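/- For every integer d ≥ 3 there is a constant C = C(d) with the following property. Let P be a set of n points in ℝ^d in general position, all of whose points are k-shallow in P, where k is an integer with 2 ≤ k ≤ n/2, and let Q be a finite nonempty set of hyperplanes in ℝ^d. Then there exist a partition of P into classes P₁, …, P_m with k ≤ |P_i| ≤ 2k for every i, and open d-simplices Δ₁, …, Δ_m with P_i ⊆ Δ_i for every i, such that every hyperplane h ∈ Q intersects at most C · ( (n/k)^{1−1/(d−1)} · (log₂(n/k))^{2/(d−1)} + log₂(|Q|+1) ) of the simplices Δ₁, …, Δ_m. -/

import Mathlib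

open scoped RealInnerProductSpace
open scoped Classical

noncomputable section

/-- A closed halfspace in `ℝ^d`. -/
def halfspace {d : ℕ} (a : EuclideanSpace ℝ (Fin d)) (b : ℝ) : Set (EuclideanSpace ℝ (Fin d)) :=
  {x | ⟪x, a⟫ ≤ b}

/-- A hyperplane in `ℝ^d`. -/
def hyperplane {d : ℕ} (a : EuclideanSpace ℝ (Fin d)) (b : ℝ) : Set (EuclideanSpace ℝ (Fin d)) :=
  {x | ⟪x, a⟫ = b}

/-- A point `p` of a finite set `P` is `k`-shallow if some closed halfspace contains `p`
and at most `k` points of `P` (including `p`). -/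
def IsShallowPt {d : ℕ} (P : Finset (EuclideanSpace ℝ (Fin d))) (k : ℕ)
    (p : EuclideanSpace ℝ (Fin d)) : Prop :=
  ∃ a b, a ≠ 0 ∧ p ∈ halfspace a b ∧
    ((P : Set (EuclideanSpace ℝ (Fin d))) ∩ halfspace a b).ncard ≤ k

/-- `P` is in general position: no `d+1` points of `P` lie on a common hyperplane. -/
def GenPos {d : ℕ} (P : Finset (EuclideanSpace ℝ (Fin d))) : Prop :=
  ∀ (a : EuclideanSpace ℝ (Fin d)) (b : ℝ), a ≠ 0 →
    ((P : Set (EuclideanSpace ℝ (Fin d))) ∩ hyperplane a b).ncard ≤ d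

/-- An open `d`-simplex: the interior of the convex hull of `d+1` affinely
independent points. -/
def IsOpenSimplex {d : ℕ} (Δ : Set (EuclideanSpace ℝ (Fin d))) : Prop :=
  ∃ v : Fin (d + 1) → EuclideanSpace ℝ (Fin d),
    AffineIndependent ℝ v ∧ Δ = interior (convexHull ℝ (Set.range v))

open Filter Topology

/-! ### Affine functionals and generic families -/

/-- The ambient Euclidean space. -/
abbrev Pt (d : ℕ) := EuclideanSpace ℝ (Fin d)

/-- The affine functional `x ↦ ⟪x, u.1⟫ - u.2`. -/
def ev {d : ℕ} (u : Pt d × ℝ) (x : Pt d) : ℝ := ⟪x, u.1⟫ - u.2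

lemma ev_add {d : ℕ} (u : Pt d × ℝ) (x v : Pt d) : ev u (x + v) = ev u x + ⟪v, u.1⟫ := by
  simp only [ev, inner_add_left]; ring

lemma ev_add_smul {d : ℕ} (u : Pt d × ℝ) (x v : Pt d) (t : ℝ) :
    ev u (x + t • v) = ev u x + t * ⟪v, u.1⟫ := by
  simp only [ev, inner_add_left, real_inner_smul_left]; ring

lemma ev_combo {d : ℕ} (u : Pt d × ℝ) (x y : Pt d) (t : ℝ) :
    ev u (x + t • (y - x)) = (1 - t) * ev u x + t * ev u y := by
  simp only [ev, inner_add_left, real_inner_smul_left, inner_sub_left]; ring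

lemma inner_sub_eq_ev {d : ℕ} (u : Pt d × ℝ) (x y : Pt d) : ⟪x - y, u.1⟫ = ev u x - ev u y := by
  simp only [ev, inner_sub_left]; ring

lemma continuous_ev {d : ℕ} (u : Pt d × ℝ) : Continuous (ev u) := by
  unfold ev; fun_prop

/-- A family of affine functionals is generic with respect to the objective `c` if any `d` of the
hyperplanes meet transversally, no `d + 1` have a common point, and the objective is nonconstant on
every flat of positive dimension. -/
structure Generic {d : ℕ} {ι : Type} (ℓ : ι → Pt d × ℝ) (c : Pt d) : Prop where
  uniq : ∀ G : Finset ι, G.card = d → ∀ v : Pt d, (∀ g ∈ G, ⟪v, (ℓ g).1⟫ = 0) → v = 0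
  card_le : ∀ (G : Finset ι) (x : Pt d), (∀ g ∈ G, ev (ℓ g) x = 0) → G.card ≤ d
  obj : ∀ G : Finset ι, G.card < d → ∃ v : Pt d, (∀ g ∈ G, ⟪v, (ℓ g).1⟫ = 0) ∧ ⟪v, c⟫ ≠ 0

lemma Generic.neg {d : ℕ} {ι : Type} {ℓ : ι → Pt d × ℝ} {c : Pt d} (h : Generic ℓ c) :
    Generic ℓ (-c) where
  uniq := h.uniq
  card_le := h.card_le
  obj G hG := by
    obtain ⟨v, h1, h2⟩ := h.obj G hG
    exact ⟨v, h1, by simpa using h2⟩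

lemma eventually_sign {d : ℕ} (u : Pt d × ℝ) (x w : Pt d) (h : ev u x ≠ 0) :
    ∀ᶠ t in 𝓝[>] (0 : ℝ), 0 < ev u (x + t • w) * ev u x := by
  have hc : Continuous fun t : ℝ => ev u (x + t • w) * ev u x := by
    have := continuous_ev u
    fun_prop
  have h0 : 0 < ev u (x + (0 : ℝ) • w) * ev u x := by
    simpa using mul_self_pos.2 h
  exact (hc.continuousAt.eventually (lt_mem_nhds h0)).filter_mono nhdsWithin_le_nhds

lemma exists_small {d : ℕ} {ι : Type} (ℓ : ι → Pt d × ℝ) (S : Finset ι) (x w : Pt d) :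
    ∃ t : ℝ, 0 < t ∧ t ≤ 1 ∧
      ∀ g ∈ S, ev (ℓ g) x ≠ 0 → 0 < ev (ℓ g) (x + t • w) * ev (ℓ g) x := by
  have h1 : ∀ᶠ t in 𝓝[>] (0 : ℝ), ∀ g ∈ S, ev (ℓ g) x ≠ 0 →
      0 < ev (ℓ g) (x + t • w) * ev (ℓ g) x := by
    rw [Filter.eventually_all_finset]
    intro g _
    by_cases h : ev (ℓ g) x = 0
    · simp [h]
    · filter_upwards [eventually_sign (ℓ g) x w h] with t ht _ using ht
  have h2 : ∀ᶠ t in 𝓝[>] (0 : ℝ), 0 < t := eventually_mem_nhdsWithin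
  have h3 : ∀ᶠ t in 𝓝[>] (0 : ℝ), t ≤ 1 :=
    ((ge_mem_nhds (by norm_num : (0 : ℝ) < 1))).filter_mono nhdsWithin_le_nhds
  obtain ⟨t, h1, h2, h3⟩ := (h1.and (h2.and h3)).exists
  exact ⟨t, h2, h3, h1⟩

/-! ### Borders of the zone -/

/-- The functionals of `S` positive at `x`. -/
def posSet {d : ℕ} {ι : Type} (ℓ : ι → Pt d × ℝ) (S : Finset ι) (x : Pt d) : Finset ι :=
  S.filter fun g => 0 < ev (ℓ g) x

/-- Sign vectors of the cells of the arrangement `S` containing a point of `Y`. -/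
def zone {d : ℕ} {ι : Type} (ℓ : ι → Pt d × ℝ) (Y : Finset (Pt d)) (S : Finset ι) :
    Finset (Finset ι) := Y.image (posSet ℓ S)

/-- The flat of `F` contains a point off the other hyperplanes of `S`, with sign vector `A`
there. -/
def IsFace {d : ℕ} {ι : Type} (ℓ : ι → Pt d × ℝ) (S F A : Finset ι) (x : Pt d) : Prop :=
  (∀ g ∈ F, ev (ℓ g) x = 0) ∧ ∀ g ∈ S, g ∉ F → ev (ℓ g) x ≠ 0 ∧ (g ∈ A ↔ 0 < ev (ℓ g) x)

/-- A face of `H ∪ F` all of whose incident cells with given signs on `F` belong to the zone. -/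
structure IsBorder {d : ℕ} {ι : Type} (ℓ : ι → Pt d × ℝ) (Y : Finset (Pt d)) (S H F A : Finset ι) :
    Prop where
  hH : H ⊆ S
  hF : F ⊆ S
  hA : A ⊆ S
  disj : Disjoint H F
  disjA : Disjoint H A
  face : ∃ x, IsFace ℓ S (H ∪ F) A x
  cells : ∀ D ⊆ H, A ∪ D ∈ zone ℓ Y S

/-- The borders with `|H| = j` and `|F| = k`. -/
def borders {d : ℕ} {ι : Type} (ℓ : ι → Pt d × ℝ) (Y : Finset (Pt d)) (S : Finset ι) (j k : ℕ) :
    Finset (Finset ι × Finset ι × Finset ι) :=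
  (S.powerset ×ˢ S.powerset ×ˢ S.powerset).filter fun t =>
    t.1.card = j ∧ t.2.1.card = k ∧ IsBorder ℓ Y S t.1 t.2.1 t.2.2

section Borders

variable {d : ℕ} {ι : Type} {ℓ : ι → Pt d × ℝ} {c : Pt d} {Y : Finset (Pt d)} {S : Finset ι}
  {j k : ℕ}

lemma mem_borders {H F A : Finset ι} : (H, F, A) ∈ borders ℓ Y S j k ↔
    H.card = j ∧ F.card = k ∧ IsBorder ℓ Y S H F A := by
  simp only [borders, Finset.mem_filter, Finset.mem_product, Finset.mem_powerset]
  constructor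
  · rintro ⟨-, h⟩; exact h
  · intro h; exact ⟨⟨h.2.2.hH, h.2.2.hF, h.2.2.hA⟩, h⟩

lemma card_borders_le : (borders ℓ Y S j k).card ≤ 8 ^ S.card := by
  refine (Finset.card_filter_le _ _).trans ?_
  rw [Finset.card_product, Finset.card_product, Finset.card_powerset]
  rw [show (8 : ℕ) = 2 * (2 * 2) by norm_num, mul_pow, mul_pow]

lemma zone_erase {A : Finset ι} (h : A ∈ zone ℓ Y S) (g : ι) :
    A.erase g ∈ zone ℓ Y (S.erase g) := by
  simp only [zone, Finset.mem_image] at h ⊢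
  obtain ⟨y, hy, rfl⟩ := h
  refine ⟨y, hy, ?_⟩
  ext i
  simp only [posSet, Finset.mem_filter, Finset.mem_erase]
  tauto

lemma IsBorder.erase {H F A : Finset ι} (h : IsBorder ℓ Y S H F A) {g : ι} (hg : g ∉ H)
    (hg' : g ∉ F) : IsBorder ℓ Y (S.erase g) H F (A.erase g) where
  hH := Finset.subset_erase.2 ⟨h.hH, hg⟩
  hF := Finset.subset_erase.2 ⟨h.hF, hg'⟩
  hA := Finset.erase_subset_erase _ h.hA
  disj := h.disj
  disjA := h.disjA.mono_right (Finset.erase_subset _ _)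
  face := by
    obtain ⟨x, h1, h2⟩ := h.face
    refine ⟨x, h1, fun i hi hi' => ?_⟩
    have := h2 i (Finset.mem_of_mem_erase hi) hi'
    simp only [Finset.mem_erase] at hi ⊢
    tauto
  cells := by
    intro D hD
    have := zone_erase (h.cells D hD) g
    rwa [Finset.erase_union_distrib, Finset.erase_eq_of_notMem (fun hh => hg (hD hh))] at this

lemma IsBorder.merge {H F A : Finset ι} {g : ι} (hgS : g ∈ S) (hgH : g ∉ H) (hgF : g ∉ F)
    (hgA : g ∉ A) (h : IsBorder ℓ Y S H F A) (h' : IsBorder ℓ Y S H F (insert g A)) :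
    IsBorder ℓ Y S (insert g H) F A where
  hH := Finset.insert_subset hgS h.hH
  hF := h.hF
  hA := h.hA
  disj := by simp [Finset.disjoint_insert_left, hgF, h.disj]
  disjA := by simp [Finset.disjoint_insert_left, hgA, h.disjA]
  face := by
    obtain ⟨x, h1, h2⟩ := h.face
    obtain ⟨y, h1', h2'⟩ := h'.face
    have hgU : g ∉ H ∪ F := by simp [hgH, hgF]
    have hx : ev (ℓ g) x < 0 := by
      have := h2 g hgS hgU
      have h3 := this.2.not.1 hgA
      exact lt_of_le_of_ne (not_lt.1 h3) this.1
    have hy : 0 < ev (ℓ g) y := (h2' g hgS hgU).2.1 (Finset.mem_insert_self _ _)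
    set t := ev (ℓ g) x / (ev (ℓ g) x - ev (ℓ g) y) with ht
    have hden : ev (ℓ g) x - ev (ℓ g) y < 0 := by linarith
    have ht0 : 0 < t := div_pos_of_neg_of_neg hx hden
    have ht1 : t < 1 := by
      rw [ht, div_lt_one_of_neg hden]; linarith
    refine ⟨x + t • (y - x), fun i hi => ?_, fun i hi hi' => ?_⟩
    · rw [ev_combo]
      rw [Finset.insert_union, Finset.mem_insert] at hi
      rcases hi with rfl | hi
      · rw [ht]; field_simp [hden.ne]; ring
      · rw [h1 i hi, h1' i hi]; ring
    · rw [Finset.insert_union, Finset.mem_insert, not_or] at hi'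
      have e1 := h2 i hi hi'.2
      have e2 := h2' i hi hi'.2
      rw [Finset.mem_insert, or_iff_right hi'.1] at e2
      rw [ev_combo]
      by_cases hiA : i ∈ A
      · have a1 := e1.2.1 hiA
        have a2 := e2.2.1 hiA
        have : 0 < (1 - t) * ev (ℓ i) x + t * ev (ℓ i) y := by
          have := mul_pos (sub_pos.2 ht1) a1
          have := mul_pos ht0 a2
          linarith
        exact ⟨this.ne', by simp [hiA, this]⟩
      · have a1 : ev (ℓ i) x < 0 := lt_of_le_of_ne (not_lt.1 (e1.2.not.1 hiA)) e1.1
        have a2 : ev (ℓ i) y < 0 := lt_of_le_of_ne (not_lt.1 (e2.2.not.1 hiA)) e2.1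
        have : (1 - t) * ev (ℓ i) x + t * ev (ℓ i) y < 0 := by
          have := mul_neg_of_pos_of_neg (sub_pos.2 ht1) a1
          have := mul_neg_of_pos_of_neg ht0 a2
          linarith
        exact ⟨this.ne, by simp [hiA, this.le]⟩
  cells := by
    intro D hD
    by_cases hgD : g ∈ D
    · have := h'.cells (D.erase g) (by
        intro i hi
        have := hD (Finset.mem_of_mem_erase hi)
        rw [Finset.mem_insert] at this
        exact this.resolve_left (Finset.ne_of_mem_erase hi))
      rwa [Finset.insert_union, ← Finset.union_insert, Finset.insert_erase hgD] at this
    · refine h.cells D fun i hi => ?_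
      have := hD hi
      rw [Finset.mem_insert] at this
      exact this.resolve_left (fun e => hgD (e ▸ hi))

/-- Erasing `g` and forgetting its sign is two-to-one, and its double points are borders of `g`. -/
lemma card_filter_borders_le {g : ι} (hg : g ∈ S) :
    ((borders ℓ Y S j k).filter fun t => g ∉ t.1 ∧ g ∉ t.2.1).card ≤
      (borders ℓ Y (S.erase g) j k).card +
        ((borders ℓ Y S (j + 1) k).filter fun t => g ∈ t.1).card := by
  set T := (borders ℓ Y S j k).filter fun t => g ∉ t.1 ∧ g ∉ t.2.1 with hT
  let μ : Finset ι × Finset ι × Finset ι → Finset ι × Finset ι × Finset ι :=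
    fun t => (t.1, t.2.1, t.2.2.erase g)
  set T1 := T.filter fun t => g ∈ t.2.2
  set T0 := T.filter fun t => ¬ g ∈ t.2.2
  have hsum : T1.card + T0.card = T.card := Finset.card_filter_add_card_filter_not _
  have i1 : (T1.image μ).card = T1.card := by
    refine Finset.card_image_of_injOn ?_
    rintro ⟨H, F, A⟩ h ⟨H', F', A'⟩ h' e
    simp only [T1, Finset.coe_filter, Set.mem_ofPred_eq] at h h'
    simp only [μ, Prod.mk.injEq] at e
    obtain ⟨rfl, rfl, e⟩ := e
    have := congrArg (insert g) e
    rw [Finset.insert_erase h.2, Finset.insert_erase h'.2] at this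
    rw [this]
  have i0 : (T0.image μ).card = T0.card := by
    refine Finset.card_image_of_injOn ?_
    rintro ⟨H, F, A⟩ h ⟨H', F', A'⟩ h' e
    simp only [T0, Finset.coe_filter, Set.mem_ofPred_eq] at h h'
    simp only [μ, Prod.mk.injEq] at e
    obtain ⟨rfl, rfl, e⟩ := e
    rw [Finset.erase_eq_of_notMem h.2, Finset.erase_eq_of_notMem h'.2] at e
    rw [e]
  have hmap : ∀ t ∈ T, μ t ∈ borders ℓ Y (S.erase g) j k := by
    rintro ⟨H, F, A⟩ h
    simp only [hT, Finset.mem_filter, mem_borders] at h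
    exact mem_borders.2 ⟨h.1.1, h.1.2.1, h.1.2.2.erase h.2.1 h.2.2⟩
  have hU : (T1.image μ ∪ T0.image μ).card ≤ (borders ℓ Y (S.erase g) j k).card := by
    refine Finset.card_le_card (Finset.union_subset ?_ ?_) <;>
    · refine Finset.image_subset_iff.2 fun t ht => hmap t (Finset.mem_of_mem_filter _ ht)
  have hI : (T1.image μ ∩ T0.image μ).card ≤
      ((borders ℓ Y S (j + 1) k).filter fun t => g ∈ t.1).card := by
    refine Finset.card_le_card_of_injOn (fun t => (insert g t.1, t.2.1, t.2.2)) ?_ ?_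
    · rintro ⟨H, F, A⟩ h
      simp only [Finset.coe_inter, Set.mem_inter_iff, Finset.mem_coe, Finset.mem_image] at h
      obtain ⟨⟨⟨H1, F1, A1⟩, h1, e1⟩, ⟨⟨H2, F2, A2⟩, h2, e2⟩⟩ := h
      simp only [μ, Prod.mk.injEq] at e1 e2
      obtain ⟨rfl, rfl, e1⟩ := e1
      obtain ⟨rfl, rfl, e2⟩ := e2
      simp only [T1, T0, hT, Finset.mem_filter, mem_borders] at h1 h2
      rw [Finset.erase_eq_of_notMem h2.2] at e2
      subst e2
      have e3 : A1 = insert g A2 := by rw [← e1, Finset.insert_erase h1.2]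
      subst e3
      simp only [Finset.coe_filter, Set.mem_ofPred_eq, mem_borders]
      refine ⟨⟨?_, h1.1.1.2.1, ?_⟩, Finset.mem_insert_self _ _⟩
      · rw [Finset.card_insert_of_notMem h1.1.2.1, h1.1.1.1]
      · exact h2.1.1.2.2.merge hg h1.1.2.1 h1.1.2.2 h2.2 h1.1.1.2.2
    · rintro ⟨H, F, A⟩ h ⟨H', F', A'⟩ h' e
      simp only [Prod.mk.injEq] at e
      have key : ∀ {H F A : Finset ι}, (H, F, A) ∈ ((T1.image μ ∩ T0.image μ : Finset _) : Set _) →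
          g ∉ H := by
        intro H F A h
        simp only [Finset.coe_inter, Set.mem_inter_iff, Finset.mem_coe, Finset.mem_image] at h
        obtain ⟨⟨⟨H1, F1, A1⟩, h1, e1⟩, -⟩ := h
        simp only [μ, Prod.mk.injEq] at e1
        obtain ⟨rfl, rfl, e1⟩ := e1
        simp only [T1, hT, Finset.mem_filter] at h1
        exact h1.1.2.1
      have a := key h
      have b := key h'
      obtain ⟨e, rfl, rfl⟩ := e
      have := congrArg (fun s => Finset.erase s g) e
      simp only [Finset.erase_insert a, Finset.erase_insert b] at this
      rw [this]
  have := Finset.card_union_add_card_inter (T1.image μ) (T0.image μ)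
  omega

/-- The deletion recurrence for the number of borders. -/
lemma borders_recurrence :
    (S.card - (j + k)) * (borders ℓ Y S j k).card ≤
      ∑ g ∈ S, (borders ℓ Y (S.erase g) j k).card + (j + 1) * (borders ℓ Y S (j + 1) k).card := by
  have h1 : ∑ g ∈ S, ((borders ℓ Y S j k).filter fun t => g ∉ t.1 ∧ g ∉ t.2.1).card =
      ∑ t ∈ borders ℓ Y S j k, (S.filter fun g => g ∉ t.1 ∧ g ∉ t.2.1).card := by
    have := Finset.sum_card_bipartiteAbove_eq_sum_card_bipartiteBelow
      (fun (g : ι) (t : Finset ι × Finset ι × Finset ι) => g ∉ t.1 ∧ g ∉ t.2.1)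
      (s := S) (t := borders ℓ Y S j k)
    exact this
  have h2 : ∑ g ∈ S, ((borders ℓ Y S (j + 1) k).filter fun t => g ∈ t.1).card =
      ∑ t ∈ borders ℓ Y S (j + 1) k, (S.filter fun g => g ∈ t.1).card := by
    have := Finset.sum_card_bipartiteAbove_eq_sum_card_bipartiteBelow
      (fun (g : ι) (t : Finset ι × Finset ι × Finset ι) => g ∈ t.1)
      (s := S) (t := borders ℓ Y S (j + 1) k)
    exact this
  have h3 : ∑ t ∈ borders ℓ Y S j k, (S.filter fun g => g ∉ t.1 ∧ g ∉ t.2.1).card =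
      (S.card - (j + k)) * (borders ℓ Y S j k).card := by
    rw [mul_comm, ← smul_eq_mul]
    refine Finset.sum_eq_card_nsmul ?_
    rintro ⟨H, F, A⟩ ht
    obtain ⟨hj, hk, hb⟩ := mem_borders.1 ht
    have : (S.filter fun g => g ∉ H ∧ g ∉ F) = S \ (H ∪ F) := by
      ext i; simp [not_or]
    simp only [this]
    rw [Finset.card_sdiff_of_subset (Finset.union_subset hb.hH hb.hF),
      Finset.card_union_of_disjoint hb.disj, hj, hk]
  have h4 : ∑ t ∈ borders ℓ Y S (j + 1) k, (S.filter fun g => g ∈ t.1).card =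
      (j + 1) * (borders ℓ Y S (j + 1) k).card := by
    rw [mul_comm, ← smul_eq_mul]
    refine Finset.sum_eq_card_nsmul ?_
    rintro ⟨H, F, A⟩ ht
    obtain ⟨hj, hk, hb⟩ := mem_borders.1 ht
    have : (S.filter fun g => g ∈ H) = H := by
      ext i; simp only [Finset.mem_filter]; exact ⟨fun h => h.2, fun h => ⟨hb.hH h, h⟩⟩
    simp only [this, hj]
  rw [← h3, ← h1, ← h4, ← h2, ← Finset.sum_add_distrib]
  exact Finset.sum_le_sum fun g hg => card_filter_borders_le hg

end Borders

section VertexEdge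

variable {d : ℕ} {ι : Type} {ℓ : ι → Pt d × ℝ} {c : Pt d} {Y : Finset (Pt d)} {S : Finset ι}
  {j k : ℕ}

lemma Generic.exists_edges (h : Generic ℓ c) {G : Finset ι} (hG : G.card = d) :
    ∃ e : ι → Pt d, ∀ g ∈ G, (∀ g' ∈ G, g' ≠ g → ⟪e g, (ℓ g').1⟫ = 0) ∧ ⟪e g, c⟫ = 1 ∧
      ⟪e g, (ℓ g).1⟫ ≠ 0 := by
  have : ∀ g ∈ G, ∃ v : Pt d, (∀ g' ∈ G, g' ≠ g → ⟪v, (ℓ g').1⟫ = 0) ∧ ⟪v, c⟫ = 1 ∧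
      ⟪v, (ℓ g).1⟫ ≠ 0 := by
    intro g hg
    obtain ⟨v, hv, hc⟩ := h.obj (G.erase g) (hG ▸ Finset.card_erase_lt_of_mem hg)
    have h1 : ∀ g' ∈ G, g' ≠ g → ⟪(⟪v, c⟫)⁻¹ • v, (ℓ g').1⟫ = 0 := by
      intro g' hg' hne
      rw [real_inner_smul_left, hv g' (Finset.mem_erase.2 ⟨hne, hg'⟩), mul_zero]
    have h2 : ⟪(⟪v, c⟫)⁻¹ • v, c⟫ = 1 := by
      rw [real_inner_smul_left, inv_mul_cancel₀ hc]
    refine ⟨(⟪v, c⟫)⁻¹ • v, h1, h2, fun h3 => ?_⟩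
    have : (⟪v, c⟫)⁻¹ • v = 0 := by
      refine h.uniq G hG _ fun g' hg' => ?_
      by_cases e : g' = g
      · rw [e, h3]
      · exact h1 g' hg' e
    rw [this, inner_zero_left] at h2
    exact zero_ne_one h2
  choose! e he using this
  exact ⟨e, he⟩

/-- The vertices of `G` is the unique minimum of the objective on the closed face of `F` with
signs `A`. -/
lemma Generic.vertex_min (h : Generic ℓ c) {G F A : Finset ι} (hG : G.card = d) {e : ι → Pt d}
    (he : ∀ g ∈ G, (∀ g' ∈ G, g' ≠ g → ⟪e g, (ℓ g').1⟫ = 0) ∧ ⟪e g, c⟫ = 1 ∧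
      ⟪e g, (ℓ g).1⟫ ≠ 0) {x : Pt d} (hx : ∀ g ∈ G, ev (ℓ g) x = 0)
    (hA : ∀ g ∈ G, g ∉ F → (g ∈ A ↔ 0 < ⟪e g, (ℓ g).1⟫)) {y : Pt d}
    (hyF : ∀ g ∈ F, ev (ℓ g) y = 0)
    (hyA : ∀ g ∈ G, g ∉ F → (g ∈ A → 0 ≤ ev (ℓ g) y) ∧ (g ∉ A → ev (ℓ g) y ≤ 0)) :
    ⟪x, c⟫ ≤ ⟪y, c⟫ ∧ (⟪x, c⟫ = ⟪y, c⟫ → x = y) := by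
  have key : y - x = ∑ g ∈ G, (ev (ℓ g) y / ⟪e g, (ℓ g).1⟫) • e g := by
    rw [← sub_eq_zero]
    refine h.uniq G hG _ fun g hg => ?_
    rw [inner_sub_left, inner_sub_eq_ev, sum_inner, Finset.sum_eq_single_of_mem g hg]
    · rw [real_inner_smul_left, hx g hg]
      field_simp [(he g hg).2.2]
      simp
    · intro b hb hne
      rw [real_inner_smul_left, (he b hb).1 g hg hne.symm, mul_zero]
  have hterm : ∀ g ∈ G, 0 ≤ ev (ℓ g) y / ⟪e g, (ℓ g).1⟫ := by
    intro g hg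
    by_cases hgF : g ∈ F
    · rw [hyF g hgF, zero_div]
    · by_cases hgA : g ∈ A
      · exact div_nonneg ((hyA g hg hgF).1 hgA) ((hA g hg hgF).1 hgA).le
      · exact div_nonneg_of_nonpos ((hyA g hg hgF).2 hgA)
          (not_lt.1 ((hA g hg hgF).not.1 hgA))
  have hsum : ⟪y, c⟫ - ⟪x, c⟫ = ∑ g ∈ G, ev (ℓ g) y / ⟪e g, (ℓ g).1⟫ := by
    rw [← inner_sub_left, key, sum_inner]
    refine Finset.sum_congr rfl fun g hg => ?_
    rw [real_inner_smul_left, (he g hg).2.1, mul_one]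
  refine ⟨by have := Finset.sum_nonneg hterm; linarith, fun heq => ?_⟩
  rw [heq, sub_self] at hsum
  have h0 := (Finset.sum_eq_zero_iff_of_nonneg hterm).1 hsum.symm
  have : y - x = 0 := by
    rw [key]
    exact Finset.sum_eq_zero fun g hg => by rw [h0 g hg, zero_smul]
  exact (sub_eq_zero.1 this).symm

/-- The closed face of `F` with signs `A`. -/
def WeakFace (ℓ : ι → Pt d × ℝ) (S F A : Finset ι) (y : Pt d) : Prop :=
  (∀ g ∈ F, ev (ℓ g) y = 0) ∧ ∀ g ∈ S, g ∉ F →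
    (g ∈ A → 0 ≤ ev (ℓ g) y) ∧ (g ∉ A → ev (ℓ g) y ≤ 0)

/-- A vertex border is the optimum of a border of dimension at least `d / 2`. -/
lemma Generic.exists_optimal_border (h : Generic ℓ c) {H F A : Finset ι}
    (hb : IsBorder ℓ Y S H F A) (hG : (H ∪ F).card = d) {e : ι → Pt d}
    (he : ∀ g ∈ H ∪ F, (∀ g' ∈ H ∪ F, g' ≠ g → ⟪e g, (ℓ g').1⟫ = 0) ∧ ⟪e g, c⟫ = 1 ∧
      ⟪e g, (ℓ g).1⟫ ≠ 0) {m : ℕ} (hm : m ≤ F.card)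
    (hU : F.card - m ≤ (F.filter fun g => g ∈ A ↔ 0 < ⟪e g, (ℓ g).1⟫).card) :
    ∃ F' A', (∅, F', A') ∈ borders ℓ Y S 0 m ∧ F' ⊆ F ∧ A' \ H = A ∧
      ∃ x, IsFace ℓ S (H ∪ F) A x ∧ ∀ y, WeakFace ℓ S F' A' y →
        ⟪x, c⟫ ≤ ⟪y, c⟫ ∧ (⟪x, c⟫ = ⟪y, c⟫ → x = y) := by
  obtain ⟨F0, hF0, hF0c⟩ := Finset.exists_subset_card_eq hU
  obtain ⟨x, hx, hx'⟩ := hb.face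
  set D := H.filter fun g => 0 < ⟪e g, (ℓ g).1⟫ with hD
  have hF0F : F0 ⊆ F := hF0.trans (Finset.filter_subset _ _)
  have hsg : ∀ g ∈ H ∪ F, g ∉ F \ F0 → (g ∈ A ∪ D ↔ 0 < ⟪e g, (ℓ g).1⟫) := by
    intro g hg hg'
    rw [Finset.mem_union] at hg ⊢
    rcases hg with hg | hg
    · have : g ∉ A := Finset.disjoint_left.1 hb.disjA hg
      simp [hD, hg, this]
    · have h1 : g ∉ H := fun h2 => Finset.disjoint_left.1 hb.disj h2 hg
      have h2 : g ∈ F0 := by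
        by_contra h3; exact hg' (Finset.mem_sdiff.2 ⟨hg, h3⟩)
      have h3 := (Finset.mem_filter.1 (hF0 h2)).2
      simp [hD, h1, h3]
  refine ⟨F \ F0, A ∪ D, mem_borders.2 ⟨rfl, ?_, ?_⟩, Finset.sdiff_subset, ?_, x, ⟨hx, hx'⟩, ?_⟩
  · rw [Finset.card_sdiff_of_subset hF0F, hF0c]; omega
  · refine ⟨Finset.empty_subset _, Finset.sdiff_subset.trans hb.hF, Finset.union_subset hb.hA
      ((Finset.filter_subset _ _).trans hb.hH), Finset.disjoint_empty_left _,
      Finset.disjoint_empty_left _, ?_, ?_⟩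
    · obtain ⟨t, ht, -, hts⟩ := exists_small ℓ S x (∑ g ∈ (H ∪ F) \ (F \ F0), e g)
      have hval : ∀ g ∈ H ∪ F, ev (ℓ g) (x + t • ∑ g ∈ (H ∪ F) \ (F \ F0), e g) =
          if g ∈ F \ F0 then 0 else t * ⟪e g, (ℓ g).1⟫ := by
        intro g hg
        rw [ev_add_smul, hx g hg, zero_add, sum_inner]
        split_ifs with hgF
        · rw [Finset.sum_eq_zero, mul_zero]
          intro b hb'
          rw [Finset.mem_sdiff] at hb'
          exact (he b hb'.1).1 g hg (fun e => hb'.2 (e ▸ hgF))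
        · rw [Finset.sum_eq_single_of_mem g (Finset.mem_sdiff.2 ⟨hg, hgF⟩)]
          intro b hb' hne
          exact (he b (Finset.mem_sdiff.1 hb').1).1 g hg hne.symm
      refine ⟨x + t • ∑ g ∈ (H ∪ F) \ (F \ F0), e g, fun g hg => ?_, fun g hg hg' => ?_⟩
      · rw [Finset.empty_union] at hg
        rw [hval g (Finset.mem_union_right _ (Finset.sdiff_subset hg)), if_pos hg]
      · rw [Finset.empty_union] at hg'
        by_cases hgG : g ∈ H ∪ F
        · rw [hval g hgG, if_neg hg', hsg g hgG hg', mul_pos_iff_of_pos_left ht]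
          exact ⟨mul_ne_zero ht.ne' (he g hgG).2.2, Iff.rfl⟩
        · obtain ⟨h1, h2⟩ := hx' g hg hgG
          have h3 := hts g hg h1
          refine ⟨fun h4 => by rw [h4, zero_mul] at h3; exact h3.false, ?_⟩
          have h5 : g ∉ D := fun h5 => hgG (Finset.mem_union_left _ (Finset.mem_filter.1 h5).1)
          rw [Finset.mem_union, or_iff_left h5, h2]
          exact (pos_iff_pos_of_mul_pos h3).symm
    · intro D' hD'
      rw [Finset.subset_empty.1 hD', Finset.union_empty]
      exact hb.cells D (Finset.filter_subset _ _)
  · ext g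
    have := fun hg : g ∈ H => Finset.disjoint_left.1 hb.disjA hg
    simp only [hD, Finset.mem_sdiff, Finset.mem_union, Finset.mem_filter]
    tauto
  · rintro y ⟨hy, hy'⟩
    refine h.vertex_min hG he hx hsg hy fun g hg hgF => hy' g ?_ hgF
    exact Finset.union_subset hb.hH hb.hF hg

/-- Vertex borders are counted by borders of half the codimension. -/
lemma Generic.card_vertex_borders_le (h : Generic ℓ c) (hjk : j + k = d) :
    (borders ℓ Y S j k).card ≤ 2 ^ (d + 1) * (borders ℓ Y S 0 (k / 2)).card := by
  let cc : Bool → Pt d := fun b => if b then c else -c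
  let r : Finset ι × Finset ι × Finset ι → (Finset ι × Finset ι × Finset ι) × Bool → Prop :=
    fun t s => s.1.2.1 ⊆ t.2.1 ∧ s.1.2.2 \ t.1 = t.2.2 ∧
      ∃ x, IsFace ℓ S (t.1 ∪ t.2.1) t.2.2 x ∧ ∀ y, WeakFace ℓ S s.1.2.1 s.1.2.2 y →
        ⟪x, cc s.2⟫ ≤ ⟪y, cc s.2⟫ ∧ (⟪x, cc s.2⟫ = ⟪y, cc s.2⟫ → x = y)
  have main := Finset.card_mul_le_card_mul r (s := borders ℓ Y S j k)
    (t := borders ℓ Y S 0 (k / 2) ×ˢ (Finset.univ : Finset Bool)) (m := 1) (n := 2 ^ d) ?_ ?_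
  · rw [mul_one, Finset.card_product, Finset.card_univ, Fintype.card_bool] at main
    calc _ ≤ _ := main
      _ = _ := by ring
  · rintro ⟨H, F, A⟩ ht
    obtain ⟨hj, hk, hb⟩ := mem_borders.1 ht
    have hG : (H ∪ F).card = d := by rw [Finset.card_union_of_disjoint hb.disj]; omega
    obtain ⟨e, he⟩ := h.exists_edges hG
    have hm : k / 2 ≤ F.card := by omega
    have hsplit := Finset.card_filter_add_card_filter_not (s := F)
      (fun g => g ∈ A ↔ 0 < ⟪e g, (ℓ g).1⟫)
    rw [Finset.one_le_card]
    by_cases hU : F.card - k / 2 ≤ (F.filter fun g => g ∈ A ↔ 0 < ⟪e g, (ℓ g).1⟫).card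
    · obtain ⟨F', A', h1, h2, h3, h4⟩ := h.exists_optimal_border hb hG he hm hU
      refine ⟨((∅, F', A'), true), ?_⟩
      rw [Finset.mem_bipartiteAbove]
      exact ⟨Finset.mem_product.2 ⟨h1, Finset.mem_univ _⟩, h2, h3, by simpa [cc] using h4⟩
    · have hneg : F.filter (fun g => ¬ (g ∈ A ↔ 0 < ⟪e g, (ℓ g).1⟫)) =
          F.filter fun g => g ∈ A ↔ 0 < ⟪-e g, (ℓ g).1⟫ := by
        refine Finset.filter_congr fun g hg => ?_
        have := (he g (Finset.mem_union_right _ hg)).2.2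
        rw [inner_neg_left, neg_pos, not_iff, iff_comm, ← not_iff_comm, not_lt, iff_comm]
        rw [← le_iff_lt_or_eq.trans (or_iff_left this)]
        tauto
      rw [hneg] at hsplit
      have hU' : F.card - k / 2 ≤ (F.filter fun g => g ∈ A ↔ 0 < ⟪-e g, (ℓ g).1⟫).card := by
        omega
      obtain ⟨F', A', h1, h2, h3, h4⟩ := h.neg.exists_optimal_border (e := fun g => -e g) hb hG
        (fun g hg => ⟨fun g' hg' hne => by rw [inner_neg_left, (he g hg).1 g' hg' hne, neg_zero],
          by rw [inner_neg_neg, (he g hg).2.1],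
          by rw [inner_neg_left]; exact neg_ne_zero.2 (he g hg).2.2⟩) hm hU'
      refine ⟨((∅, F', A'), false), ?_⟩
      rw [Finset.mem_bipartiteAbove]
      exact ⟨Finset.mem_product.2 ⟨h1, Finset.mem_univ _⟩, h2, h3, by simpa [cc] using h4⟩
  · rintro ⟨⟨H', F', A'⟩, b⟩ -
    have hkey : ∀ {H1 F1 A1 H2 F2 A2 : Finset ι} {x1 x2 : Pt d},
        IsFace ℓ S (H1 ∪ F1) A1 x1 → F' ⊆ F2 → A' \ H2 = A2 → IsFace ℓ S (H2 ∪ F2) A2 x2 →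
        (∀ y, WeakFace ℓ S F' A' y →
          ⟪x1, cc b⟫ ≤ ⟪y, cc b⟫ ∧ (⟪x1, cc b⟫ = ⟪y, cc b⟫ → x1 = y)) →
        ⟪x1, cc b⟫ ≤ ⟪x2, cc b⟫ ∧ (⟪x1, cc b⟫ = ⟪x2, cc b⟫ → x1 = x2) := by
      intro H1 F1 A1 H2 F2 A2 x1 x2 _ hF hA hx2 hmin
      refine hmin x2 ⟨fun g hg => hx2.1 g (Finset.mem_union_right _ (hF hg)), fun g hg hg' => ?_⟩
      by_cases hgG : g ∈ H2 ∪ F2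
      · rw [hx2.1 g hgG]; simp
      · have h1 := hx2.2 g hg hgG
        have h2 : g ∈ A' ↔ g ∈ A2 := by
          rw [← hA, Finset.mem_sdiff]
          simp only [Finset.mem_union, not_or] at hgG
          tauto
        rw [h2, h1.2, not_lt]
        exact ⟨le_of_lt, id⟩
    by_cases hne : (Finset.bipartiteBelow r (borders ℓ Y S j k) ((H', F', A'), b)).Nonempty
    swap
    · rw [Finset.not_nonempty_iff_eq_empty.1 hne, Finset.card_empty]; positivity
    obtain ⟨⟨H0, F0, A0⟩, h0⟩ := hne
    rw [Finset.mem_bipartiteBelow] at h0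
    obtain ⟨h0b, h0F, h0A, x0, hx0, h0min⟩ := h0
    obtain ⟨h0j, h0k, h0b⟩ := mem_borders.1 h0b
    have hG0 : (H0 ∪ F0).card = d := by rw [Finset.card_union_of_disjoint h0b.disj]; omega
    suffices hle : (Finset.bipartiteBelow r (borders ℓ Y S j k) ((H', F', A'), b)).card ≤
        (H0 ∪ F0).powerset.card by rwa [Finset.card_powerset, hG0] at hle
    have hsame : ∀ {H F A : Finset ι},
        (H, F, A) ∈ Finset.bipartiteBelow r (borders ℓ Y S j k) ((H', F', A'), b) →
        H ∪ F = H0 ∪ F0 ∧ A' \ H = A ∧ Disjoint H F := by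
      intro H F A hh
      rw [Finset.mem_bipartiteBelow] at hh
      obtain ⟨hb, hF, hA, x, hx, hmin⟩ := hh
      obtain ⟨-, -, hb⟩ := mem_borders.1 hb
      refine ⟨?_, hA, hb.disj⟩
      have e1 := hkey hx h0F h0A hx0 hmin
      have e2 := hkey hx0 hF hA hx h0min
      have e3 : x = x0 := e1.2 (le_antisymm e1.1 e2.1)
      subst e3
      ext g
      constructor
      · intro hg
        by_contra hg'
        exact (hx0.2 g (Finset.union_subset hb.hH hb.hF hg) hg').1 (hx.1 g hg)
      · intro hg
        by_contra hg'
        exact (hx.2 g (Finset.union_subset h0b.hH h0b.hF hg) hg').1 (hx0.1 g hg)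
    refine Finset.card_le_card_of_injOn (fun t => t.1) ?_ ?_
    · rintro ⟨H, F, A⟩ hh
      have := (hsame (Finset.mem_coe.1 hh)).1
      simp only [Finset.coe_powerset, Set.mem_preimage, Set.mem_powerset_iff, Finset.coe_subset]
      rw [← this]
      exact Finset.subset_union_left
    · rintro ⟨H, F, A⟩ h1 ⟨H2, F2, A2⟩ h2 e
      obtain ⟨a1, b1, c1⟩ := hsame (Finset.mem_coe.1 h1)
      obtain ⟨a2, b2, c2⟩ := hsame (Finset.mem_coe.1 h2)
      simp only at e
      subst e
      have e1 : F = F2 := by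
        rw [← Finset.union_sdiff_cancel_left c1, a1, ← a2, Finset.union_sdiff_cancel_left c2]
      rw [e1, ← b1, ← b2]

/-- Edge borders are counted by their endpoints. -/
lemma Generic.card_edge_borders_le (h : Generic ℓ c) (hjk : j + k + 1 = d) (hS : d ≤ S.card) :
    (borders ℓ Y S j k).card ≤ d * (borders ℓ Y S j (k + 1)).card := by
  let r : Finset ι × Finset ι × Finset ι → Finset ι × Finset ι × Finset ι → Prop :=
    fun t s => t.1 = s.1 ∧ t.2.2 = s.2.2 ∧ ∃ g ∈ s.2.1, s.2.1.erase g = t.2.1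
  have main := Finset.card_mul_le_card_mul r (s := borders ℓ Y S j k)
    (t := borders ℓ Y S j (k + 1)) (m := 1) (n := d) ?_ ?_
  · rw [mul_one] at main
    calc _ ≤ _ := main
      _ = _ := by ring
  · rintro ⟨H, F, A⟩ ht
    obtain ⟨hj, hk, hb⟩ := mem_borders.1 ht
    obtain ⟨x, hx, hx'⟩ := hb.face
    have hG : (H ∪ F).card = j + k := by rw [Finset.card_union_of_disjoint hb.disj]; omega
    obtain ⟨v, hv, hvc⟩ := h.obj (H ∪ F) (by omega)
    have hs : ∀ g ∈ S \ (H ∪ F), ⟪v, (ℓ g).1⟫ ≠ 0 := by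
      intro g hg h0
      have : v = 0 := by
        refine h.uniq (insert g (H ∪ F)) ?_ v ?_
        · rw [Finset.card_insert_of_notMem (Finset.mem_sdiff.1 hg).2]; omega
        · intro i hi
          rcases Finset.mem_insert.1 hi with rfl | hi
          · exact h0
          · exact hv i hi
      rw [this, inner_zero_left] at hvc
      exact hvc rfl
    have hne : (S \ (H ∪ F)).Nonempty := by
      rw [← Finset.card_pos, Finset.card_sdiff_of_subset (Finset.union_subset hb.hH hb.hF)]
      omega
    obtain ⟨g0, hg0, hmin⟩ := Finset.exists_min_image (S \ (H ∪ F))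
      (fun g => |ev (ℓ g) x / ⟪v, (ℓ g).1⟫|) hne
    obtain ⟨hg0S, hg0G⟩ := Finset.mem_sdiff.1 hg0
    rw [Finset.mem_union, not_or] at hg0G
    set t0 := -(ev (ℓ g0) x / ⟪v, (ℓ g0).1⟫) with ht0
    have hz : ∀ i ∈ insert g0 (H ∪ F), ev (ℓ i) (x + t0 • v) = 0 := by
      intro i hi
      rw [ev_add_smul]
      rcases Finset.mem_insert.1 hi with rfl | hi
      · rw [ht0]; field_simp [hs i hg0]; ring
      · rw [hx i hi, hv i hi]; ring
    rw [Finset.one_le_card]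
    refine ⟨(H, insert g0 F, A), ?_⟩
    rw [Finset.mem_bipartiteAbove]
    refine ⟨mem_borders.2 ⟨hj, by rw [Finset.card_insert_of_notMem hg0G.2, hk], hb.hH,
      Finset.insert_subset hg0S hb.hF, hb.hA,
      by simp [Finset.disjoint_insert_right, hg0G.1, hb.disj], hb.disjA,
      ⟨x + t0 • v, ?_, ?_⟩, hb.cells⟩,
      rfl, rfl, g0, Finset.mem_insert_self _ _, Finset.erase_insert hg0G.2⟩
    · rwa [Finset.union_insert]
    · rw [Finset.union_insert]
      intro g hg hgn
      rw [Finset.mem_insert, not_or] at hgn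
      have hgm : g ∈ S \ (H ∪ F) := Finset.mem_sdiff.2 ⟨hg, hgn.2⟩
      obtain ⟨h1, h2⟩ := hx' g hg hgn.2
      have hnz : ev (ℓ g) (x + t0 • v) ≠ 0 := by
        intro h0
        have := h.card_le (insert g (insert g0 (H ∪ F))) (x + t0 • v) (fun i hi => by
          rcases Finset.mem_insert.1 hi with rfl | hi
          · exact h0
          · exact hz i hi)
        rw [Finset.card_insert_of_notMem (by rw [Finset.mem_insert, not_or]; exact hgn),
          Finset.card_insert_of_notMem (by simp [hg0G])] at this
        omega
      refine ⟨hnz, h2.trans ?_⟩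
      have hsg := hs g hgm
      have hle := hmin g hgm
      set τ := ev (ℓ g) x / ⟪v, (ℓ g).1⟫ with hτ
      have e1 : ev (ℓ g) x = τ * ⟪v, (ℓ g).1⟫ := by rw [hτ]; field_simp
      have h3 : 0 ≤ ev (ℓ g) (x + t0 • v) * ev (ℓ g) x := by
        rw [ev_add_smul, e1]
        have : 0 ≤ (τ + t0) * τ := by
          have a1 : |t0| ≤ |τ| := by rw [ht0, abs_neg]; exact hle
          have a2 : -(|t0| * |τ|) ≤ t0 * τ := by rw [← abs_mul]; exact neg_abs_le _
          have a3 : |t0| * |τ| ≤ |τ| * |τ| := mul_le_mul_of_nonneg_right a1 (abs_nonneg _)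
          rw [abs_mul_abs_self] at a3
          linarith
        nlinarith [mul_nonneg this (mul_self_nonneg ⟪v, (ℓ g).1⟫)]
      exact (pos_iff_pos_of_mul_pos (lt_of_le_of_ne h3 (mul_ne_zero hnz h1).symm)).symm
  · rintro ⟨H, F, A⟩ hs
    obtain ⟨hj, hk, -⟩ := mem_borders.1 hs
    have hsub : Finset.bipartiteBelow r (borders ℓ Y S j k) (H, F, A) ⊆
        F.image fun g => (H, F.erase g, A) := by
      rintro ⟨H', F', A'⟩ h'
      rw [Finset.mem_bipartiteBelow] at h'
      obtain ⟨-, h1, h2, g, hg, h3⟩ := h'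
      simp only at h1 h2 hg h3
      subst h1 h2 h3
      exact Finset.mem_image.2 ⟨g, hg, rfl⟩
    refine (Finset.card_le_card hsub).trans (Finset.card_image_le.trans ?_)
    omega

end VertexEdge

section Cells

variable {d : ℕ} {ι : Type} {ℓ : ι → Pt d × ℝ} {c : Pt d} {Y : Finset (Pt d)} {S : Finset ι}

/-- Every point of `Y` is an extreme point of `Y`, and lies on no hyperplane of the family. -/
structure Admissible (ℓ : ι → Pt d × ℝ) (Y : Finset (Pt d)) : Prop where
  extreme : ∀ y ∈ Y, ∃ a : Pt d, a ≠ 0 ∧ ∀ y' ∈ Y, y' ≠ y → ⟪y, a⟫ < ⟪y', a⟫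
  off : ∀ y ∈ Y, ∀ i, ev (ℓ i) y ≠ 0

lemma eventually_sqrt_lt {v a : Pt d} (h : 0 < ⟪v, a⟫) :
    ∀ᶠ R : ℝ in atTop, ‖v - R • a‖ < R * ‖a‖ := by
  filter_upwards [eventually_gt_atTop (‖v‖ ^ 2 / (2 * ⟪v, a⟫)), eventually_ge_atTop 0] with R hR hR0
  rw [div_lt_iff₀ (by positivity)] at hR
  refine lt_of_pow_lt_pow_left₀ 2 (by positivity) ?_
  rw [norm_sub_sq_real, norm_smul, real_inner_smul_right, Real.norm_of_nonneg hR0]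
  nlinarith

/-- A strictly convex body with the points of `Y` on its boundary and no vertex of the arrangement
on its boundary. -/
lemma Admissible.exists_body (hd : 0 < d) (h : Generic ℓ c) (hY : Admissible ℓ Y) :
    ∃ K U : Set (Pt d), IsCompact K ∧ Convex ℝ K ∧ IsOpen U ∧ Convex ℝ U ∧ U ⊆ K ∧
      (∀ x ∈ K, ∀ y ∈ K, x ≠ y → (1 / 2 : ℝ) • x + (1 / 2 : ℝ) • y ∈ U) ∧
      (Y.Nonempty → (Y : Set (Pt d)) ⊆ K \ U ∧ ∀ x ∈ K, x ∉ U →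
        (S.filter fun g => ev (ℓ g) x = 0).card < d) := by
  rcases Y.eq_empty_or_nonempty with rfl | hne
  · exact ⟨∅, ∅, isCompact_empty, convex_empty, isOpen_empty, convex_empty, subset_rfl,
      by simp, by simp⟩
  choose! a ha0 ha using hY.extreme
  have hbad : {R : ℝ | ∃ G ∈ S.powersetCard d, ∃ y ∈ Y, ∃ v : Pt d, (∀ g ∈ G, ev (ℓ g) v = 0) ∧
      ‖v - y‖ ^ 2 = 2 * R * ⟪v - y, a y⟫}.Finite := by
    have : {R : ℝ | ∃ G ∈ S.powersetCard d, ∃ y ∈ Y, ∃ v : Pt d, (∀ g ∈ G, ev (ℓ g) v = 0) ∧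
      ‖v - y‖ ^ 2 = 2 * R * ⟪v - y, a y⟫} = ⋃ G ∈ (S.powersetCard d : Set (Finset ι)),
        ⋃ y ∈ (Y : Set (Pt d)), {R | ∃ v : Pt d, (∀ g ∈ G, ev (ℓ g) v = 0) ∧
      ‖v - y‖ ^ 2 = 2 * R * ⟪v - y, a y⟫} := by
      ext R; simp
    rw [this]
    refine (Finset.finite_toSet _).biUnion fun G hG =>
      (Finset.finite_toSet _).biUnion fun y hy => ?_
    refine Set.Subsingleton.finite ?_
    rintro R ⟨v, hv, hR⟩ R' ⟨v', hv', hR'⟩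
    have hGc : G.card = d := (Finset.mem_powersetCard.1 hG).2
    have : v = v' := by
      rw [← sub_eq_zero]
      refine h.uniq G hGc _ fun g hg => ?_
      rw [inner_sub_eq_ev, hv g hg, hv' g hg, sub_zero]
    subst this
    obtain ⟨g, hg⟩ : G.Nonempty := by rw [← Finset.card_pos]; omega
    have hvy : v - y ≠ 0 := by
      intro e
      rw [sub_eq_zero] at e
      exact hY.off y hy g (e ▸ hv g hg)
    have hpos : 0 < ‖v - y‖ ^ 2 := by positivity
    have hi : ⟪v - y, a y⟫ ≠ 0 := by
      intro e; rw [e, mul_zero] at hR; exact hpos.ne' hR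
    have : 2 * R * ⟪v - y, a y⟫ = 2 * R' * ⟪v - y, a y⟫ := hR.symm.trans hR'
    have := mul_right_cancel₀ hi this
    linarith
  have hev : ∀ᶠ R : ℝ in atTop, ∀ y ∈ Y, ∀ y' ∈ Y, y' ≠ y → ‖y' - y - R • a y‖ < R * ‖a y‖ := by
    rw [Filter.eventually_all_finset]
    intro y hy
    rw [Filter.eventually_all_finset]
    intro y' hy'
    by_cases e : y' = y
    · simp [e]
    · have : 0 < ⟪y' - y, a y⟫ := by rw [inner_sub_left]; linarith [ha y hy y' hy' e]
      filter_upwards [eventually_sqrt_lt this] with R hR _ using hR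
  have hfin := hbad.eventually_cofinite_notMem.filter_mono (atTop_le_cofinite (α := ℝ))
  obtain ⟨R, hR1, hR2, hR0⟩ := (hev.and (hfin.and (eventually_gt_atTop 0))).exists
  have hrad : ∀ y ∈ Y, R * ‖a y‖ ≠ 0 := fun y hy => by
    have := norm_ne_zero_iff.2 (ha0 y hy)
    positivity
  have hself : ∀ y : Pt d, dist y (y + R • a y) = R * ‖a y‖ := by
    intro y
    rw [dist_eq_norm, sub_add_cancel_left, norm_neg, norm_smul, Real.norm_of_nonneg hR0.le]
  refine ⟨⋂ y ∈ Y, Metric.closedBall (y + R • a y) (R * ‖a y‖),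
    ⋂ y ∈ Y, Metric.ball (y + R • a y) (R * ‖a y‖), ?_, ?_, ?_, ?_, ?_, ?_, fun _ => ⟨?_, ?_⟩⟩
  · obtain ⟨y0, hy0⟩ := hne
    exact (isCompact_closedBall (y0 + R • a y0) (R * ‖a y0‖)).of_isClosed_subset
      (isClosed_biInter fun _ _ => Metric.isClosed_closedBall) (Set.biInter_subset_of_mem hy0)
  · exact convex_iInter₂ fun _ _ => convex_closedBall _ _
  · exact isOpen_biInter_finset fun _ _ => Metric.isOpen_ball
  · exact convex_iInter₂ fun _ _ => convex_ball _ _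
  · exact Set.iInter₂_mono fun _ _ => Metric.ball_subset_closedBall
  · intro x hx y hy hxy
    rw [Set.mem_iInter₂] at hx hy ⊢
    intro z hz
    exact combo_mem_ball_of_ne (hx z hz) (hy z hz) hxy (by norm_num) (by norm_num) (by norm_num)
  · intro y hy
    refine ⟨Set.mem_iInter₂.2 fun z hz => ?_, fun hU => ?_⟩
    · by_cases e : y = z
      · subst e; exact (hself y).le
      · have := (hR1 z hz y hy e).le
        rwa [Metric.mem_closedBall, dist_eq_norm, ← sub_sub]
    · have := Set.mem_iInter₂.1 hU y hy
      rw [Metric.mem_ball, hself] at this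
      exact this.false
  · intro x hxK hxU
    refine lt_of_le_of_ne (h.card_le _ x fun g hg => (Finset.mem_filter.1 hg).2) fun hcard => ?_
    rw [Set.mem_iInter₂] at hxK hxU
    push Not at hxU
    obtain ⟨y, hy, hyx⟩ := hxU
    have h1 := hxK y hy
    rw [Metric.mem_ball, not_lt] at hyx
    rw [Metric.mem_closedBall] at h1
    have h2 : ‖x - y - R • a y‖ = R * ‖a y‖ := by
      rw [sub_sub, ← dist_eq_norm]; exact le_antisymm h1 hyx
    refine hR2 ⟨_, Finset.mem_powersetCard.2 ⟨Finset.filter_subset _ _, hcard⟩, y, hy, x,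
      fun g hg => (Finset.mem_filter.1 hg).2, ?_⟩
    have h3 := congrArg (· ^ 2) h2
    simp only [norm_sub_sq_real, norm_smul, real_inner_smul_right, Real.norm_of_nonneg hR0.le] at h3
    rw [norm_sub_sq_real]
    linarith

/-- The closed cell of `y`. -/
def closedCell (ℓ : ι → Pt d × ℝ) (S : Finset ι) (y : Pt d) : Set (Pt d) :=
  {x | ∀ g ∈ S, 0 ≤ ev (ℓ g) x * ev (ℓ g) y}

lemma isClosed_closedCell (y : Pt d) : IsClosed (closedCell ℓ S y) := by
  have : closedCell ℓ S y = ⋂ g ∈ S, {x | 0 ≤ ev (ℓ g) x * ev (ℓ g) y} := by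
    ext x; simp [closedCell]
  rw [this]
  exact isClosed_biInter fun g _ =>
    isClosed_le continuous_const ((continuous_ev (ℓ g)).mul continuous_const)

lemma closedCell_combo {x x' y : Pt d} (hx : x ∈ closedCell ℓ S y) (hx' : x' ∈ closedCell ℓ S y)
    {t : ℝ} (h0 : 0 ≤ t) (h1 : t ≤ 1) : x + t • (x' - x) ∈ closedCell ℓ S y := by
  intro g hg
  rw [ev_combo]
  have := mul_nonneg (sub_nonneg.2 h1) (hx g hg)
  have := mul_nonneg h0 (hx' g hg)
  nlinarith

/-- A point of the closed cell can be moved slightly in a direction of the flat of its tight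
constraints. -/
lemma exists_small_cell {x y w : Pt d} (hy : ∀ g ∈ S, ev (ℓ g) y ≠ 0) (hx : x ∈ closedCell ℓ S y)
    (hw : ∀ g ∈ S, ev (ℓ g) x = 0 → ⟪w, (ℓ g).1⟫ = 0) :
    ∃ t : ℝ, 0 < t ∧ t ≤ 1 ∧ x + t • w ∈ closedCell ℓ S y := by
  obtain ⟨t, h0, h1, h⟩ := exists_small ℓ S x w
  refine ⟨t, h0, h1, fun g hg => ?_⟩
  by_cases e : ev (ℓ g) x = 0
  · rw [ev_add_smul, e, hw g hg e]; simp
  · have a1 := h g hg e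
    have a2 : 0 < ev (ℓ g) x * ev (ℓ g) y := lt_of_le_of_ne (hx g hg) (mul_ne_zero e (hy g hg)).symm
    have a3 : 0 < ev (ℓ g) x * ev (ℓ g) x := mul_self_pos.2 e
    by_contra hneg
    push Not at hneg
    nlinarith [mul_pos a1 a2]

/-- A cell meeting the boundary of a strictly convex body has a boundary point optimal on the flat
of its tight constraints. -/
lemma exists_optimal_point {K U : Set (Pt d)} (hK : IsCompact K) (hKc : Convex ℝ K) (hU : IsOpen U)
    (hUc : Convex ℝ U) (hUK : U ⊆ K)
    (hmid : ∀ x ∈ K, ∀ y ∈ K, x ≠ y → (1 / 2 : ℝ) • x + (1 / 2 : ℝ) • y ∈ U)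
    {y : Pt d} (hyK : y ∈ K) (hyU : y ∉ U) (hy : ∀ g ∈ S, ev (ℓ g) y ≠ 0) (c : Pt d) :
    ∃ z ∈ K, z ∉ U ∧ z ∈ closedCell ℓ S y ∧ ∃ b : Bool, ∀ w ∈ K,
      (∀ g ∈ S, ev (ℓ g) z = 0 → ev (ℓ g) w = 0) →
      ⟪z, if b then c else -c⟫ ≤ ⟪w, if b then c else -c⟫ := by
  have hgc : Continuous fun x : Pt d => ⟪x, c⟫ := by fun_prop
  have hycell : y ∈ closedCell ℓ S y := fun g _ => mul_self_nonneg _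
  obtain ⟨z1, ⟨hz1K, hz1C⟩, hz1⟩ :=
    (hK.inter_right (isClosed_closedCell (ℓ := ℓ) (S := S) y)).exists_isMinOn
    ⟨y, hyK, hycell⟩ hgc.continuousOn
  by_cases hz1U : z1 ∈ U
  swap
  · refine ⟨z1, hz1K, hz1U, hz1C, true, fun w hw hwF => ?_⟩
    simp only [if_true]
    obtain ⟨t, h0, h1, ht⟩ := exists_small_cell (w := w - z1) hy hz1C (fun g hg e => by
      rw [inner_sub_eq_ev, e, hwF g hg e, sub_zero])
    have hK' : z1 + t • (w - z1) ∈ K := hKc.add_smul_sub_mem hz1K hw ⟨h0.le, h1⟩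
    have := hz1 ⟨hK', ht⟩
    simp only [Set.mem_ofPred_eq, inner_add_left, real_inner_smul_left, inner_sub_left] at this
    have : 0 ≤ t * (⟪w, c⟫ - ⟪z1, c⟫) := by linarith
    have := nonneg_of_mul_nonneg_right this h0
    linarith
  have hglob : ∀ x ∈ closedCell ℓ S y, ⟪z1, c⟫ ≤ ⟪x, c⟫ := by
    intro x hx
    have hcont : Continuous fun t : ℝ => z1 + t • (x - z1) := by fun_prop
    have hev : ∀ᶠ t in 𝓝[>] (0 : ℝ), z1 + t • (x - z1) ∈ U := by
      have : ∀ᶠ t in 𝓝 (0 : ℝ), z1 + t • (x - z1) ∈ U :=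
        hcont.continuousAt.eventually (hU.mem_nhds (by simpa using hz1U))
      exact this.filter_mono nhdsWithin_le_nhds
    have h2 : ∀ᶠ t in 𝓝[>] (0 : ℝ), 0 < t := eventually_mem_nhdsWithin
    have h3 : ∀ᶠ t in 𝓝[>] (0 : ℝ), t ≤ 1 :=
      ((ge_mem_nhds (by norm_num : (0 : ℝ) < 1))).filter_mono nhdsWithin_le_nhds
    obtain ⟨t, ht, h0, h1⟩ := (hev.and (h2.and h3)).exists
    have := hz1 ⟨hUK ht, closedCell_combo hz1C hx h0.le h1⟩
    simp only [Set.mem_ofPred_eq, inner_add_left, real_inner_smul_left, inner_sub_left] at this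
    have : 0 ≤ t * (⟪x, c⟫ - ⟪z1, c⟫) := by linarith
    have := nonneg_of_mul_nonneg_right this h0
    linarith
  obtain ⟨z2, ⟨⟨hz2K, hz2C⟩, hz2U⟩, hz2⟩ :=
    ((hK.inter_right (isClosed_closedCell (ℓ := ℓ) (S := S) y)).inter_right
      hU.isClosed_compl).exists_isMinOn ⟨y, ⟨hyK, hycell⟩, hyU⟩ hgc.continuousOn
  have hout : ∀ x ∈ closedCell ℓ S y, x ∉ U → ⟪z2, c⟫ ≤ ⟪x, c⟫ := by
    intro x hx hxU
    have hcont : Continuous fun t : ℝ => z1 + t • (x - z1) := by fun_prop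
    have hpre : IsPreconnected ((fun t : ℝ => z1 + t • (x - z1)) '' Set.Icc 0 1) :=
      isPreconnected_Icc.image _ hcont.continuousOn
    obtain ⟨t, ht, hp⟩ : ∃ t ∈ Set.Icc (0 : ℝ) 1, z1 + t • (x - z1) ∈ closure U \ U := by
      by_contra! hcon
      obtain ⟨p, -, hp⟩ := hpre U (closure U)ᶜ hU isClosed_closure.isOpen_compl
        (by
          rintro _ ⟨t, ht, rfl⟩
          by_contra hp
          rw [Set.mem_union, not_or, Set.notMem_compl_iff] at hp
          exact hcon t ht ⟨hp.2, hp.1⟩)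
        ⟨z1, ⟨0, by simp, by simp⟩, hz1U⟩
        ⟨x, ⟨1, by simp, by simp⟩, fun hx => hcon 1 (by simp) (by simpa using ⟨hx, hxU⟩)⟩
      exact hp.2 (subset_closure hp.1)
    have h1 : z1 + t • (x - z1) ∈ K := hK.isClosed.closure_subset_iff.2 hUK hp.1
    have h2 := hz2 ⟨⟨h1, closedCell_combo hz1C hx ht.1 ht.2⟩, hp.2⟩
    have h3 := hglob x hx
    simp only [Set.mem_ofPred_eq, inner_add_left, real_inner_smul_left, inner_sub_left] at h2
    have h4 := mul_nonneg (sub_nonneg.2 ht.2) (sub_nonneg.2 h3)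
    linarith
  obtain ⟨f, hf⟩ := geometric_hahn_banach_open_point hUc hU hz2U
  refine ⟨z2, hz2K, hz2U, hz2C, false, fun w hw hwF => ?_⟩
  simp only [Bool.false_eq_true, if_false, inner_neg_right, neg_le_neg_iff]
  by_contra hlt
  push Not at hlt
  have hne : w ≠ z2 := by rintro rfl; exact hlt.false
  have h1 := hf _ (hmid w hw z2 hz2K hne)
  simp only [map_add, map_smul, smul_eq_mul] at h1
  obtain ⟨t, h0, -, ht⟩ := exists_small_cell (w := z2 - w) hy hz2C (fun g hg e => by
      rw [inner_sub_eq_ev, e, hwF g hg e, sub_zero])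
  have h2 : z2 + t • (z2 - w) ∉ U := by
    intro hin
    have := hf _ hin
    simp only [map_add, map_smul, smul_eq_mul, map_sub] at this
    nlinarith
  have h3 := hout _ ht h2
  simp only [inner_add_left, real_inner_smul_left, inner_sub_left] at h3
  nlinarith

/-- Optimal points are unique. -/
lemma Generic.optimal_unique (h : Generic ℓ c) {K U : Set (Pt d)} (hU : IsOpen U) (hUK : U ⊆ K)
    (hmid : ∀ x ∈ K, ∀ y ∈ K, x ≠ y → (1 / 2 : ℝ) • x + (1 / 2 : ℝ) • y ∈ U)
    {F : Finset ι} (hF : F.card < d) {z z' : Pt d} (hz : z ∈ K) (hz' : z' ∈ K)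
    (hzF : ∀ g ∈ F, ev (ℓ g) z = 0) (hzF' : ∀ g ∈ F, ev (ℓ g) z' = 0)
    (hmin : ∀ w ∈ K, (∀ g ∈ F, ev (ℓ g) w = 0) → ⟪z, c⟫ ≤ ⟪w, c⟫)
    (hmin' : ∀ w ∈ K, (∀ g ∈ F, ev (ℓ g) w = 0) → ⟪z', c⟫ ≤ ⟪w, c⟫) : z = z' := by
  by_contra hne
  have hm := hmid z hz z' hz' hne
  set m := (1 / 2 : ℝ) • z + (1 / 2 : ℝ) • z' with hmdef
  have hmF : ∀ g ∈ F, ev (ℓ g) m = 0 := by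
    intro g hg
    have : m = z + (1 / 2 : ℝ) • (z' - z) := by rw [hmdef]; module
    rw [this, ev_combo, hzF g hg, hzF' g hg]; simp
  have hmc : ⟪m, c⟫ = ⟪z, c⟫ := by
    have e : ⟪z, c⟫ = ⟪z', c⟫ := le_antisymm (hmin z' hz' hzF') (hmin' z hz hzF)
    rw [hmdef, inner_add_left, real_inner_smul_left, real_inner_smul_left, ← e]; ring
  obtain ⟨v, hv, hvc⟩ := h.obj F hF
  have hcont : Continuous fun t : ℝ => m + t • (-⟪v, c⟫ • v) := by fun_prop
  have hev : ∀ᶠ t in 𝓝[>] (0 : ℝ), m + t • (-⟪v, c⟫ • v) ∈ U := by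
    have : ∀ᶠ t in 𝓝 (0 : ℝ), m + t • (-⟪v, c⟫ • v) ∈ U :=
      hcont.continuousAt.eventually (hU.mem_nhds (by simpa using hm))
    exact this.filter_mono nhdsWithin_le_nhds
  have h2 : ∀ᶠ t in 𝓝[>] (0 : ℝ), 0 < t := eventually_mem_nhdsWithin
  obtain ⟨t, ht, h0⟩ := (hev.and h2).exists
  have := hmin _ (hUK ht) fun g hg => by
    rw [ev_add_smul, hmF g hg, real_inner_smul_left, hv g hg]; simp
  rw [inner_add_left, real_inner_smul_left, real_inner_smul_left, hmc] at this
  have := mul_pos h0 (mul_self_pos.2 hvc)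
  linarith

lemma sum_choose_le {m : ℕ} (hd : 0 < d) (hm : d - 1 ≤ m) :
    ∑ i ∈ Finset.range d, m.choose i ≤ 2 ^ (d - 1) * m.choose (d - 1) := by
  obtain ⟨e, rfl⟩ : ∃ e, d = e + 1 := ⟨d - 1, by omega⟩
  rw [Nat.add_sub_cancel] at hm ⊢
  rw [← Nat.sum_range_choose, Finset.sum_mul]
  refine Finset.sum_le_sum fun i hi => ?_
  have hie : i ≤ e := by rw [Finset.mem_range] at hi; omega
  have := Nat.choose_mul (n := m) hie
  rw [mul_comm, this]
  exact Nat.le_mul_of_pos_right _ (Nat.choose_pos (by omega))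

/-- The number of cells containing points of `Y`. -/
lemma Admissible.card_zone_le (hd : 0 < d) (h : Generic ℓ c) (hY : Admissible ℓ Y)
    (hS : d - 1 ≤ S.card) :
    (zone ℓ Y S).card ≤ 2 ^ (2 * d) * S.card.choose (d - 1) := by
  rcases Y.eq_empty_or_nonempty with rfl | hne
  · simp [zone]
  obtain ⟨K, U, hK, hKc, hU, hUc, hUK, hmid, hrest⟩ := hY.exists_body (S := S) hd h
  obtain ⟨hYK, hvert⟩ := hrest hne
  let r : Finset ι → (Finset ι × Finset ι) × Bool → Prop := fun A s =>
    s.1.2 = A ∩ s.1.1 ∧ ∃ z ∈ K, (∀ g ∈ s.1.1, ev (ℓ g) z = 0) ∧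
      (∀ g ∈ S, g ∉ s.1.1 → (g ∈ A ↔ 0 < ev (ℓ g) z)) ∧ A ⊆ S ∧
      ∀ w ∈ K, (∀ g ∈ s.1.1, ev (ℓ g) w = 0) →
        ⟪z, if s.2 then c else -c⟫ ≤ ⟪w, if s.2 then c else -c⟫
  let T := ((S.powerset.filter fun F => F.card < d).sigma fun F => F.powerset).image
    fun x => (x.1, x.2)
  have hTc : T.card ≤ 2 ^ (d - 1) * (2 ^ (d - 1) * S.card.choose (d - 1)) := by
    refine Finset.card_image_le.trans ?_
    rw [Finset.card_sigma]
    have h1 : ∀ F ∈ S.powerset.filter fun F => F.card < d, F.powerset.card ≤ 2 ^ (d - 1) := by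
      intro F hF
      rw [Finset.card_powerset]
      exact Nat.pow_le_pow_right (by norm_num) (by have := (Finset.mem_filter.1 hF).2; omega)
    refine (Finset.sum_le_card_nsmul _ _ _ h1).trans ?_
    rw [smul_eq_mul, mul_comm]
    refine Nat.mul_le_mul_left _ (le_trans ?_ (sum_choose_le hd hS))
    have : (S.powerset.filter fun F => F.card < d) ⊆
        (Finset.range d).biUnion fun i => S.powersetCard i := by
      intro F hF
      rw [Finset.mem_filter, Finset.mem_powerset] at hF
      exact Finset.mem_biUnion.2 ⟨F.card, Finset.mem_range.2 hF.2,
        Finset.mem_powersetCard.2 ⟨hF.1, rfl⟩⟩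
    refine (Finset.card_le_card this).trans (Finset.card_biUnion_le.trans ?_)
    simp [Finset.card_powersetCard]
  have main := Finset.card_le_card_of_forall_subsingleton r (s := zone ℓ Y S)
    (t := T ×ˢ (Finset.univ : Finset Bool)) ?_ ?_
  · rw [Finset.card_product, Finset.card_univ, Fintype.card_bool] at main
    refine main.trans ((Nat.mul_le_mul_right 2 hTc).trans ?_)
    obtain ⟨e, rfl⟩ : ∃ e, d = e + 1 := ⟨d - 1, by omega⟩
    rw [Nat.add_sub_cancel, show 2 * (e + 1) = e + e + 1 + 1 by ring, pow_succ, pow_succ, pow_add]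
    nlinarith [Nat.zero_le (2 ^ e * 2 ^ e * S.card.choose e)]
  · intro A hA
    obtain ⟨y, hy, rfl⟩ := Finset.mem_image.1 hA
    have hyo : ∀ g ∈ S, ev (ℓ g) y ≠ 0 := fun g _ => hY.off y hy g
    obtain ⟨z, hzK, hzU, hzC, b, hb⟩ := exists_optimal_point hK hKc hU hUc hUK hmid (hYK hy).1
      (hYK hy).2 hyo c
    set F := S.filter fun g => ev (ℓ g) z = 0 with hF
    refine ⟨((F, posSet ℓ S y ∩ F), b), Finset.mem_product.2 ⟨?_, Finset.mem_univ _⟩, rfl, z, hzK,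
      fun g hg => (Finset.mem_filter.1 hg).2, fun g hg hgF => ?_, Finset.filter_subset _ _,
      fun w hw hwF => hb w hw fun g hg e => hwF g (Finset.mem_filter.2 ⟨hg, e⟩)⟩
    · refine Finset.mem_image.2 ⟨⟨F, posSet ℓ S y ∩ F⟩, Finset.mem_sigma.2 ⟨?_, ?_⟩, rfl⟩
      · exact Finset.mem_filter.2 ⟨Finset.mem_powerset.2 (Finset.filter_subset _ _),
          hvert z hzK hzU⟩
      · exact Finset.mem_powerset.2 Finset.inter_subset_right
    · have hz0 : ev (ℓ g) z ≠ 0 := fun e => hgF (Finset.mem_filter.2 ⟨hg, e⟩)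
      have := lt_of_le_of_ne (hzC g hg) (mul_ne_zero hz0 (hyo g hg)).symm
      simp only [posSet, Finset.mem_filter, hg, true_and]
      exact (pos_iff_pos_of_mul_pos this).symm
  · rintro ⟨⟨F, B⟩, b⟩ hs A ⟨-, h1, z, hz, hzF, hzA, hAS, hzmin⟩
      A' ⟨-, h1', z', hz', hzF', hzA', hAS',
      hzmin'⟩
    simp only at h1 h1' hzF hzA hzmin hzF' hzA' hzmin'
    have hFc : F.card < d := by
      obtain ⟨x, hx, e⟩ := Finset.mem_image.1 (Finset.mem_product.1 hs).1
      have := (Finset.mem_filter.1 (Finset.mem_sigma.1 hx).1).2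
      rw [Prod.mk.injEq] at e
      rwa [e.1] at this
    have hgen : Generic ℓ (if b then c else -c) := by
      cases b
      · exact h.neg
      · exact h
    have := hgen.optimal_unique hU hUK hmid hFc hz hz' hzF hzF' hzmin hzmin'
    subst this
    ext g
    by_cases hgF : g ∈ F
    · have e : A ∩ F = A' ∩ F := h1.symm.trans h1'
      have : g ∈ A ∩ F ↔ g ∈ A' ∩ F := by rw [e]
      simpa [hgF] using this
    · by_cases hgS : g ∈ S
      · rw [hzA g hgS hgF, hzA' g hgS hgF]
      · exact ⟨fun hh => absurd (hAS hh) hgS, fun hh => absurd (hAS' hh) hgS⟩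

end Cells

section ZoneBounds

/-- The number of borders of type `(j, k)` is `O(m ^ (d - 1) * θ m)`. -/
def BorderBound (d j k : ℕ) (θ : ℕ → ℝ) : Prop :=
  ∃ B : ℝ, 0 < B ∧ ∀ (ι : Type) (ℓ : ι → Pt d × ℝ) (c : Pt d) (Y : Finset (Pt d)) (S : Finset ι),
    Generic ℓ c → Admissible ℓ Y → d - 1 ≤ S.card →
      ((borders ℓ Y S j k).card : ℝ) ≤ B * (S.card.choose (d - 1) : ℝ) * θ S.card

/-- The logarithmic factor of the zone bound. -/
def logFactor (m : ℕ) : ℝ := 1 + Real.log m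

lemma one_le_logFactor (m : ℕ) : 1 ≤ logFactor m := by
  have := Real.log_natCast_nonneg m
  unfold logFactor; linarith

lemma logFactor_mono {m n : ℕ} (h : m ≤ n) : logFactor m ≤ logFactor n := by
  unfold logFactor
  rcases Nat.eq_zero_or_pos m with rfl | hm
  · simpa using Real.log_natCast_nonneg n
  · have : Real.log m ≤ Real.log n :=
      Real.log_le_log (by exact_mod_cast hm) (by exact_mod_cast h)
    linarith

variable {d j k : ℕ} {θ θ' : ℕ → ℝ}

lemma BorderBound.mono (h : BorderBound d j k θ) (hθ : ∀ m, θ m ≤ θ' m) : BorderBound d j k θ' := by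
  obtain ⟨B, hB, h⟩ := h
  refine ⟨B, hB, fun ι ℓ c Y S hg hY hS => (h ι ℓ c Y S hg hY hS).trans ?_⟩
  have := hθ S.card
  gcongr

lemma borderBound_zero (hd : 0 < d) : BorderBound d 0 0 fun _ => 1 := by
  refine ⟨2 ^ (2 * d), by positivity, fun ι ℓ c Y S hg hY hS => ?_⟩
  have h1 : (borders ℓ Y S 0 0).card ≤ (zone ℓ Y S).card := by
    refine Finset.card_le_card_of_injOn (fun t => t.2.2) ?_ ?_
    · rintro ⟨H, F, A⟩ h
      have := (mem_borders.1 (Finset.mem_coe.1 h)).2.2.cells ∅ (Finset.empty_subset _)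
      rwa [Finset.union_empty] at this
    · rintro ⟨H, F, A⟩ h ⟨H', F', A'⟩ h' e
      have h1 := mem_borders.1 (Finset.mem_coe.1 h)
      have h2 := mem_borders.1 (Finset.mem_coe.1 h')
      rw [Finset.card_eq_zero, Finset.card_eq_zero] at h1 h2
      simp only at e
      rw [h1.1, h1.2.1, h2.1, h2.2.1, e]
  rw [mul_one]
  exact_mod_cast h1.trans (hY.card_zone_le hd hg hS)

lemma BorderBound.vertex (h : BorderBound d 0 (k / 2) θ) (hjk : j + k = d) :
    BorderBound d j k θ := by
  obtain ⟨B, hB, h⟩ := h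
  refine ⟨2 ^ (d + 1) * B, by positivity, fun ι ℓ c Y S hg hY hS => ?_⟩
  have h1 : ((borders ℓ Y S j k).card : ℝ) ≤ 2 ^ (d + 1) * (borders ℓ Y S 0 (k / 2)).card := by
    exact_mod_cast hg.card_vertex_borders_le hjk
  refine h1.trans ?_
  rw [mul_assoc, mul_assoc, ← mul_assoc B]
  exact mul_le_mul_of_nonneg_left (h ι ℓ c Y S hg hY hS) (by positivity)

lemma card_borders_le_of_base {ι : Type} {ℓ : ι → Pt d × ℝ} {Y : Finset (Pt d)} {S : Finset ι}
    (hS : S.card = d - 1) (hθ : ∀ m, 1 ≤ θ m) {B : ℝ} (hB : 8 ^ (d - 1) ≤ B) :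
    ((borders ℓ Y S j k).card : ℝ) ≤ B * (S.card.choose (d - 1) : ℝ) * θ S.card := by
  have h1 : ((borders ℓ Y S j k).card : ℝ) ≤ 8 ^ (d - 1) := by
    rw [← hS]; exact_mod_cast card_borders_le
  rw [hS, Nat.choose_self, Nat.cast_one, mul_one]
  have : (0 : ℝ) ≤ 8 ^ (d - 1) := by positivity
  nlinarith [hθ (d - 1)]

lemma BorderBound.edge (h : BorderBound d j (k + 1) θ) (hjk : j + k + 1 = d) (hθ : ∀ m, 1 ≤ θ m) :
    BorderBound d j k θ := by
  obtain ⟨B, hB, h⟩ := h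
  refine ⟨max (8 ^ (d - 1)) (d * B), by positivity, fun ι ℓ c Y S hg hY hS => ?_⟩
  rcases hS.eq_or_lt with e | hlt
  · exact card_borders_le_of_base e.symm hθ (le_max_left _ _)
  · have h1 : ((borders ℓ Y S j k).card : ℝ) ≤ d * (borders ℓ Y S j (k + 1)).card := by
      exact_mod_cast hg.card_edge_borders_le hjk (by omega)
    refine h1.trans ?_
    have h2 := mul_le_mul_of_nonneg_left (h ι ℓ c Y S hg hY hS) (Nat.cast_nonneg (α := ℝ) d)
    refine h2.trans ?_
    rw [← mul_assoc, ← mul_assoc]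
    have := le_max_right ((8 : ℝ) ^ (d - 1)) (d * B)
    have := hθ S.card
    gcongr

/-- The deletion recurrence turns a bound for `(j + 1, k)` into one for `(j, k)`. -/
lemma BorderBound.step {e : ℕ} (h : BorderBound (e + 1) (j + 1) k θ') (hjk : j + k ≤ e)
    {κ : ℝ} (hκ : 0 < κ) (hθ : ∀ m, 1 ≤ θ m) (hθ' : ∀ m, 1 ≤ θ' m)
    (hstep : ∀ m : ℕ, e ≤ m → ((m + 1 : ℝ) - e) * θ m + κ * θ' (m + 1) ≤
      ((m + 1 : ℝ) - (j + k)) * θ (m + 1)) :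
    BorderBound (e + 1) j k θ := by
  obtain ⟨B, hB, h⟩ := h
  set B' := max ((8 : ℝ) ^ (e + 1 - 1)) ((j + 1) * B / κ) with hB'
  have hB'0 : 0 < B' := lt_of_lt_of_le (by positivity) (le_max_left _ _)
  refine ⟨B', hB'0, fun ι ℓ c Y S hg hY hS => ?_⟩
  obtain ⟨m, hm⟩ : ∃ m, m = S.card := ⟨_, rfl⟩
  induction m generalizing S with
  | zero =>
    refine card_borders_le_of_base ?_ hθ (le_max_left _ _)
    omega
  | succ m ih =>
    rcases hS.eq_or_lt with e1 | hlt
    · exact card_borders_le_of_base e1.symm hθ (le_max_left _ _)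
    · have hem : e ≤ m := by omega
      rw [← hm, Nat.add_sub_cancel]
      have hrec : ((m + 1 : ℝ) - (j + k)) * (borders ℓ Y S j k).card ≤
          ∑ g ∈ S, ((borders ℓ Y (S.erase g) j k).card : ℝ) +
            (j + 1) * (borders ℓ Y S (j + 1) k).card := by
        have h1 := borders_recurrence (ℓ := ℓ) (Y := Y) (S := S) (j := j) (k := k)
        rw [← hm] at h1
        have h2 : ((m + 1 - (j + k) : ℕ) : ℝ) = (m + 1 : ℝ) - (j + k) := by
          rw [Nat.cast_sub (by omega)]; push_cast; ring
        rw [← h2]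
        exact_mod_cast h1
      have hsum : ∑ g ∈ S, ((borders ℓ Y (S.erase g) j k).card : ℝ) ≤
          (m + 1) * (B' * (m.choose e : ℝ) * θ m) := by
        have : ∀ g ∈ S, ((borders ℓ Y (S.erase g) j k).card : ℝ) ≤
            B' * (m.choose e : ℝ) * θ m := by
          intro g hg'
          have hc : (S.erase g).card = m := by rw [Finset.card_erase_of_mem hg', ← hm]; rfl
          have := ih (S.erase g) (by rw [hc]; omega) hc.symm
          rwa [hc, Nat.add_sub_cancel] at this
        refine (Finset.sum_le_card_nsmul _ _ _ this).trans ?_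
        rw [← hm, nsmul_eq_mul]; push_cast; rfl
      have hj := h ι ℓ c Y S hg hY hS
      rw [← hm, Nat.add_sub_cancel] at hj
      have hchoose : (m + 1 : ℝ) * (m.choose e : ℝ) = (m + 1 - e) * ((m + 1).choose e : ℝ) := by
        have h1 := Nat.choose_mul_succ_eq m e
        have h2 : ((m + 1 - e : ℕ) : ℝ) = (m + 1 : ℝ) - e := by
          rw [Nat.cast_sub (by omega)]; push_cast; ring
        rw [← h2, mul_comm, mul_comm _ (((m + 1).choose e : ℕ) : ℝ)]
        exact_mod_cast h1
      have hpos : 0 < (m + 1 : ℝ) - (j + k) := by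
        have : ((j + k : ℕ) : ℝ) ≤ (m : ℝ) := by exact_mod_cast hjk.trans hem
        push_cast at this
        linarith
      have hBk : (j + 1) * B ≤ κ * B' := by
        rw [mul_comm κ, ← div_le_iff₀ hκ]; exact le_max_right _ _
      set φ := ((m + 1).choose e : ℝ) with hφ
      have hφ0 : 0 ≤ φ := Nat.cast_nonneg _
      refine le_of_mul_le_mul_left ?_ hpos
      calc _ ≤ _ := hrec
        _ ≤ (m + 1) * (B' * (m.choose e : ℝ) * θ m) + (j + 1) * (B * φ * θ' (m + 1)) := by
          gcongr
        _ = B' * (((m + 1 : ℝ) * m.choose e) * θ m) + ((j + 1) * B) * (φ * θ' (m + 1)) := by ring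
        _ ≤ B' * (((m + 1 : ℝ) - e) * φ * θ m) + (κ * B') * (φ * θ' (m + 1)) := by
          rw [hchoose]
          have := hθ' (m + 1)
          gcongr
        _ = B' * φ * (((m + 1 : ℝ) - e) * θ m + κ * θ' (m + 1)) := by ring
        _ ≤ B' * φ * (((m + 1 : ℝ) - (j + k)) * θ (m + 1)) := by
          have := hstep m hem
          gcongr
        _ = _ := by ring

lemma BorderBound.step_log {e : ℕ} (h : BorderBound (e + 1) (j + 1) k logFactor)
    (hjk : j + k + 1 ≤ e) : BorderBound (e + 1) j k logFactor := by
  refine h.step (κ := 1) (by omega) one_pos one_le_logFactor one_le_logFactor fun m hm => ?_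
  have h1 := logFactor_mono (Nat.le_succ m)
  have h2 := one_le_logFactor (m + 1)
  have h3 : ((j + k + 1 : ℕ) : ℝ) ≤ (e : ℝ) := by exact_mod_cast hjk
  have h4 : (e : ℝ) ≤ m := by exact_mod_cast hm
  push_cast at h3
  have h5 := mul_le_mul_of_nonneg_left h1 (by linarith : (0 : ℝ) ≤ (m + 1 : ℝ) - e)
  have h6 : 0 ≤ ((e : ℝ) - (j + k + 1)) * logFactor (m + 1) :=
    mul_nonneg (by linarith) (by linarith)
  simp only [Nat.succ_eq_add_one] at h5
  linarith

lemma BorderBound.step_critical {e : ℕ} (he : 0 < e)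
    (h : BorderBound (e + 1) (j + 1) k fun _ => 1) (hjk : j + k = e) :
    BorderBound (e + 1) j k logFactor := by
  refine h.step (κ := 1 / (e + 1)) hjk.le (by positivity) one_le_logFactor (fun _ => le_rfl)
    fun m hm => ?_
  have hje : (j + k : ℝ) = e := by exact_mod_cast hjk
  have h4 : (e : ℝ) ≤ m := by exact_mod_cast hm
  have he' : (0 : ℝ) < e := by exact_mod_cast he
  have hm0 : (0 : ℝ) < m := by linarith
  rw [hje, mul_one]
  have hlog : 1 / (m + 1 : ℝ) ≤ logFactor (m + 1) - logFactor m := by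
    have h1 : Real.log ((m : ℝ) / (m + 1)) ≤ (m : ℝ) / (m + 1) - 1 :=
      Real.log_le_sub_one_of_pos (by positivity)
    rw [Real.log_div hm0.ne' (by positivity)] at h1
    have h2 : (m : ℝ) / (m + 1) - 1 = -(1 / (m + 1)) := by field_simp; ring
    unfold logFactor
    push_cast
    linarith
  have h5 : 1 / ((e : ℝ) + 1) ≤ ((m + 1 : ℝ) - e) * (1 / (m + 1)) := by
    rw [mul_one_div, div_le_div_iff₀ (by positivity) (by positivity)]
    nlinarith
  have h6 := mul_le_mul_of_nonneg_left hlog (by linarith : (0 : ℝ) ≤ (m + 1 : ℝ) - e)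
  linarith

lemma BorderBound.descend {e : ℕ} (h : BorderBound (e + 1) j k logFactor) (hjk : j + k ≤ e) :
    BorderBound (e + 1) 0 k logFactor := by
  induction j with
  | zero => exact h
  | succ j ih => exact ih (h.step_log (by omega)) (by omega)

lemma borderBound_log {e : ℕ} (he : 0 < e) (hk : k ≤ e + 1) :
    BorderBound (e + 1) 0 k logFactor := by
  induction k using Nat.strong_induction_on with
  | _ k ih =>
    rcases Nat.eq_zero_or_pos k with rfl | hk0
    · exact (borderBound_zero e.succ_pos).mono one_le_logFactor
    rcases eq_or_ne k 1 with rfl | hk1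
    · have h1 : BorderBound (e + 1) (e - 1 + 1) 1 fun _ => 1 :=
        BorderBound.vertex (borderBound_zero e.succ_pos) (by omega)
      exact (h1.step_critical he (by omega)).descend (by omega)
    rcases hk.eq_or_lt with rfl | hlt
    · exact (ih ((e + 1) / 2) (by omega) (by omega)).vertex (by omega)
    · have h1 : BorderBound (e + 1) (e - k) (k + 1) logFactor :=
        (ih ((k + 1) / 2) (by omega) (by omega)).vertex (by omega)
      exact (h1.edge (by omega) one_le_logFactor).descend (by omega)

end ZoneBounds

/-! ### Bottom-vertex triangulation -/

section Triangulation

variable {d : ℕ} {ι : Type} {ℓ : ι → Pt d × ℝ} {c : Pt d} {S : Finset ι}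

/-- `x` belongs to the cell `C`, and among the hyperplanes of `S` lies exactly on those of `F`. -/
structure Fine (ℓ : ι → Pt d × ℝ) (S : Finset ι) (C : Set (Pt d)) (F : Finset ι) (x : Pt d) :
    Prop where
  mem : x ∈ C
  zero : ∀ g ∈ F, ev (ℓ g) x = 0
  ne : ∀ g ∈ S, g ∉ F → ev (ℓ g) x ≠ 0

/-- `v` minimizes the objective on the face of `C` in the flat of `F`. -/
structure IsBottom (ℓ : ι → Pt d × ℝ) (c : Pt d) (C : Set (Pt d)) (F : Finset ι) (v : Pt d) :
    Prop where
  mem : v ∈ C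
  zero : ∀ g ∈ F, ev (ℓ g) v = 0
  min : ∀ w ∈ C, (∀ g ∈ F, ev (ℓ g) w = 0) → ⟪v, c⟫ ≤ ⟪w, c⟫

/-- Projecting `x` from the bottom vertex `v` of the face of `F` to the boundary of that face. -/
structure Step (ℓ : ι → Pt d × ℝ) (c : Pt d) (S : Finset ι) (C : Set (Pt d)) (F : Finset ι)
    (v x : Pt d) (f : ι) (x' : Pt d) : Prop where
  bottom : IsBottom ℓ c C F v
  mem : f ∈ S
  notMem : f ∉ F
  fine : Fine ℓ S C (insert f F) x'
  between : ∃ t : ℝ, 0 < t ∧ t < 1 ∧ x = v + t • (x' - v)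

/-- A sequence of projections from bottom vertices, starting at `x` and ending at `z`. -/
def Chain (ℓ : ι → Pt d × ℝ) (c : Pt d) (S : Finset ι) (C : Set (Pt d)) :
    Finset ι → Pt d → List (ι × Pt d) → Pt d → Prop
  | _, x, [], z => z = x
  | F, x, a :: L, z => ∃ x', Step ℓ c S C F a.2 x a.1 x' ∧ Chain ℓ c S C (insert a.1 F) x' L z

/-- The tight constraints at a point. -/
def tight (ℓ : ι → Pt d × ℝ) (S : Finset ι) (x : Pt d) : Finset ι :=
  S.filter fun g => ev (ℓ g) x = 0

lemma mem_tight {g : ι} {x : Pt d} : g ∈ tight ℓ S x ↔ g ∈ S ∧ ev (ℓ g) x = 0 := Finset.mem_filter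

lemma Generic.card_tight_le (h : Generic ℓ c) (x : Pt d) : (tight ℓ S x).card ≤ d :=
  h.card_le _ x fun _ hg => (mem_tight.1 hg).2

lemma Fine.tight_eq {C : Set (Pt d)} {F : Finset ι} {x : Pt d} (h : Fine ℓ S C F x) (hF : F ⊆ S) :
    tight ℓ S x = F := by
  ext g
  rw [mem_tight]
  exact ⟨fun hg => by by_contra hn; exact h.ne g hg.1 hn hg.2, fun hg => ⟨hF hg, h.zero g hg⟩⟩

lemma IsBottom.le_card_tight (h : Generic ℓ c) {y v : Pt d} {F : Finset ι}
    (hy : ∀ g ∈ S, ev (ℓ g) y ≠ 0) (hF : F ⊆ S) (hv : IsBottom ℓ c (closedCell ℓ S y) F v) :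
    d ≤ (tight ℓ S v).card := by
  by_contra hlt
  push Not at hlt
  obtain ⟨w, hw, hwc⟩ := h.obj _ hlt
  obtain ⟨t, h0, -, ht⟩ := exists_small_cell (w := -⟪w, c⟫ • w) hy hv.mem (fun g hg e => by
    rw [real_inner_smul_left, hw g (mem_tight.2 ⟨hg, e⟩), mul_zero])
  have := hv.min _ ht fun g hg => by
    rw [ev_add_smul, hv.zero g hg, real_inner_smul_left,
      hw g (mem_tight.2 ⟨hF hg, hv.zero g hg⟩)]; simp
  rw [inner_add_left, real_inner_smul_left, real_inner_smul_left] at this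
  have := mul_pos h0 (mul_self_pos.2 hwc)
  linarith

lemma IsBottom.unique (h : Generic ℓ c) {y v v' : Pt d} {F : Finset ι}
    (hy : ∀ g ∈ S, ev (ℓ g) y ≠ 0) (hF : F ⊆ S) (hv : IsBottom ℓ c (closedCell ℓ S y) F v)
    (hv' : IsBottom ℓ c (closedCell ℓ S y) F v') : v = v' := by
  have hm : IsBottom ℓ c (closedCell ℓ S y) F (v + (1 / 2 : ℝ) • (v' - v)) := by
    refine ⟨closedCell_combo hv.mem hv'.mem (by norm_num) (by norm_num), fun g hg => ?_,
      fun w hw hwF => ?_⟩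
    · rw [ev_combo, hv.zero g hg, hv'.zero g hg]; simp
    · have h1 := hv.min w hw hwF
      have h2 := hv'.min w hw hwF
      rw [inner_add_left, real_inner_smul_left, inner_sub_left]
      linarith
  obtain ⟨G, hG, hGc⟩ := Finset.exists_subset_card_eq (hm.le_card_tight h hy hF)
  rw [← sub_eq_zero]
  refine h.uniq G hGc _ fun g hg => ?_
  obtain ⟨hgS, hg0⟩ := mem_tight.1 (hG hg)
  rw [ev_combo] at hg0
  rw [inner_sub_eq_ev]
  have a1 := hv.mem g hgS
  have a2 := hv'.mem g hgS
  have a3 := mul_self_pos.2 (hy g hgS)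
  have e : ev (ℓ g) v * ev (ℓ g) y + ev (ℓ g) v' * ev (ℓ g) y = 0 := by
    linear_combination 2 * ev (ℓ g) y * hg0
  have e1 : ev (ℓ g) v * ev (ℓ g) y = 0 := by linarith
  have e2 : ev (ℓ g) v' * ev (ℓ g) y = 0 := by linarith
  rw [(mul_eq_zero.1 e1).resolve_right (hy g hgS), (mul_eq_zero.1 e2).resolve_right (hy g hgS)]
  simp

lemma IsBottom.exists (F : Finset ι) {y x : Pt d} (hcomp : IsCompact (closedCell ℓ S y))
    (hx : x ∈ closedCell ℓ S y) (hxF : ∀ g ∈ F, ev (ℓ g) x = 0) :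
    ∃ v, IsBottom ℓ c (closedCell ℓ S y) F v := by
  have hcl : IsClosed {x : Pt d | ∀ g ∈ F, ev (ℓ g) x = 0} := by
    have : {x : Pt d | ∀ g ∈ F, ev (ℓ g) x = 0} = ⋂ g ∈ F, {x | ev (ℓ g) x = 0} := by ext; simp
    rw [this]
    exact isClosed_biInter fun g _ => isClosed_eq (continuous_ev (ℓ g)) continuous_const
  obtain ⟨v, ⟨h1, h2⟩, h3⟩ := (hcomp.inter_right hcl).exists_isMinOn ⟨x, hx, hxF⟩
    (f := fun x => ⟪x, c⟫) (by fun_prop)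
  exact ⟨v, h1, h2, fun w hw hwF => h3 ⟨hw, hwF⟩⟩

lemma Step.ev_ne {C : Set (Pt d)} {F : Finset ι} {v x x' : Pt d} {f : ι}
    (hx : Fine ℓ S C F x) (h : Step ℓ c S C F v x f x') : ev (ℓ f) v ≠ 0 := by
  intro h0
  obtain ⟨t, -, -, rfl⟩ := h.between
  refine hx.ne f h.mem h.notMem ?_
  rw [ev_combo, h0, h.fine.zero f (Finset.mem_insert_self _ _)]; simp

lemma Step.unique (h : Generic ℓ c) {y v v' x x1 x2 : Pt d} {F : Finset ι} {f f' : ι}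
    (hy : ∀ g ∈ S, ev (ℓ g) y ≠ 0) (hF : F ⊆ S) (hx : Fine ℓ S (closedCell ℓ S y) F x)
    (h1 : Step ℓ c S (closedCell ℓ S y) F v x f x1)
    (h2 : Step ℓ c S (closedCell ℓ S y) F v' x f' x2) : v = v' ∧ f = f' ∧ x1 = x2 := by
  have hv := h1.bottom.unique h hy hF h2.bottom
  subst hv
  have key : ∀ {x1 x2 : Pt d} {f : ι} {t s : ℝ}, f ∈ S → f ∉ F → ev (ℓ f) x1 = 0 →
      x2 ∈ closedCell ℓ S y → 0 < t → t < 1 → x = v + t • (x1 - v) → 0 < s → s < 1 →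
      x = v + s • (x2 - v) → t ≤ s := by
    intro x1 x2 f t s hfS hfF hf1 hx2 ht ht1 e1 hs hs1 e2
    have n0 := hx.ne f hfS hfF
    have g1 : ev (ℓ f) x = (1 - t) * ev (ℓ f) v := by rw [e1, ev_combo, hf1]; ring
    have g2 : ev (ℓ f) x = (1 - s) * ev (ℓ f) v + s * ev (ℓ f) x2 := by rw [e2, ev_combo]
    have a1 := h1.bottom.mem f hfS
    have a2 := hx2 f hfS
    have hvn : ev (ℓ f) v ≠ 0 := fun e => n0 (by rw [g1, e, mul_zero])
    have a1' : 0 < ev (ℓ f) v * ev (ℓ f) y :=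
      lt_of_le_of_ne a1 (mul_ne_zero hvn (hy f hfS)).symm
    by_contra hlt
    push Not at hlt
    have e : (1 - t) * (ev (ℓ f) v * ev (ℓ f) y) =
        (1 - s) * (ev (ℓ f) v * ev (ℓ f) y) + s * (ev (ℓ f) x2 * ev (ℓ f) y) := by
      linear_combination ev (ℓ f) y * (g2 - g1)
    nlinarith [mul_nonneg hs.le a2, mul_pos (sub_pos.2 hlt) a1']
  obtain ⟨t, ht, ht1, e1⟩ := h1.between
  obtain ⟨s, hs, hs1, e2⟩ := h2.between
  have hts : t = s := le_antisymm
    (key h1.mem h1.notMem (h1.fine.zero f (Finset.mem_insert_self _ _)) h2.fine.mem ht ht1 e1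
      hs hs1 e2)
    (key h2.mem h2.notMem (h2.fine.zero f' (Finset.mem_insert_self _ _)) h1.fine.mem hs hs1 e2
      ht ht1 e1)
  subst hts
  have hxx : x1 = x2 := by
    have : t • (x1 - v) = t • (x2 - v) := add_left_cancel (e1.symm.trans e2)
    exact sub_left_injective (smul_right_injective _ ht.ne' this)
  subst hxx
  refine ⟨rfl, ?_, rfl⟩
  by_contra hne
  refine h2.fine.ne f h1.mem ?_ (h1.fine.zero f (Finset.mem_insert_self _ _))
  rw [Finset.mem_insert, not_or]
  exact ⟨hne, h1.notMem⟩

lemma Chain.unique (h : Generic ℓ c) {y : Pt d} (hy : ∀ g ∈ S, ev (ℓ g) y ≠ 0)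
    {L L' : List (ι × Pt d)} {x z z' : Pt d} {F : Finset ι} (hF : F ⊆ S)
    (hx : Fine ℓ S (closedCell ℓ S y) F x) (hlen : L.length = L'.length)
    (h1 : Chain ℓ c S (closedCell ℓ S y) F x L z)
    (h2 : Chain ℓ c S (closedCell ℓ S y) F x L' z') : L = L' ∧ z = z' := by
  induction L generalizing L' x F with
  | nil =>
    cases L' with
    | nil => exact ⟨rfl, h1.trans h2.symm⟩
    | cons a L' => simp at hlen
  | cons a L ih =>
    cases L' with
    | nil => simp at hlen
    | cons b L' =>
      obtain ⟨x1, s1, c1⟩ := h1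
      obtain ⟨x2, s2, c2⟩ := h2
      obtain ⟨e1, e2, e3⟩ := s1.unique h hy hF hx s2
      have hab : a = b := Prod.ext e2 e1
      subst hab e3
      obtain ⟨e4, e5⟩ := ih (Finset.insert_subset s1.mem hF) s1.fine (by simpa using hlen) c1 c2
      exact ⟨by rw [e4], e5⟩

lemma Chain.fine {C : Set (Pt d)} {L : List (ι × Pt d)} {x z : Pt d} {F : Finset ι}
    (hx : Fine ℓ S C F x) (h : Chain ℓ c S C F x L z) :
    Fine ℓ S C (F ∪ (L.map Prod.fst).toFinset) z := by
  induction L generalizing x F with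
  | nil =>
    have : z = x := h
    subst this
    simpa using hx
  | cons a L ih =>
    obtain ⟨x', s, hc⟩ := h
    have := ih s.fine hc
    rwa [List.map_cons, List.toFinset_cons, Finset.union_insert, ← Finset.insert_union]

lemma Chain.nodup {C : Set (Pt d)} {L : List (ι × Pt d)} {x z : Pt d} {F : Finset ι}
    (h : Chain ℓ c S C F x L z) :
    (L.map Prod.fst).Nodup ∧ (∀ a ∈ L, a.1 ∈ S ∧ a.1 ∉ F) := by
  induction L generalizing x F with
  | nil => simp
  | cons a L ih =>
    obtain ⟨x', s, hc⟩ := h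
    obtain ⟨h1, h2⟩ := ih hc
    refine ⟨?_, ?_⟩
    · rw [List.map_cons, List.nodup_cons]
      refine ⟨fun hm => ?_, h1⟩
      obtain ⟨b, hb, e⟩ := List.mem_map.1 hm
      exact (h2 b hb).2 (e ▸ Finset.mem_insert_self _ _)
    · intro b hb
      rcases List.mem_cons.1 hb with rfl | hb
      · exact ⟨s.mem, s.notMem⟩
      · exact ⟨(h2 b hb).1, fun hh => (h2 b hb).2 (Finset.mem_insert_of_mem hh)⟩

/-- The vertices of the simplex of a chain. -/
def verts (L : List (ι × Pt d)) (z : Pt d) : List (Pt d) := L.map Prod.snd ++ [z]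

lemma length_verts (L : List (ι × Pt d)) (z : Pt d) : (verts L z).length = L.length + 1 := by
  simp [verts]

lemma verts_cons (a : ι × Pt d) (L : List (ι × Pt d)) (z : Pt d) :
    verts (a :: L) z = a.2 :: verts L z := rfl

lemma Chain.mem_cell {C : Set (Pt d)} {L : List (ι × Pt d)} {x z : Pt d} {F : Finset ι}
    (hx : Fine ℓ S C F x) (h : Chain ℓ c S C F x L z) :
    ∀ v ∈ verts L z, v ∈ C ∧ ∀ g ∈ F, ev (ℓ g) v = 0 := by
  induction L generalizing x F with
  | nil =>
    have : z = x := h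
    subst this
    intro v hv
    have : v = z := by simpa [verts] using hv
    subst this
    exact ⟨hx.mem, hx.zero⟩
  | cons a L ih =>
    obtain ⟨x', s, hc⟩ := h
    intro v hv
    rw [verts_cons, List.mem_cons] at hv
    rcases hv with rfl | hv
    · exact ⟨s.bottom.mem, s.bottom.zero⟩
    · obtain ⟨h1, h2⟩ := ih s.fine hc v hv
      exact ⟨h1, fun g hg => h2 g (Finset.mem_insert_of_mem hg)⟩

/-- Affine independence of a list of points, in terms of weights. -/
def AffIndep (M : List (Pt d)) : Prop :=
  ∀ w : Fin M.length → ℝ, ∑ i, w i = 0 → ∑ i, w i • M.get i = 0 → w = 0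

lemma AffIndep.cons {M : List (Pt d)} (hM : AffIndep M) (u : Pt d × ℝ) {v : Pt d}
    (hv : ev u v ≠ 0) (hu : ∀ x ∈ M, ev u x = 0) : AffIndep (v :: M) := by
  intro w h1 h2
  have h1' : w 0 + ∑ i : Fin M.length, w i.succ = 0 := by
    rw [← h1]; exact (Fin.sum_univ_succ w).symm
  have h2' : w 0 • v + ∑ i : Fin M.length, w i.succ • M.get i = 0 := by
    rw [← h2]; exact (Fin.sum_univ_succ fun i : Fin (v :: M).length => w i • (v :: M).get i).symm
  have h0 : w 0 = 0 := by
    have e := congrArg (fun x => ⟪x, u.1⟫) h2'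
    simp only [inner_add_left, sum_inner, real_inner_smul_left, inner_zero_left] at e
    have e2 : ∀ i : Fin M.length, ⟪M.get i, u.1⟫ = u.2 := fun i => by
      have := hu _ (List.get_mem M i)
      unfold ev at this
      linarith
    simp only [e2, ← Finset.sum_mul] at e
    have e3 : ∑ i : Fin M.length, w i.succ = -w 0 := by linarith
    rw [e3] at e
    have : w 0 * ev u v = 0 := by unfold ev; linarith
    exact (mul_eq_zero.1 this).resolve_right hv
  rw [h0, zero_add] at h1'
  rw [h0, zero_smul, zero_add] at h2'
  have := hM _ h1' h2'
  funext i
  refine Fin.cases h0 (fun j => ?_) i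
  exact congrFun this j

lemma affIndep_singleton (z : Pt d) : AffIndep [z] := by
  intro w h1 _
  funext i
  have : w 0 = 0 := by rw [← h1]; exact (Fin.sum_univ_one w).symm
  have hi : i = (0 : Fin 1) := Subsingleton.elim (α := Fin 1) _ _
  rw [hi]; exact this

lemma Chain.affIndep {C : Set (Pt d)} {L : List (ι × Pt d)} {x z : Pt d} {F : Finset ι}
    (hx : Fine ℓ S C F x) (h : Chain ℓ c S C F x L z) : AffIndep (verts L z) := by
  induction L generalizing x F with
  | nil => exact affIndep_singleton z
  | cons a L ih =>
    obtain ⟨x', s, hc⟩ := h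
    rw [verts_cons]
    exact (ih s.fine hc).cons (ℓ a.1) (s.ev_ne hx) fun v hv =>
      (hc.mem_cell s.fine v hv).2 _ (Finset.mem_insert_self _ _)

lemma Chain.exists_weights {C : Set (Pt d)} {L : List (ι × Pt d)} {x z : Pt d} {F : Finset ι}
    (h : Chain ℓ c S C F x L z) :
    ∃ w : Fin (verts L z).length → ℝ, (∀ i, 0 < w i) ∧ ∑ i, w i = 1 ∧
      ∑ i, w i • (verts L z).get i = x := by
  induction L generalizing x F with
  | nil =>
    have : z = x := h
    subst this
    exact ⟨fun _ => 1, fun _ => one_pos, (Fin.sum_univ_one fun _ : Fin 1 => (1 : ℝ)), by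
      exact (Fin.sum_univ_one fun i : Fin 1 => (1 : ℝ) • [z].get i).trans (one_smul _ _)⟩
  | cons a L ih =>
    obtain ⟨x', s, hc⟩ := h
    obtain ⟨w, h1, h2, h3⟩ := ih hc
    obtain ⟨t, ht, ht1, e⟩ := s.between
    refine ⟨(Fin.cons (1 - t) fun i => t * w i : Fin ((verts L z).length + 1) → ℝ), fun i => ?_,
      ?_, ?_⟩
    · refine Fin.cases (sub_pos.2 ht1) (fun j => ?_) i
      exact mul_pos ht (h1 j)
    · refine (Fin.sum_univ_succ _).trans ?_
      change (1 - t) + ∑ i, t * w i = 1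
      rw [← Finset.mul_sum, h2]
      ring
    · refine (Fin.sum_univ_succ (n := (verts L z).length) _).trans ?_
      change (1 - t) • a.2 + ∑ i, (t * w i) • (verts L z).get i = x
      simp only [mul_smul]
      rw [← Finset.smul_sum, h3, e]
      module

/-- The open simplex of a list of vertices. -/
def openHull (M : List (Pt d)) : Set (Pt d) := interior (convexHull ℝ {x | x ∈ M})

lemma AffIndep.affineIndependent {M : List (Pt d)} (h : AffIndep M) :
    AffineIndependent ℝ M.get := by
  rw [affineIndependent_iff]
  intro s w h1 h2 e he
  have := h (fun i => if i ∈ s then w i else 0) (by simpa using h1)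
    (by simpa [ite_smul] using h2)
  have := congrFun this e
  simpa [he] using this

lemma AffIndep.isOpenSimplex {M : List (Pt d)} (h : AffIndep M) (hl : M.length = d + 1) :
    IsOpenSimplex (openHull M) := by
  refine ⟨fun i => M.get (finCongr hl.symm i), h.affineIndependent.comp_embedding
    (finCongr hl.symm).toEmbedding, ?_⟩
  unfold openHull
  congr 2
  ext x
  rw [Set.mem_ofPred_eq, List.mem_iff_get]
  constructor
  · rintro ⟨i, rfl⟩
    exact ⟨finCongr hl i, rfl⟩
  · rintro ⟨i, rfl⟩
    exact ⟨_, rfl⟩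

lemma AffIndep.mem_openHull {M : List (Pt d)} (h : AffIndep M) (hl : M.length = d + 1)
    {w : Fin M.length → ℝ} (hw : ∀ i, 0 < w i) (hw1 : ∑ i, w i = 1) :
    ∑ i, w i • M.get i ∈ openHull M := by
  have hai := h.affineIndependent
  have htop : affineSpan ℝ (Set.range M.get) = ⊤ := by
    rw [hai.affineSpan_eq_top_iff_card_eq_finrank_add_one]
    simp [hl]
  let b : AffineBasis (Fin M.length) ℝ (Pt d) := ⟨M.get, hai, htop⟩
  have hr : Set.range b = {x | x ∈ M} := by
    ext x
    rw [Set.mem_ofPred_eq, List.mem_iff_get]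
    rfl
  unfold openHull
  rw [← hr, AffineBasis.interior_convexHull]
  intro i
  have e : ∑ i, w i • M.get i = Finset.univ.affineCombination ℝ b w := by
    rw [Finset.affineCombination_eq_linear_combination _ _ _ hw1]
    rfl
  rw [e, AffineBasis.coord_apply_combination_of_mem _ (Finset.mem_univ i) hw1]
  exact hw i

end Triangulation

section Projection

variable {d : ℕ} {ι : Type} {ℓ : ι → Pt d × ℝ} {c : Pt d} {S : Finset ι}

/-- A vertex of the arrangement. -/
def IsVertex (ℓ : ι → Pt d × ℝ) (v : Pt d) : Prop :=
  ∃ G : Finset ι, G.card = d ∧ ∀ g ∈ G, ev (ℓ g) v = 0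

/-- `p` is in general position with respect to the flats and vertices of the arrangement. -/
def PointGeneric (ℓ : ι → Pt d × ℝ) (p : Pt d) : Prop :=
  ∀ G : Finset ι, G.card ≤ d → ∀ V : Finset (Pt d), (∀ v ∈ V, IsVertex ℓ v) → V.card < G.card →
    ∃ α : ι → ℝ, (∀ v ∈ V, ∑ g ∈ G, α g * ev (ℓ g) v = 0) ∧ ∑ g ∈ G, α g * ev (ℓ g) p ≠ 0

/-- `p` is in the affine hull of `x` and of at most `k` vertices, in terms of combinations of the
functionals. -/
def Reaches (ℓ : ι → Pt d × ℝ) (p : Pt d) (k : ℕ) (x : Pt d) : Prop :=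
  ∃ V : Finset (Pt d), (∀ v ∈ V, IsVertex ℓ v) ∧ V.card ≤ k ∧ ∀ (G : Finset ι) (α : ι → ℝ),
    (∀ v ∈ V, ∑ g ∈ G, α g * ev (ℓ g) v = 0) → ∑ g ∈ G, α g * ev (ℓ g) x = 0 →
      ∑ g ∈ G, α g * ev (ℓ g) p = 0

lemma exists_last_point {K : Set (Pt d)} (hK : IsCompact K) {v x : Pt d} (hx : x ∈ K)
    (hvx : x ≠ v) : ∃ s : ℝ, 1 ≤ s ∧ v + s • (x - v) ∈ K ∧
      ∀ t : ℝ, v + t • (x - v) ∈ K → t ≤ s := by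
  set T := {s : ℝ | v + s • (x - v) ∈ K} with hT
  have hn : 0 < ‖x - v‖ := norm_pos_iff.2 (sub_ne_zero.2 hvx)
  have hcl : IsClosed T := hK.isClosed.preimage (by fun_prop)
  obtain ⟨R, hR⟩ := hK.isBounded.subset_closedBall v
  have hsub : T ⊆ Set.Icc (-(R / ‖x - v‖)) (R / ‖x - v‖) := by
    intro s hs
    have := hR hs
    rw [mem_closedBall_iff_norm, add_sub_cancel_left, norm_smul, Real.norm_eq_abs] at this
    rw [Set.mem_Icc, ← abs_le, le_div_iff₀ hn]
    exact this
  have h1 : (1 : ℝ) ∈ T := by simpa [hT] using hx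
  obtain ⟨s, hs, hmax⟩ := (isCompact_Icc.of_isClosed_subset hcl hsub).exists_isGreatest ⟨1, h1⟩
  exact ⟨s, hmax h1, hs, fun t ht => hmax ht⟩

lemma exists_step (h : Generic ℓ c) {p x : Pt d} (hp : PointGeneric ℓ p)
    (hpS : ∀ g ∈ S, ev (ℓ g) p ≠ 0) (hK : IsCompact (closedCell ℓ S p)) {F : Finset ι}
    (hF : F ⊆ S) (hFd : F.card < d) (hx : Fine ℓ S (closedCell ℓ S p) F x)
    (hr : Reaches ℓ p F.card x) :
    ∃ v f x', Step ℓ c S (closedCell ℓ S p) F v x f x' ∧ Reaches ℓ p (insert f F).card x' := by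
  obtain ⟨v, hv⟩ := IsBottom.exists (c := c) F hK hx.mem hx.zero
  have hcard := hv.le_card_tight h hpS hF
  have hxv : x ≠ v := by
    rintro rfl
    rw [hx.tight_eq hF] at hcard
    omega
  obtain ⟨s, hs1, hsK, hmax⟩ := exists_last_point hK hx.mem hxv
  set x' := v + s • (x - v) with hx'
  have hx'F : ∀ g ∈ F, ev (ℓ g) x' = 0 := fun g hg => by
    rw [hx', ev_combo, hv.zero g hg, hx.zero g hg]; simp
  obtain ⟨f, hfS, hfF, hf0⟩ : ∃ f ∈ S, f ∉ F ∧ ev (ℓ f) x' = 0 := by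
    by_contra hno
    push Not at hno
    obtain ⟨t, ht, -, htK⟩ := exists_small_cell (w := x - v) hpS hsK (fun g hg e => by
      have hgF : g ∈ F := by
        by_contra hgF
        exact hno g hg hgF e
      rw [inner_sub_eq_ev, hx.zero g hgF, hv.zero g hgF, sub_zero])
    have := hmax (s + t) (by
      have e : v + (s + t) • (x - v) = x' + t • (x - v) := by rw [hx']; module
      rw [e]; exact htK)
    linarith
  have hs : 1 < s := by
    refine lt_of_le_of_ne hs1 fun e => hx.ne f hfS hfF ?_
    rw [hx', ← e] at hf0
    simpa using hf0
  have hs0 : 0 < s := by linarith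
  have hxe : x = v + s⁻¹ • (x' - v) := by
    rw [hx', add_sub_cancel_left, smul_smul, inv_mul_cancel₀ hs0.ne', one_smul]
    abel
  obtain ⟨V, hV, hVc, hVr⟩ := hr
  have hreach : ∀ (G : Finset ι) (α : ι → ℝ),
      (∀ w ∈ insert v V, ∑ g ∈ G, α g * ev (ℓ g) w = 0) → ∑ g ∈ G, α g * ev (ℓ g) x' = 0 →
      ∑ g ∈ G, α g * ev (ℓ g) p = 0 := by
    intro G α h1 h2
    refine hVr G α (fun w hw => h1 w (Finset.mem_insert_of_mem hw)) ?_
    have e : ∀ g ∈ G, α g * ev (ℓ g) x =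
        (1 - s⁻¹) * (α g * ev (ℓ g) v) + s⁻¹ * (α g * ev (ℓ g) x') := fun g _ => by
      conv_lhs => rw [hxe, ev_combo]
      ring
    rw [Finset.sum_congr rfl e, Finset.sum_add_distrib, ← Finset.mul_sum, ← Finset.mul_sum, h2,
      h1 v (Finset.mem_insert_self _ _)]
    simp
  have hvV : ∀ w ∈ insert v V, IsVertex ℓ w := by
    intro w hw
    rcases Finset.mem_insert.1 hw with rfl | hw
    · obtain ⟨G, hG, hGc⟩ := Finset.exists_subset_card_eq hcard
      exact ⟨G, hGc, fun g hg => (mem_tight.1 (hG hg)).2⟩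
    · exact hV w hw
  have hcardV : (insert v V).card ≤ F.card + 1 :=
    (Finset.card_insert_le _ _).trans (by omega)
  refine ⟨v, f, x', ⟨hv, hfS, hfF, ⟨hsK, ?_, ?_⟩, s⁻¹, inv_pos.2 hs0,
      inv_lt_one_of_one_lt₀ hs, hxe⟩,
    insert v V, hvV, by rwa [Finset.card_insert_of_notMem hfF], hreach⟩
  · intro g hg
    rcases Finset.mem_insert.1 hg with rfl | hg
    · exact hf0
    · exact hx'F g hg
  · intro g hgS hg e
    have hz : ∀ a ∈ insert g (insert f F), ev (ℓ a) x' = 0 := by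
      intro a ha
      rcases Finset.mem_insert.1 ha with rfl | ha
      · exact e
      rcases Finset.mem_insert.1 ha with rfl | ha
      · exact hf0
      · exact hx'F a ha
    have hc2 : (insert g (insert f F)).card = F.card + 2 := by
      rw [Finset.card_insert_of_notMem hg, Finset.card_insert_of_notMem hfF]
    obtain ⟨α, h1, h2⟩ := hp _ (h.card_le _ x' hz) (insert v V) hvV (by omega)
    refine h2 (hreach _ α h1 ?_)
    exact Finset.sum_eq_zero fun a ha => by rw [hz a ha, mul_zero]

lemma Chain.exists_aux (h : Generic ℓ c) {p : Pt d} (hp : PointGeneric ℓ p)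
    (hpS : ∀ g ∈ S, ev (ℓ g) p ≠ 0) (hK : IsCompact (closedCell ℓ S p)) (n : ℕ) {F : Finset ι}
    {x : Pt d} (hF : F ⊆ S) (hFd : F.card + n = d) (hx : Fine ℓ S (closedCell ℓ S p) F x)
    (hr : Reaches ℓ p F.card x) :
    ∃ L z, L.length = n ∧ Chain ℓ c S (closedCell ℓ S p) F x L z := by
  induction n generalizing F x with
  | zero => exact ⟨[], x, rfl, rfl⟩
  | succ n ih =>
    obtain ⟨v, f, x', hs, hr'⟩ := exists_step h hp hpS hK hF (by omega) hx hr
    obtain ⟨L, z, hL, hc⟩ := ih (Finset.insert_subset hs.mem hF)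
      (by rw [Finset.card_insert_of_notMem hs.notMem]; omega) hs.fine hr'
    exact ⟨(f, v) :: L, z, by rw [List.length_cons, hL], x', hs, hc⟩

lemma fine_self {p : Pt d} (hpS : ∀ g ∈ S, ev (ℓ g) p ≠ 0) :
    Fine ℓ S (closedCell ℓ S p) ∅ p :=
  ⟨fun _ _ => mul_self_nonneg _, by simp, fun g hg _ => hpS g hg⟩

/-- `M` is the list of vertices of the simplex containing `p` in the bottom-vertex triangulation of
the arrangement of `S`. -/
def IsSimplexAt (ℓ : ι → Pt d × ℝ) (c : Pt d) (S : Finset ι) (p : Pt d) (M : List (Pt d)) : Prop :=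
  ∃ L z, L.length = d ∧ Chain ℓ c S (closedCell ℓ S p) ∅ p L z ∧ M = verts L z

lemma exists_isSimplexAt (h : Generic ℓ c) {p : Pt d} (hp : PointGeneric ℓ p)
    (hpS : ∀ g ∈ S, ev (ℓ g) p ≠ 0) (hK : IsCompact (closedCell ℓ S p)) :
    ∃ M, IsSimplexAt ℓ c S p M := by
  obtain ⟨L, z, h1, h2⟩ := Chain.exists_aux h hp hpS hK d (Finset.empty_subset _) (by simp)
    (fine_self hpS) ⟨∅, by simp, by simp, fun _ _ _ h => h⟩
  exact ⟨_, L, z, h1, h2, rfl⟩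

variable {p : Pt d} {M M' : List (Pt d)}

lemma IsSimplexAt.unique (h : Generic ℓ c) (hpS : ∀ g ∈ S, ev (ℓ g) p ≠ 0)
    (hM : IsSimplexAt ℓ c S p M) (hM' : IsSimplexAt ℓ c S p M') : M = M' := by
  obtain ⟨L, z, h1, h2, rfl⟩ := hM
  obtain ⟨L', z', h1', h2', rfl⟩ := hM'
  obtain ⟨rfl, rfl⟩ := h2.unique h hpS (Finset.empty_subset _) (fine_self hpS)
    (h1.trans h1'.symm) h2'
  rfl

lemma IsSimplexAt.length (hM : IsSimplexAt ℓ c S p M) : M.length = d + 1 := by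
  obtain ⟨L, z, h1, h2, rfl⟩ := hM
  rw [length_verts, h1]

lemma IsSimplexAt.isOpenSimplex (hpS : ∀ g ∈ S, ev (ℓ g) p ≠ 0) (hM : IsSimplexAt ℓ c S p M) :
    IsOpenSimplex (openHull M) := by
  have hl := hM.length
  obtain ⟨L, z, h1, h2, rfl⟩ := hM
  exact (h2.affIndep (fine_self hpS)).isOpenSimplex hl

lemma IsSimplexAt.mem (hpS : ∀ g ∈ S, ev (ℓ g) p ≠ 0) (hM : IsSimplexAt ℓ c S p M) :
    p ∈ openHull M := by
  have hl := hM.length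
  obtain ⟨L, z, h1, h2, rfl⟩ := hM
  obtain ⟨w, hw, hw1, e⟩ := h2.exists_weights
  rw [← e]
  exact (h2.affIndep (fine_self hpS)).mem_openHull hl hw hw1

lemma IsSimplexAt.subset_cell (hpS : ∀ g ∈ S, ev (ℓ g) p ≠ 0) (hM : IsSimplexAt ℓ c S p M) :
    convexHull ℝ {x | x ∈ M} ⊆ closedCell ℓ S p := by
  obtain ⟨L, z, h1, h2, rfl⟩ := hM
  refine convexHull_min (fun v hv => (h2.mem_cell (fine_self hpS) v hv).1) ?_
  intro x hx y hy a b ha hb hab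
  have e : a • x + b • y = x + b • (y - x) := by
    rw [← eq_sub_iff_add_eq] at hab
    rw [hab]
    module
  rw [e]
  exact closedCell_combo hx hy hb (by linarith)

lemma IsSimplexAt.ev_ne (hpS : ∀ g ∈ S, ev (ℓ g) p ≠ 0) (hM : IsSimplexAt ℓ c S p M) {g : ι}
    (hg : g ∈ S) {x : Pt d} (hx : x ∈ openHull M) : ev (ℓ g) x ≠ 0 := by
  intro h0
  have hc : Continuous fun t : ℝ => x + t • (x - p) := by fun_prop
  have hev : ∀ᶠ t in 𝓝[>] (0 : ℝ), x + t • (x - p) ∈ openHull M :=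
    (hc.continuousAt.eventually (IsOpen.mem_nhds (s := openHull M) isOpen_interior
      (by simpa using hx))).filter_mono
      nhdsWithin_le_nhds
  obtain ⟨t, ht, ht0⟩ := (hev.and eventually_mem_nhdsWithin).exists
  have := hM.subset_cell hpS (interior_subset ht) g hg
  rw [ev_add_smul, h0, inner_sub_eq_ev, h0] at this
  have := mul_pos (Set.mem_Ioi.1 ht0) (mul_self_pos.2 (hpS g hg))
  linarith

lemma closedCell_erase_subset (h : ι) (p : Pt d) : closedCell ℓ S p ⊆ closedCell ℓ (S.erase h) p :=
  fun _ hx g hg => hx g (Finset.mem_of_mem_erase hg)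

lemma IsBottom.erase {h : ι} {F : Finset ι} {v : Pt d} (hv : IsBottom ℓ c (closedCell ℓ S p) F v)
    (h0 : ev (ℓ h) v ≠ 0) : IsBottom ℓ c (closedCell ℓ (S.erase h) p) F v := by
  refine ⟨closedCell_erase_subset h p hv.mem, hv.zero, fun w hw hwF => ?_⟩
  by_contra hlt
  push Not at hlt
  obtain ⟨t, ht, ht1, hsign⟩ := exists_small ℓ {h} v (w - v)
  have hs := hsign h (Finset.mem_singleton_self h) h0
  have hmem : v + t • (w - v) ∈ closedCell ℓ S p := by
    intro g hg
    by_cases e : g = h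
    · subst e
      have h1 := hv.mem g hg
      by_contra hneg
      push Not at hneg
      have := mul_pos hs (mul_self_pos.2 h0)
      nlinarith [mul_self_nonneg (ev (ℓ g) v), mul_nonneg h1 hs.le]
    · exact closedCell_combo (closedCell_erase_subset h p hv.mem) hw ht.le ht1 g
        (Finset.mem_erase.2 ⟨e, hg⟩)
  have := hv.min _ hmem fun g hg => by rw [ev_combo, hv.zero g hg, hwF g hg]; simp
  rw [inner_add_left, real_inner_smul_left, inner_sub_left] at this
  nlinarith

lemma Chain.erase {h : ι} {L : List (ι × Pt d)} {x z : Pt d} {F : Finset ι}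
    (hx : Fine ℓ S (closedCell ℓ S p) F x) (hc : Chain ℓ c S (closedCell ℓ S p) F x L z)
    (h0 : ∀ v ∈ verts L z, ev (ℓ h) v ≠ 0) :
    Chain ℓ c (S.erase h) (closedCell ℓ (S.erase h) p) F x L z := by
  induction L generalizing x F with
  | nil => exact hc
  | cons a L ih =>
    obtain ⟨x', s, hc⟩ := hc
    rw [verts_cons] at h0
    refine ⟨x', ⟨s.bottom.erase (h0 _ List.mem_cons_self), Finset.mem_erase.2 ⟨?_, s.mem⟩,
      s.notMem, ⟨closedCell_erase_subset h p s.fine.mem, s.fine.zero,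
        fun g hg => s.fine.ne g (Finset.mem_of_mem_erase hg)⟩, s.between⟩,
      ih s.fine hc fun v hv => h0 v (List.mem_cons_of_mem _ hv)⟩
    intro e
    have hz : z ∈ verts L z := by simp [verts]
    refine h0 z (List.mem_cons_of_mem _ hz) ?_
    rw [← e]
    exact (hc.mem_cell s.fine z hz).2 _ (Finset.mem_insert_self _ _)

/-- The simplex at `p` does not change when a hyperplane is removed, except for at most `(d+1)d`
hyperplanes. -/
lemma IsSimplexAt.exists_stable (h : Generic ℓ c) (hpS : ∀ g ∈ S, ev (ℓ g) p ≠ 0)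
    (hM : IsSimplexAt ℓ c S p M) : ∃ D : Finset ι, D.card ≤ (d + 1) * d ∧
      ∀ g ∈ S, g ∉ D → IsSimplexAt ℓ c (S.erase g) p M := by
  refine ⟨M.toFinset.biUnion (tight ℓ S), ?_, fun g hg hgD => ?_⟩
  · refine (Finset.card_biUnion_le_card_mul _ _ d fun v _ => h.card_tight_le v).trans ?_
    gcongr
    exact (List.toFinset_card_le _).trans hM.length.le
  · obtain ⟨L, z, h1, h2, rfl⟩ := hM
    refine ⟨L, z, h1, h2.erase (fine_self hpS) fun v hv e => hgD ?_, rfl⟩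
    exact Finset.mem_biUnion.2 ⟨v, List.mem_toFinset.2 hv, mem_tight.2 ⟨hg, e⟩⟩

lemma closedCell_eq_of_posSet {p' : Pt d} (hpS : ∀ g ∈ S, ev (ℓ g) p ≠ 0)
    (hpS' : ∀ g ∈ S, ev (ℓ g) p' ≠ 0) (h : posSet ℓ S p = posSet ℓ S p') :
    closedCell ℓ S p = closedCell ℓ S p' := by
  have key : ∀ {p p' : Pt d}, (∀ g ∈ S, ev (ℓ g) p ≠ 0) → (∀ g ∈ S, ev (ℓ g) p' ≠ 0) →
      posSet ℓ S p = posSet ℓ S p' → closedCell ℓ S p ⊆ closedCell ℓ S p' := by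
    intro p p' hp hp' h x hx g hg
    have h1 := hx g hg
    have h2 : g ∈ posSet ℓ S p ↔ g ∈ posSet ℓ S p' := by rw [h]
    simp only [posSet, Finset.mem_filter, hg, true_and] at h2
    rcases lt_or_gt_of_ne (hp g hg) with h3 | h3
    · have h4 : ev (ℓ g) p' ≤ 0 := not_lt.1 fun h => absurd (h2.2 h) h3.le.not_gt
      exact mul_nonneg_of_nonpos_of_nonpos (nonpos_of_mul_nonneg_left h1 h3) h4
    · exact mul_nonneg (nonneg_of_mul_nonneg_left h1 h3) (h2.1 h3).le
  exact Set.Subset.antisymm (key hpS hpS' h) (key hpS' hpS h.symm)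

lemma Chain.verts_unique (h : Generic ℓ c) (hpS : ∀ g ∈ S, ev (ℓ g) p ≠ 0)
    {L L' : List (ι × Pt d)} {x x' z z' : Pt d} {F : Finset ι} (hF : F ⊆ S)
    (hx : Fine ℓ S (closedCell ℓ S p) F x) (hx' : Fine ℓ S (closedCell ℓ S p) F x')
    (hL : L.map Prod.fst = L'.map Prod.fst) (hd : F.card + L.length = d)
    (h1 : Chain ℓ c S (closedCell ℓ S p) F x L z)
    (h2 : Chain ℓ c S (closedCell ℓ S p) F x' L' z') : L = L' ∧ z = z' := by
  induction L generalizing L' x x' F with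
  | nil =>
    obtain rfl : L' = [] := by simpa using hL.symm
    have e1 : z = x := h1
    have e2 : z' = x' := h2
    refine ⟨rfl, ?_⟩
    rw [e1, e2, ← sub_eq_zero]
    exact h.uniq F hd _ fun g hg => by
      rw [inner_sub_eq_ev, hx.zero g hg, hx'.zero g hg, sub_zero]
  | cons a L ih =>
    cases L' with
    | nil => simp at hL
    | cons b L' =>
      obtain ⟨x1, s1, c1⟩ := h1
      obtain ⟨x2, s2, c2⟩ := h2
      simp only [List.map_cons, List.cons.injEq] at hL
      have hab : a = b := Prod.ext hL.1 (s1.bottom.unique h hpS hF s2.bottom)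
      subst hab
      obtain ⟨e4, e5⟩ := ih (Finset.insert_subset s1.mem hF) s1.fine s2.fine hL.2
        (by rw [Finset.card_insert_of_notMem s1.notMem]
            simp only [List.length_cons] at hd; omega) c1 c2
      exact ⟨by rw [e4], e5⟩

/-- Points in distinct simplices are at most `d!` times as numerous as the border vertices. -/
lemma card_le_factorial_mul_borders (h : Generic ℓ c) {Y : Finset (Pt d)}
    (hY : ∀ y ∈ Y, ∀ g ∈ S, ev (ℓ g) y ≠ 0) (M : Pt d → List (Pt d))
    (hM : ∀ y ∈ Y, IsSimplexAt ℓ c S y (M y))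
    (hdist : ∀ y ∈ Y, ∀ y' ∈ Y, y' ∈ openHull (M y) → y' = y) :
    Y.card ≤ d.factorial * (borders ℓ Y S 0 d).card := by
  choose! L z hL hc hMe using hM
  have hmap : ∀ y ∈ Y, ((L y).map Prod.fst).toFinset.card = d := fun y hy => by
    rw [List.toFinset_card_of_nodup (hc y hy).nodup.1, List.length_map, hL y hy]
  set φ : Pt d → Finset ι × Finset ι × Finset ι := fun y =>
    (∅, ((L y).map Prod.fst).toFinset, posSet ℓ S y) with hφ
  have himg : Y.image φ ⊆ borders ℓ Y S 0 d := by
    intro b hb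
    obtain ⟨y, hy, rfl⟩ := Finset.mem_image.1 hb
    have hsub : ((L y).map Prod.fst).toFinset ⊆ S := by
      intro g hg
      obtain ⟨a, ha, rfl⟩ := List.mem_map.1 (List.mem_toFinset.1 hg)
      exact ((hc y hy).nodup.2 a ha).1
    refine mem_borders.2 ⟨rfl, hmap y hy, ?_⟩
    have hf := (hc y hy).fine (fine_self (hY y hy))
    rw [Finset.empty_union] at hf
    refine ⟨Finset.empty_subset _, hsub, Finset.filter_subset _ _, by simp, by simp,
      ⟨z y, ?_, ?_⟩, ?_⟩
    · rw [Finset.empty_union]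
      exact hf.zero
    · intro g hg hgF
      rw [Finset.empty_union] at hgF
      have hne := hf.ne g hg hgF
      refine ⟨hne, ?_⟩
      have h1 := hf.mem g hg
      simp only [posSet, Finset.mem_filter, hg, true_and]
      constructor
      · intro hp
        exact lt_of_le_of_ne (nonneg_of_mul_nonneg_left h1 hp) hne.symm
      · intro hp
        exact lt_of_le_of_ne (nonneg_of_mul_nonneg_right h1 hp) (hY y hy g hg).symm
    · intro D hD
      rw [Finset.subset_empty.1 hD, Finset.union_empty]
      exact Finset.mem_image_of_mem _ hy
  refine (Finset.card_le_mul_card_image (f := φ) Y d.factorial ?_).trans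
    (Nat.mul_le_mul_left _ (Finset.card_le_card himg))
  intro b hb
  obtain ⟨y0, hy0, rfl⟩ := Finset.mem_image.1 hb
  have hcardp : ((((L y0).map Prod.fst).toFinset.toList).permutations.toFinset).card ≤
      d.factorial := by
    refine (List.toFinset_card_le _).trans ?_
    rw [List.length_permutations, Finset.length_toList, hmap y0 hy0]
  refine le_trans (Finset.card_le_card_of_injOn (fun y => (L y).map Prod.fst) ?_ ?_) hcardp
  · intro y hy
    obtain ⟨hyY, e⟩ := Finset.mem_filter.1 hy
    simp only [hφ, Prod.mk.injEq, true_and] at e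
    simp only [List.coe_toFinset, Set.mem_ofPred_eq, List.mem_permutations]
    refine List.perm_of_nodup_nodup_toFinset_eq (hc y hyY).nodup.1 (Finset.nodup_toList _) ?_
    rw [Finset.toList_toFinset, e.1]
  · intro y hy y' hy' e
    obtain ⟨hyY, e1⟩ := Finset.mem_filter.1 hy
    obtain ⟨hyY', e1'⟩ := Finset.mem_filter.1 hy'
    simp only [hφ, Prod.mk.injEq, true_and] at e1 e1'
    have hcell := closedCell_eq_of_posSet (hY y hyY) (hY y' hyY') (e1.2.trans e1'.2.symm)
    have hc' := hc y' hyY'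
    have hf' := fine_self (hY y' hyY')
    rw [← hcell] at hc' hf'
    obtain ⟨e2, e3⟩ := (hc y hyY).verts_unique h (hY y hyY) (Finset.empty_subset _)
      (fine_self (hY y hyY)) hf' e (by simp [hL y hyY]) hc'
    refine (hdist y hyY y' hyY' ?_).symm
    have := IsSimplexAt.mem (hY y' hyY') ⟨L y', z y', hL y' hyY', hc y' hyY', rfl⟩
    rw [hMe y hyY, e2, e3]
    exact this

end Projection

/-! ### Random sampling -/

section Sampling

variable {d : ℕ} {ι κ : Type} {ℓ : ι → Pt d × ℝ} {c : Pt d} {S₀ : Finset ι}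

/-- The total weight of the hyperplanes that meet the simplex with vertices `M`. -/
def crossWeight [Fintype κ] (ℓ : ι → Pt d × ℝ) (j : κ → ι) (w : κ → ℝ) (M : List (Pt d)) : ℝ :=
  ∑ q, if ∃ x ∈ openHull M, ev (ℓ (j q)) x = 0 then w q else 0

/-- The hyperplanes of `S₀` together with those picked by `s`. -/
def pick (S₀ : Finset ι) (j : κ → ι) {n : ℕ} (s : Fin n → κ) : Finset ι :=
  S₀ ∪ Finset.univ.image fun i => j (s i)

lemma pick_erase (j : κ → ι) {n : ℕ} (s : Fin (n + 1) → κ) (i : Fin (n + 1))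
    (h : j (s i) ∉ pick S₀ j (s ∘ i.succAbove)) :
    (pick S₀ j s).erase (j (s i)) = pick S₀ j (s ∘ i.succAbove) := by
  ext g
  simp only [pick, Finset.mem_erase, Finset.mem_union, Finset.mem_image, Finset.mem_univ, true_and,
    Function.comp_apply] at h ⊢
  constructor
  · rintro ⟨h1, h2 | ⟨a, rfl⟩⟩
    · exact Or.inl h2
    · rcases Fin.eq_self_or_eq_succAbove i a with rfl | ⟨b, rfl⟩
      · exact absurd rfl h1
      · exact Or.inr ⟨b, rfl⟩
  · intro h1
    refine ⟨fun e => h (e ▸ h1), ?_⟩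
    rcases h1 with h1 | ⟨a, rfl⟩
    · exact Or.inl h1
    · exact Or.inr ⟨_, rfl⟩

lemma card_crossing_le (h : Generic ℓ c) (j : κ → ι) {p : Pt d} (hp : ∀ g, ev (ℓ g) p ≠ 0)
    (Δ : Finset ι → List (Pt d)) (hΔ : ∀ S, S₀ ⊆ S → IsSimplexAt ℓ c S p (Δ S)) {n : ℕ}
    (s : Fin (n + 1) → κ) :
    (Finset.univ.filter fun i : Fin (n + 1) =>
      ∃ x ∈ openHull (Δ (pick S₀ j (s ∘ i.succAbove))), ev (ℓ (j (s i))) x = 0).card ≤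
      (d + 1) * d := by
  obtain ⟨D, hD, hstab⟩ := (hΔ _ (Finset.subset_union_left (s₂ := Finset.univ.image fun i =>
    j (s i)))).exists_stable h fun g _ => hp g
  refine (Finset.card_le_card_of_injOn (fun i => j (s i)) ?_ ?_).trans hD
  all_goals
    have hnot : ∀ i : Fin (n + 1), (∃ x ∈ openHull (Δ (pick S₀ j (s ∘ i.succAbove))),
        ev (ℓ (j (s i))) x = 0) → j (s i) ∉ pick S₀ j (s ∘ i.succAbove) := by
      rintro i ⟨x, hx, hx0⟩ hmem
      exact (hΔ _ Finset.subset_union_left).ev_ne (fun g _ => hp g) hmem hx hx0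
  · intro i hi
    obtain ⟨x, hx, hx0⟩ := (Finset.mem_filter.1 hi).2
    have hn := hnot i ⟨x, hx, hx0⟩
    by_contra hiD
    have hmem : j (s i) ∈ pick S₀ j s :=
      Finset.mem_union_right _ (Finset.mem_image_of_mem _ (Finset.mem_univ i))
    have h1 := hstab _ hmem hiD
    have h2 := pick_erase j s i hn
    unfold pick at h2 hmem
    rw [h2] at h1
    have h3 := h1.unique h (fun g _ => hp g) (hΔ _ Finset.subset_union_left)
    refine (hΔ _ (Finset.subset_union_left (s₂ := Finset.univ.image fun i =>
      j (s i)))).ev_ne (fun g _ => hp g) hmem ?_ hx0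
    rw [h3]
    exact hx
  · intro a ha b hb e
    by_contra hab
    refine hnot a (Finset.mem_filter.1 ha).2 ?_
    obtain ⟨t, ht⟩ := Fin.exists_succAbove_eq (Ne.symm hab)
    refine Finset.mem_union_right _ (Finset.mem_image.2 ⟨t, Finset.mem_univ _, ?_⟩)
    have e' : j (s a) = j (s b) := e
    rw [e', Function.comp_apply, ht]

variable [Fintype κ]

lemma sum_crossWeight_le (h : Generic ℓ c) (j : κ → ι) {p : Pt d} (hp : ∀ g, ev (ℓ g) p ≠ 0)
    (Δ : Finset ι → List (Pt d)) (hΔ : ∀ S, S₀ ⊆ S → IsSimplexAt ℓ c S p (Δ S)) (n : ℕ)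
    {w : κ → ℝ} (hw : ∀ q, 0 ≤ w q) :
    (n + 1) * ∑ s : Fin n → κ, (∏ i, w (s i)) * crossWeight ℓ j w (Δ (pick S₀ j s)) ≤
      ((d + 1) * d) * (∑ q, w q) ^ (n + 1) := by
  have key : ∀ i : Fin (n + 1),
      ∑ s : Fin n → κ, (∏ i, w (s i)) * crossWeight ℓ j w (Δ (pick S₀ j s)) =
      ∑ s : Fin (n + 1) → κ, (∏ i, w (s i)) *
        (if ∃ x ∈ openHull (Δ (pick S₀ j (s ∘ i.succAbove))), ev (ℓ (j (s i))) x = 0 then 1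
          else 0) := by
    intro i
    rw [← (Fin.insertNthEquiv (fun _ => κ) i).sum_comp, Fintype.sum_prod_type_right]
    refine Finset.sum_congr rfl fun s _ => ?_
    rw [crossWeight, Finset.mul_sum]
    refine Finset.sum_congr rfl fun q _ => ?_
    have e : (i.insertNth q s : Fin (n + 1) → κ) ∘ i.succAbove = s := by
      funext a; simp
    have e' : Fin.insertNthEquiv (fun _ => κ) i (q, s) = (i.insertNth q s : Fin (n + 1) → κ) := rfl
    rw [e']
    simp only [Fin.prod_univ_succAbove _ i, Fin.insertNth_apply_same,
      Fin.insertNth_apply_succAbove, e]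
    split_ifs <;> ring
  calc (n + 1) * ∑ s : Fin n → κ, (∏ i, w (s i)) * crossWeight ℓ j w (Δ (pick S₀ j s))
      = ∑ i : Fin (n + 1), ∑ s : Fin (n + 1) → κ, (∏ i, w (s i)) *
        (if ∃ x ∈ openHull (Δ (pick S₀ j (s ∘ i.succAbove))), ev (ℓ (j (s i))) x = 0 then (1 : ℝ)
          else 0) := by
        rw [← Finset.sum_congr rfl fun i _ => key i]
        simp
    _ = ∑ s : Fin (n + 1) → κ, (∏ i, w (s i)) *
        ((Finset.univ.filter fun i : Fin (n + 1) =>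
          ∃ x ∈ openHull (Δ (pick S₀ j (s ∘ i.succAbove))), ev (ℓ (j (s i))) x = 0).card : ℝ) := by
        rw [Finset.sum_comm]
        refine Finset.sum_congr rfl fun s _ => ?_
        rw [← Finset.mul_sum, Finset.sum_boole]
    _ ≤ ∑ s : Fin (n + 1) → κ, (∏ i, w (s i)) * ((d + 1) * d) := by
        refine Finset.sum_le_sum fun s _ => ?_
        refine mul_le_mul_of_nonneg_left ?_ (Finset.prod_nonneg fun i _ => hw _)
        exact_mod_cast card_crossing_le h j hp Δ hΔ s
    _ = ((d + 1) * d) * (∑ q, w q) ^ (n + 1) := by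
        rw [← Finset.sum_mul, mul_comm, Fintype.sum_pow]

lemma exists_sample [Nonempty κ] (h : Generic ℓ c) (j : κ → ι) {P : Finset (Pt d)}
    (hP : ∀ p ∈ P, ∀ g, ev (ℓ g) p ≠ 0) (Δ : Finset ι → Pt d → List (Pt d))
    (hΔ : ∀ S, S₀ ⊆ S → ∀ p ∈ P, IsSimplexAt ℓ c S p (Δ S p)) (n : ℕ)
    {w : κ → ℝ} (hw : ∀ q, 0 < w q) :
    ∃ S, S₀ ⊆ S ∧ S.card ≤ S₀.card + n ∧
      (n + 1) * ∑ p ∈ P, crossWeight ℓ j w (Δ S p) ≤ P.card * ((d + 1) * d) * ∑ q, w q := by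
  by_contra hno
  push Not at hno
  have hlt : ∀ s : Fin n → κ, P.card * ((d + 1) * d) * ∑ q, w q <
      (n + 1) * ∑ p ∈ P, crossWeight ℓ j w (Δ (pick S₀ j s) p) := fun s => by
    refine hno _ Finset.subset_union_left ((Finset.card_union_le _ _).trans ?_)
    gcongr
    exact Finset.card_image_le.trans (by simp)
  have h1 : ∑ s : Fin n → κ, (∏ i, w (s i)) * (P.card * ((d + 1) * d) * ∑ q, w q) <
      ∑ s : Fin n → κ, (∏ i, w (s i)) *
        ((n + 1) * ∑ p ∈ P, crossWeight ℓ j w (Δ (pick S₀ j s) p)) := by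
    refine Finset.sum_lt_sum_of_nonempty Finset.univ_nonempty fun s _ => ?_
    exact mul_lt_mul_of_pos_left (hlt s) (Finset.prod_pos fun i _ => hw _)
  have h2 : ∑ s : Fin n → κ, (∏ i, w (s i)) *
        ((n + 1) * ∑ p ∈ P, crossWeight ℓ j w (Δ (pick S₀ j s) p)) =
      ∑ p ∈ P, (n + 1) * ∑ s : Fin n → κ, (∏ i, w (s i)) *
        crossWeight ℓ j w (Δ (pick S₀ j s) p) := by
    rw [← Finset.mul_sum, Finset.sum_comm, Finset.mul_sum]
    refine Finset.sum_congr rfl fun s _ => ?_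
    rw [← Finset.mul_sum]
    ring
  have h3 : ∑ p ∈ P, (n + 1) * ∑ s : Fin n → κ, (∏ i, w (s i)) *
        crossWeight ℓ j w (Δ (pick S₀ j s) p) ≤
      ∑ p ∈ P, ((d + 1) * d) * (∑ q, w q) ^ (n + 1) :=
    Finset.sum_le_sum fun p hp => sum_crossWeight_le h j (hP p hp) (fun S => Δ S p)
      (fun S hS => hΔ S hS p hp) n fun q => (hw q).le
  rw [← Finset.sum_mul, ← Fintype.sum_pow] at h1
  rw [Finset.sum_const, nsmul_eq_mul] at h3
  rw [h2] at h1
  have h4 : (∑ q, w q) ^ n * (P.card * ((d + 1) * d) * ∑ q, w q) =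
      P.card * (((d + 1) * d) * (∑ q, w q) ^ (n + 1)) := by ring
  linarith

end Sampling

/-! ### A simplex with many points and few crossings -/

lemma exists_independent {V : Type*} (m : ℕ) (out : V → Finset V) (G : Finset V)
    (h : ∀ x ∈ G, (out x).card ≤ m) :
    ∃ Y ⊆ G, (∀ y ∈ Y, ∀ y' ∈ Y, y' ≠ y → y' ∉ out y) ∧ G.card ≤ (2 * m + 1) * Y.card := by
  induction hn : G.card using Nat.strong_induction_on generalizing G with
  | _ n ih =>
    subst hn
    rcases G.eq_empty_or_nonempty with rfl | hG
    · exact ⟨∅, by simp⟩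
    obtain ⟨x, hx, hin⟩ : ∃ x ∈ G, (G.filter fun y => x ∈ out y).card ≤ m := by
      refine Finset.exists_le_of_sum_le hG ?_
      have := Finset.sum_card_bipartiteAbove_eq_sum_card_bipartiteBelow (s := G) (t := G)
        fun x y => x ∈ out y
      unfold Finset.bipartiteAbove Finset.bipartiteBelow at this
      rw [this]
      refine Finset.sum_le_sum fun y hy => le_trans (Finset.card_le_card fun a ha => ?_) (h y hy)
      exact (Finset.mem_filter.1 ha).2
    set R := insert x (out x ∪ G.filter fun y => x ∈ out y) with hR
    have hRc : R.card ≤ 2 * m + 1 := by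
      refine (Finset.card_insert_le _ _).trans ?_
      have := Finset.card_union_le (out x) (G.filter fun y => x ∈ out y)
      have := h x hx
      omega
    have hlt : (G \ R).card < G.card := Finset.card_lt_card <| by
      refine Finset.ssubset_iff_subset_ne.2 ⟨Finset.sdiff_subset, fun e => ?_⟩
      rw [← e] at hx
      exact (Finset.mem_sdiff.1 hx).2 (Finset.mem_insert_self _ _)
    obtain ⟨Y, hYG, hY, hYc⟩ := ih _ hlt (G \ R)
      (fun y hy => h y (Finset.mem_sdiff.1 hy).1) rfl
    have hnot : ∀ y ∈ Y, y ∈ G ∧ y ≠ x ∧ y ∉ out x ∧ x ∉ out y := by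
      intro y hy
      have := Finset.mem_sdiff.1 (hYG hy)
      simp only [hR, Finset.mem_insert, Finset.mem_union, Finset.mem_filter, not_or,
        not_and] at this
      exact ⟨this.1, this.2.1, this.2.2.1, this.2.2.2 this.1⟩
    refine ⟨insert x Y, Finset.insert_subset hx fun y hy => (hnot y hy).1, ?_, ?_⟩
    · intro y hy y' hy' hne
      rcases Finset.mem_insert.1 hy with rfl | hyY <;>
        rcases Finset.mem_insert.1 hy' with rfl | hyY'
      · exact absurd rfl hne
      · exact (hnot y' hyY').2.2.1
      · exact (hnot y hyY).2.2.2
      · exact hY y hyY y' hyY' hne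
    · rw [Finset.card_insert_of_notMem fun hxY => (hnot x hxY).2.1 rfl]
      have := Finset.le_card_sdiff R G
      have e : (2 * m + 1) * (Y.card + 1) = (2 * m + 1) * Y.card + (2 * m + 1) := by ring
      omega

/-- A generic family of affine functionals containing the facets `S₀` of a bounded simplex inside
`B` around
the set of points `P`, which is in general position with respect to the family. -/
structure Setting {d : ℕ} {ι : Type} (ℓ : ι → Pt d × ℝ) (c : Pt d) (S₀ : Finset ι)
    (P : Finset (Pt d)) (B : Set (Pt d)) : Prop where
  generic : Generic ℓ c
  card : S₀.card = d + 1
  off : ∀ p ∈ P, ∀ g, ev (ℓ g) p ≠ 0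
  pointGeneric : ∀ p ∈ P, PointGeneric ℓ p
  compact : ∀ p ∈ P, IsCompact (closedCell ℓ S₀ p)
  bounded : ∀ p ∈ P, closedCell ℓ S₀ p ⊆ B

/-- The list `M` spans an open simplex contained in `B`. -/
def IsSimplexIn {d : ℕ} (B : Set (Pt d)) (M : List (Pt d)) : Prop :=
  IsOpenSimplex (openHull M) ∧ openHull M ⊆ B

section OneClass

variable {d : ℕ} {ι κ : Type} [Fintype κ] {ℓ : ι → Pt d × ℝ} {c : Pt d} {S₀ : Finset ι}
  {P : Finset (Pt d)} {B : Set (Pt d)} {k : ℕ}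

lemma Setting.subset (h : Setting ℓ c S₀ P B) {P' : Finset (Pt d)} (hP : P' ⊆ P) :
    Setting ℓ c S₀ P' B :=
  ⟨h.generic, h.card, fun p hp => h.off p (hP hp), fun p hp => h.pointGeneric p (hP hp),
    fun p hp => h.compact p (hP hp), fun p hp => h.bounded p (hP hp)⟩

lemma Setting.exists_simplices (h : Setting ℓ c S₀ P B) :
    ∃ Δ : Finset ι → Pt d → List (Pt d), ∀ S, S₀ ⊆ S → ∀ p ∈ P, IsSimplexAt ℓ c S p (Δ S p) := by
  have : ∀ S p, ∃ M, S₀ ⊆ S → p ∈ P → IsSimplexAt ℓ c S p M := by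
    intro S p
    by_cases hS : S₀ ⊆ S ∧ p ∈ P
    · obtain ⟨M, hM⟩ := exists_isSimplexAt (S := S) h.generic (h.pointGeneric p hS.2)
        (fun g _ => h.off p hS.2 g)
        ((h.compact p hS.2).of_isClosed_subset (isClosed_closedCell p)
          fun x hx g hg => hx g (hS.1 hg))
      exact ⟨M, fun _ _ => hM⟩
    · exact ⟨[], fun h1 h2 => absurd ⟨h1, h2⟩ hS⟩
  choose Δ hΔ using this
  exact ⟨Δ, fun S hS p hp => hΔ S p hS hp⟩

lemma IsShallowPt.mono {P' : Finset (Pt d)} {p : Pt d} (hP : P' ⊆ P) (h : IsShallowPt P k p) :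
    IsShallowPt P' k p := by
  obtain ⟨a, b, h1, h2, h3⟩ := h
  refine ⟨a, b, h1, h2, le_trans (Set.ncard_le_ncard ?_ ?_) h3⟩
  · exact Set.inter_subset_inter_left _ (by exact_mod_cast hP)
  · exact P.finite_toSet.inter_of_left _

/-- If the simplices at the points of `G` contain few points, there are few points in `G`. -/
lemma Setting.card_le (h : Setting ℓ c S₀ P B) (hk : ∀ p ∈ P, IsShallowPt P k p) {S : Finset ι}
    {G : Finset (Pt d)} (hG : G ⊆ P) (Δ : Pt d → List (Pt d))
    (hΔ : ∀ p ∈ G, IsSimplexAt ℓ c S p (Δ p))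
    (hfew : ∀ p ∈ G, (P.filter (· ∈ openHull (Δ p))).card ≤ k) :
    ∃ Y, Admissible ℓ Y ∧ G.card ≤ (4 * k + 1) * Y.card ∧
      Y.card ≤ d.factorial * (borders ℓ Y S 0 d).card := by
  choose! a b ha hab hcard using hk
  obtain ⟨Y, hYG, hY, hYc⟩ := exists_independent (2 * k)
    (fun p => P.filter (· ∈ openHull (Δ p)) ∪ P.filter (· ∈ halfspace (a p) (b p))) G
    (fun p hp => by
      refine (Finset.card_union_le _ _).trans ?_
      have h1 := hfew p hp
      have h2 := hcard p (hG hp)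
      have e : ((P : Set (Pt d)) ∩ halfspace (a p) (b p)) =
          (P.filter (· ∈ halfspace (a p) (b p)) : Finset (Pt d)) := by
        ext x; simp
      rw [e, Set.ncard_coe_finset] at h2
      omega)
  have hYP := hYG.trans hG
  have hout : ∀ y ∈ Y, ∀ y' ∈ Y, y' ≠ y → y' ∉ openHull (Δ y) ∧ y' ∉ halfspace (a y) (b y) := by
    intro y hy y' hy' hne
    have := hY y hy y' hy' hne
    simp only [Finset.mem_union, Finset.mem_filter, not_or, hYP hy', true_and] at this
    exact this
  refine ⟨Y, ⟨fun y hy => ⟨a y, ha y (hYP hy), fun y' hy' hne => ?_⟩,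
    fun y hy => h.off y (hYP hy)⟩, by rw [show 4 * k = 2 * (2 * k) by ring]; exact hYc, ?_⟩
  · have h1 := hab y (hYP hy)
    have h2 := (hout y hy y' hy' hne).2
    simp only [halfspace, Set.mem_ofPred_eq, not_le] at h1 h2
    exact h1.trans_lt h2
  · refine card_le_factorial_mul_borders h.generic (fun y hy g _ => h.off y (hYP hy) g) Δ
      (fun y hy => hΔ y (hYG hy)) fun y hy y' hy' hmem => ?_
    by_contra hne
    exact (hout y hy y' hy' hne).1 hmem

/-- Either some simplex contains many points and meets few hyperplanes, or the number of points is
bounded in terms of the sample size. -/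
lemma Setting.exists_sample_simplex [Nonempty κ] (h : Setting ℓ c S₀ P B) (hP : P.Nonempty)
    (hk : ∀ p ∈ P, IsShallowPt P k p) (hk0 : 0 < k) (j : κ → ι) {w : κ → ℝ} (hw : ∀ q, 0 < w q)
    (n : ℕ)
    (hbig : ∀ (S : Finset ι) (Y : Finset (Pt d)), Admissible ℓ Y → d + 1 ≤ S.card →
      S.card ≤ d + 1 + n →
      10 * k * (d.factorial * (borders ℓ Y S 0 d).card) < P.card) :
    ∃ M, IsSimplexIn B M ∧ k ≤ (P.filter (· ∈ openHull M)).card ∧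
      (n + 1) * crossWeight ℓ j w M ≤ 2 * ((d + 1) * d) * ∑ q, w q := by
  obtain ⟨Δ, hΔ⟩ := h.exists_simplices
  obtain ⟨S, hS, hSc, hsum⟩ := exists_sample h.generic j h.off Δ hΔ n hw
  rw [h.card] at hSc
  by_contra hno
  push Not at hno
  set G := P.filter fun p => (n + 1) * crossWeight ℓ j w (Δ S p) ≤ 2 * ((d + 1) * d) * ∑ q, w q
    with hGdef
  have hGP : G ⊆ P := Finset.filter_subset _ _
  have hGhalf : (P.card : ℝ) ≤ 2 * G.card := by
    by_contra hlt
    push Not at hlt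
    have hW : 0 < ∑ q, w q := Finset.sum_pos (fun q _ => hw q) Finset.univ_nonempty
    have h1 : ∀ p ∈ P, (if p ∈ G then 0 else 2 * ((d + 1) * d) * ∑ q, w q) ≤
        (n + 1) * crossWeight ℓ j w (Δ S p) := by
      intro p hp
      have h0 : 0 ≤ crossWeight ℓ j w (Δ S p) :=
        Finset.sum_nonneg fun q _ => by split_ifs <;> [exact (hw q).le; exact le_rfl]
      split_ifs with hpG
      · positivity
      · by_contra hlt
        exact hpG (Finset.mem_filter.2 ⟨hp, (not_le.1 hlt).le⟩)
    have h2 := Finset.sum_le_sum h1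
    rw [← Finset.mul_sum, Finset.sum_ite, Finset.sum_const_zero, zero_add, Finset.sum_const,
      nsmul_eq_mul] at h2
    have h3 : (P.filter fun p => p ∉ G).card + G.card = P.card := by
      rw [← Finset.card_filter_add_card_filter_not (s := P) (fun p => p ∈ G), add_comm,
        Finset.filter_mem_eq_inter, Finset.inter_eq_right.2 hGP]
    have h4 : ((P.filter fun p => p ∉ G).card : ℝ) + G.card = P.card := by exact_mod_cast h3
    have hd : d ≠ 0 := by
      rintro rfl
      obtain ⟨p, hp⟩ := hP
      obtain ⟨a, b, ha, -⟩ := hk p hp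
      exact ha (Subsingleton.elim _ _)
    have hd' : (0 : ℝ) < (d + 1) * d := by positivity
    have h5 : (P.card : ℝ) < 2 * (P.filter fun p => p ∉ G).card := by linarith
    have h6 := mul_lt_mul_of_pos_right h5 (mul_pos hd' hW)
    nlinarith
  obtain ⟨Y, hY, hY1, hY2⟩ := h.card_le hk hGP (Δ S) (fun p hp => hΔ S hS p (hGP hp))
    (fun p hp => by
      by_contra hlt
      push Not at hlt
      have hpS := h.off p (hGP hp)
      have hsim := hΔ S hS p (hGP hp)
      have := hno (Δ S p) ⟨hsim.isOpenSimplex fun g _ => hpS g, fun x hx => h.bounded p (hGP hp)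
        fun g hg => hsim.subset_cell (fun g _ => hpS g) (interior_subset hx) g (hS hg)⟩
        hlt.le
      exact absurd (Finset.mem_filter.1 hp).2 (not_le.2 this))
  have hbig' := hbig S Y hY (h.card ▸ Finset.card_le_card hS) hSc
  have hn : P.card ≤ 2 * G.card := by exact_mod_cast hGhalf
  have h7 : (4 * k + 1) * Y.card ≤ 5 * k * (d.factorial * (borders ℓ Y S 0 d).card) :=
    Nat.mul_le_mul (by omega) hY2
  have h8 : 10 * k * (d.factorial * (borders ℓ Y S 0 d).card) =
    2 * (5 * k * (d.factorial * (borders ℓ Y S 0 d).card)) := by ring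
  omega

end OneClass

section OneClassBound

lemma crossWeight_le {d : ℕ} {ι κ : Type} [Fintype κ] (ℓ : ι → Pt d × ℝ) (j : κ → ι) {w : κ → ℝ}
    (hw : ∀ q, 0 ≤ w q) (M : List (Pt d)) : crossWeight ℓ j w M ≤ ∑ q, w q := by
  refine Finset.sum_le_sum fun q _ => ?_
  split_ifs
  · exact le_rfl
  · exact hw q

lemma one_le_logb_two {r : ℝ} (hr : 2 ≤ r) : 1 ≤ Real.logb 2 r := by
  rw [Real.le_logb_iff_rpow_le one_lt_two (by linarith), Real.rpow_one]
  exact hr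

lemma log_le_logb_two {r : ℝ} (hr : 1 ≤ r) : Real.log r ≤ Real.logb 2 r := by
  have h1 := Real.log_nonneg hr
  have h2 : Real.log 2 ≤ 1 := by linarith [Real.log_two_lt_d9]
  have h3 : 0 < Real.log 2 := Real.log_pos one_lt_two
  rw [Real.logb, le_div_iff₀ h3]
  nlinarith

/-- The bound on the number of borders of a small sample. -/
lemma exists_border_const {e : ℕ} (he : 0 < e) : ∃ A : ℝ, 1 ≤ A ∧
    ∀ (ι : Type) (ℓ : ι → Pt (e + 1) × ℝ) (c : Pt (e + 1)) (Y : Finset (Pt (e + 1)))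
      (S : Finset ι) (n : ℕ), Generic ℓ c → Admissible ℓ Y → e + 1 + 1 ≤ S.card →
      S.card ≤ e + 1 + 1 + n →
      (10 * ((e + 1).factorial * (borders ℓ Y S 0 (e + 1)).card) : ℝ) ≤
        A * (n + 1) ^ e * (1 + Real.log (n + 1)) := by
  obtain ⟨B, hB, h⟩ := borderBound_log he (k := e + 1) le_rfl
  have ha : (0 : ℝ) ≤ Real.log (e + 2) := Real.log_nonneg
      (by linarith [(e.cast_nonneg : (0:ℝ) ≤ e)])
  refine ⟨1 + 10 * (e + 1).factorial * B * (e + 2) ^ e * (1 + Real.log (e + 2)), by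
    have : 0 ≤ 10 * (e + 1).factorial * B * (e + 2) ^ e * (1 + Real.log (e + 2)) := by positivity
    linarith, fun ι ℓ c Y S n hg hY h1 h2 => ?_⟩
  have h3 := h ι ℓ c Y S hg hY (by omega)
  rw [Nat.add_sub_cancel] at h3
  have hS : (S.card : ℝ) ≤ (e + 2) * (n + 1) := by
    have : (S.card : ℝ) ≤ e + 1 + 1 + n := by exact_mod_cast h2
    nlinarith [(e.cast_nonneg : (0 : ℝ) ≤ e), (n.cast_nonneg : (0 : ℝ) ≤ n)]
  have hS0 : (0 : ℝ) < S.card := by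
    have : 0 < S.card := by omega
    exact_mod_cast this
  have h4 : (S.card.choose e : ℝ) ≤ (e + 2) ^ e * (n + 1) ^ e := by
    rw [← mul_pow]
    refine le_trans (by exact_mod_cast Nat.choose_le_pow _ e) (pow_le_pow_left₀ hS0.le hS e)
  have hn : 0 ≤ Real.log (n + 1) := Real.log_nonneg (by linarith [(n.cast_nonneg : (0 : ℝ) ≤ n)])
  have h5 : logFactor S.card ≤ (1 + Real.log (e + 2)) * (1 + Real.log (n + 1)) := by
    have h6 := Real.log_le_log hS0 hS
    rw [Real.log_mul (by positivity) (by positivity)] at h6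
    unfold logFactor
    nlinarith [mul_nonneg ha hn]
  calc (10 * ((e + 1).factorial * (borders ℓ Y S 0 (e + 1)).card) : ℝ)
      ≤ 10 * ((e + 1).factorial * (B * ((e + 2) ^ e * (n + 1) ^ e) *
        ((1 + Real.log (e + 2)) * (1 + Real.log (n + 1))))) := by
        gcongr
        refine h3.trans ?_
        have := (zero_le_one.trans (one_le_logFactor S.card))
        gcongr
    _ = (10 * (e + 1).factorial * B * (e + 2) ^ e * (1 + Real.log (e + 2))) *
        ((n + 1) ^ e * (1 + Real.log (n + 1))) := by ring
    _ ≤ (1 + 10 * (e + 1).factorial * B * (e + 2) ^ e * (1 + Real.log (e + 2))) *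
        ((n + 1) ^ e * (1 + Real.log (n + 1))) := by
        have : (0 : ℝ) ≤ (n + 1) ^ e * (1 + Real.log (n + 1)) := by positivity
        gcongr
        linarith
    _ = _ := by ring

lemma sample_size_bound {e : ℕ} {A r : ℝ} (he : 0 < e) (hA : 1 ≤ A) (hr : 2 ≤ r)
    (hy : 1 ≤ r / (3 * A * Real.logb 2 r)) : ∃ n : ℕ,
      A * (n + 1) ^ e * (1 + Real.log (n + 1)) < r ∧
      (r / (3 * A * Real.logb 2 r)) ^ (1 / (e : ℝ)) ≤ 2 * (n + 1) := by
  have hlb := one_le_logb_two hr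
  set y := r / (3 * A * Real.logb 2 r) with hydef
  have hy0 : 0 < y := by linarith
  set x := y ^ (1 / (e : ℝ)) with hx
  have he0 : (0 : ℝ) < e := by exact_mod_cast he
  have he1 : (1 : ℝ) ≤ e := by exact_mod_cast he
  have hx1 : 1 ≤ x := Real.one_le_rpow hy (by positivity)
  have hxe : x ^ e = y := by
    rw [hx, ← Real.rpow_natCast, ← Real.rpow_mul hy0.le, one_div, inv_mul_cancel₀ he0.ne',
      Real.rpow_one]
  have hN : 1 ≤ ⌊x⌋₊ := Nat.one_le_floor_iff _ |>.2 hx1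
  obtain ⟨n, hn⟩ := Nat.exists_eq_add_of_le' hN
  have hnx : (n + 1 : ℝ) ≤ x := by
    have := Nat.floor_le (zero_le_one.trans hx1)
    rw [hn] at this
    exact_mod_cast this
  have hxn : x < n + 1 + 1 := by
    have := Nat.lt_floor_add_one x
    rw [hn] at this
    exact_mod_cast this
  have hn0 : (0 : ℝ) ≤ n := n.cast_nonneg
  refine ⟨n, ?_, by linarith⟩
  have h1 : (n + 1 : ℝ) ^ e ≤ y := by
    rw [← hxe]; exact pow_le_pow_left₀ (by linarith) hnx e
  have hden : 1 ≤ 3 * A * Real.logb 2 r := by nlinarith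
  have hyr : y ≤ r := div_le_self (by linarith) hden
  have hxy : x ≤ y := by
    conv_rhs => rw [← Real.rpow_one y]
    exact Real.rpow_le_rpow_of_exponent_le hy (by rw [div_le_one he0]; exact he1)
  have h2 : Real.log (n + 1) ≤ Real.logb 2 r :=
    (Real.log_le_log (by linarith) (by linarith)).trans (log_le_logb_two (by linarith))
  have h0 : 0 ≤ Real.log (n + 1) := Real.log_nonneg (by linarith)
  calc A * (n + 1) ^ e * (1 + Real.log (n + 1)) ≤ A * y * (2 * Real.logb 2 r) := by
        have : 1 + Real.log (n + 1) ≤ 2 * Real.logb 2 r := by linarith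
        gcongr
    _ = 2 / 3 * r := by
        have hAn : A ≠ 0 := by positivity
        have hl : Real.logb 2 r ≠ 0 := by positivity
        rw [hydef]; field_simp
    _ < r := by linarith

/-- There is a simplex with at least `k` points whose crossing weight is small. -/
theorem exists_class {e : ℕ} (he : 0 < e) : ∃ K : ℝ, 0 < K ∧
    ∀ (ι κ : Type) [Fintype κ] [Nonempty κ] (ℓ : ι → Pt (e + 1) × ℝ) (c : Pt (e + 1))
      (S₀ : Finset ι) (P : Finset (Pt (e + 1))) (B : Set (Pt (e + 1))) (k : ℕ) (j : κ → ι)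
      (w : κ → ℝ)
      (M₀ : List (Pt (e + 1))), Setting ℓ c S₀ P B → (∀ p ∈ P, IsShallowPt P k p) → 0 < k →
      2 * k ≤ P.card → (∀ q, 0 < w q) → IsSimplexIn B M₀ → (∀ p ∈ P, p ∈ openHull M₀) →
      ∃ M, IsSimplexIn B M ∧ k ≤ (P.filter (· ∈ openHull M)).card ∧
        crossWeight ℓ j w M ≤
          K * (Real.logb 2 (P.card / k) / (P.card / k)) ^ (1 / (e : ℝ)) * ∑ q, w q := by
  obtain ⟨A, hA, hbord⟩ := exists_border_const he
  have he0 : (0 : ℝ) < e := by exact_mod_cast he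
  have hA3 : 0 < (3 * A) ^ (1 / (e : ℝ)) := Real.rpow_pos_of_pos (by linarith) _
  refine ⟨4 * ((e + 2) * (e + 1)) * (3 * A) ^ (1 / (e : ℝ)), by positivity, ?_⟩
  intro ι κ _ _ ℓ c S₀ P B k j w M₀ hS hk hk0 hkP hw hM₀ hPM₀
  have hk0' : (0 : ℝ) < k := by exact_mod_cast hk0
  set r : ℝ := P.card / k with hr
  have hr2 : 2 ≤ r := by
    rw [hr, le_div_iff₀ hk0']
    exact_mod_cast hkP
  have hlb := one_le_logb_two hr2
  have hW : 0 < ∑ q, w q := Finset.sum_pos (fun q _ => hw q) Finset.univ_nonempty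
  set y := r / (3 * A * Real.logb 2 r) with hy
  have hy0 : 0 < y := by positivity
  have hyx : (3 * A) ^ (1 / (e : ℝ)) * (Real.logb 2 r / r) ^ (1 / (e : ℝ)) *
      y ^ (1 / (e : ℝ)) = 1 := by
    rw [← Real.mul_rpow (by positivity) (by positivity), ← Real.mul_rpow (by positivity) hy0.le]
    have : 3 * A * (Real.logb 2 r / r) * y = 1 := by
      have hAn : A ≠ 0 := by positivity
      have hl : Real.logb 2 r ≠ 0 := by positivity
      rw [hy]; field_simp
    rw [this, Real.one_rpow]
  set L := (Real.logb 2 r / r) ^ (1 / (e : ℝ)) with hL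
  set T := (3 * A) ^ (1 / (e : ℝ)) with hT
  have hL0 : 0 < L := Real.rpow_pos_of_pos (by positivity) _
  rcases lt_or_ge y 1 with hy1 | hy1
  · refine ⟨M₀, hM₀, ?_, (crossWeight_le ℓ j (fun q => (hw q).le) M₀).trans ?_⟩
    · rw [Finset.filter_true_of_mem hPM₀]; omega
    · have h1 : y ^ (1 / (e : ℝ)) ≤ 1 := Real.rpow_le_one hy0.le hy1.le (by positivity)
      have h2 : 1 ≤ T * L := by
        rw [← hyx]
        exact mul_le_of_le_one_right (by positivity) h1
      have h3 : (1 : ℝ) ≤ 4 * ((e + 2) * (e + 1)) := by nlinarith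
      refine le_mul_of_one_le_left hW.le ?_
      rw [mul_assoc]
      nlinarith
  · obtain ⟨n, hn1, hn2⟩ := sample_size_bound he hA hr2 hy1
    obtain ⟨M, h1, h2, h3⟩ := hS.exists_sample_simplex (Finset.card_pos.1 (by omega)) hk hk0 j hw n
      (fun S Y hY hS1 hS2 => by
        have h4 := (hbord ι ℓ c Y S n hS.generic hY hS1 hS2).trans_lt hn1
        rw [hr, lt_div_iff₀ hk0'] at h4
        have e1 : 10 * k * ((e + 1).factorial * (borders ℓ Y S 0 (e + 1)).card) =
          10 * ((e + 1).factorial * (borders ℓ Y S 0 (e + 1)).card) * k := by ring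
        rw [e1]
        exact_mod_cast h4)
    refine ⟨M, h1, h2, ?_⟩
    rw [← hy] at hn2
    set x := y ^ (1 / (e : ℝ)) with hx
    have hx0 : 0 < x := Real.rpow_pos_of_pos hy0 _
    have hc0 : 0 ≤ crossWeight ℓ j w M :=
      Finset.sum_nonneg fun q _ => by split_ifs <;> [exact (hw q).le; exact le_rfl]
    have h5 : x * crossWeight ℓ j w M ≤ x * (4 * ((e + 2) * (e + 1)) * T * L * ∑ q, w q) := by
      have e2 : x * (4 * ((e + 2) * (e + 1)) * T * L * ∑ q, w q) =
          4 * ((e + 2) * (e + 1)) * (T * L * x) * ∑ q, w q := by ring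
      rw [e2, hyx]
      push_cast at h3
      nlinarith [mul_le_mul_of_nonneg_right hn2 hc0]
    exact le_of_mul_le_mul_left h5 hx0

end OneClassBound

/-! ### Iterated reweighting -/

section Iteration

variable {d : ℕ} {ι κ : Type} {ℓ : ι → Pt d × ℝ} {B : Set (Pt d)}

/-- A partition of `P` into classes with between `k` and `2 k` points enclosed in
simplices inside `B`. -/
structure IsSimplicialPartition (B : Set (Pt d)) (P : Finset (Pt d)) (k : ℕ) {m : ℕ}
    (parts : Fin m → Finset (Pt d)) (M : Fin m → List (Pt d)) : Prop where
  disj : ∀ i j, i ≠ j → Disjoint (parts i) (parts j)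
  mem : ∀ p, p ∈ P ↔ ∃ i, p ∈ parts i
  card : ∀ i, k ≤ (parts i).card ∧ (parts i).card ≤ 2 * k
  simplex : ∀ i, IsSimplexIn B (M i)
  sub : ∀ i, ∀ p ∈ parts i, p ∈ openHull (M i)

/-- The number of simplices met by the hyperplane of `u`. -/
def crossNumber (u : Pt d × ℝ) {m : ℕ} (M : Fin m → List (Pt d)) : ℕ :=
  (Finset.univ.filter fun i => ∃ x ∈ openHull (M i), ev u x = 0).card

lemma crossNumber_cons (u : Pt d × ℝ) {m : ℕ} (M : Fin m → List (Pt d)) (M₁ : List (Pt d)) :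
    crossNumber u (Fin.cons M₁ M : Fin (m + 1) → List (Pt d)) =
      (if ∃ x ∈ openHull M₁, ev u x = 0 then 1 else 0) + crossNumber u M := by
  unfold crossNumber
  rw [Fin.card_filter_univ_succ]
  simp only [Fin.cons_zero, Fin.cons_succ]
  split_ifs <;> ring

lemma IsSimplicialPartition.single {P : Finset (Pt d)} {k : ℕ} (h1 : k ≤ P.card)
    (h2 : P.card ≤ 2 * k) {M : List (Pt d)} (hM : IsSimplexIn B M)
    (hP : ∀ p ∈ P, p ∈ openHull M) :
    IsSimplicialPartition B P k (fun _ : Fin 1 => P) fun _ => M :=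
  ⟨fun i j h => absurd (Subsingleton.elim i j) h, fun _ => ⟨fun h => ⟨0, h⟩, fun ⟨_, h⟩ => h⟩,
    fun _ => ⟨h1, h2⟩, fun _ => hM, fun _ => hP⟩

lemma IsSimplicialPartition.cons {P P₁ : Finset (Pt d)} {k m : ℕ} {parts : Fin m → Finset (Pt d)}
    {M : Fin m → List (Pt d)} (h : IsSimplicialPartition B (P \ P₁) k parts M) (hP₁ : P₁ ⊆ P)
    (hk : P₁.card = k) {M₁ : List (Pt d)} (hM₁ : IsSimplexIn B M₁)
    (hsub : ∀ p ∈ P₁, p ∈ openHull M₁) :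
    IsSimplicialPartition B P k (Fin.cons P₁ parts : Fin (m + 1) → Finset (Pt d))
      (Fin.cons M₁ M : Fin (m + 1) → List (Pt d)) := by
  have hdisj : ∀ i, Disjoint P₁ (parts i) := fun i => by
    refine Finset.disjoint_left.2 fun p hp hpi => ?_
    exact (Finset.mem_sdiff.1 ((h.mem p).2 ⟨i, hpi⟩)).2 hp
  refine ⟨?_, ?_, ?_, ?_, ?_⟩
  · intro i j
    refine Fin.cases ?_ (fun i => ?_) i <;> refine Fin.cases ?_ (fun j => ?_) j
    · exact fun h => absurd rfl h
    · exact fun _ => hdisj j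
    · exact fun _ => (hdisj i).symm
    · exact fun hij => h.disj i j fun e => hij (by rw [e])
  · intro p
    rw [Fin.exists_fin_succ]
    simp only [Fin.cons_zero, Fin.cons_succ, ← h.mem, Finset.mem_sdiff]
    constructor
    · intro hp
      by_cases h1 : p ∈ P₁
      · exact Or.inl h1
      · exact Or.inr ⟨hp, h1⟩
    · rintro (h1 | h1)
      · exact hP₁ h1
      · exact h1.1
  · exact fun i => Fin.cases ⟨hk.ge, by simp [hk]; omega⟩ h.card i
  · exact fun i => Fin.cases hM₁ h.simplex i
  · exact fun i => Fin.cases hsub h.sub i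

lemma rpow_neg_le_two_mul_sub {r α : ℝ} (hr : 1 ≤ r) (h0 : 0 ≤ α) (hα : α ≤ 1 / 2) :
    r ^ (-α) ≤ 2 * (r ^ (1 - α) - (r - 1) ^ (1 - α)) := by
  have hr0 : 0 < r := by linarith
  have h1 : (r - 1) ^ (1 - α) ≤ r ^ (1 - α) * (1 + (1 - α) * (-(1 / r))) := by
    have e : r - 1 = r * (1 + -(1 / r)) := by field_simp; ring
    have hle : 1 / r ≤ 1 := (div_le_one hr0).2 hr
    conv_lhs => rw [e]
    rw [Real.mul_rpow hr0.le (by linarith)]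
    refine mul_le_mul_of_nonneg_left ?_ (Real.rpow_nonneg hr0.le _)
    exact rpow_one_add_le_one_add_mul_self (by linarith) (by linarith) (by linarith)
  have h2 : r ^ (-α) = r ^ (1 - α) * (1 / r) := by
    rw [sub_eq_add_neg, Real.rpow_add hr0, Real.rpow_one]; field_simp
  have h3 : 0 < r ^ (-α) := Real.rpow_pos_of_pos hr0 _
  have h4 : r ^ (1 - α) * (1 + (1 - α) * (-(1 / r))) = r ^ (1 - α) - (1 - α) * r ^ (-α) := by
    rw [h2]; ring
  nlinarith

lemma exists_partition_of_classes [Fintype κ] {k : ℕ} (hk : 0 < k) (j : κ → ι) {T α : ℝ}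
    (hT : 0 ≤ T) (hα0 : 0 ≤ α) (hα : α ≤ 1 / 2) {M₀ : List (Pt d)}
    (hM₀ : IsSimplexIn B M₀) (P : Finset (Pt d)) (hP : ∀ p ∈ P, p ∈ openHull M₀)
    (hkP : k ≤ P.card)
    (hclass : ∀ P' ⊆ P, 2 * k ≤ P'.card → ∀ w : κ → ℝ, (∀ q, 0 < w q) →
      ∃ M, IsSimplexIn B M ∧ k ≤ (P'.filter (· ∈ openHull M)).card ∧
        crossWeight ℓ j w M ≤ T * ((P'.card : ℝ) / k) ^ (-α) * ∑ q, w q)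
    (w : κ → ℝ) (hw : ∀ q, 0 < w q) :
    ∃ (m : ℕ) (parts : Fin m → Finset (Pt d)) (M : Fin m → List (Pt d)),
      IsSimplicialPartition B P k parts M ∧
      ∑ q, w q * 2 ^ crossNumber (ℓ (j q)) M ≤
        2 * (∑ q, w q) * Real.exp (2 * T * ((P.card : ℝ) / k) ^ (1 - α)) := by
  have hk' : (0 : ℝ) < k := by exact_mod_cast hk
  induction hn : P.card using Nat.strong_induction_on generalizing P w with
  | _ n ih =>
    subst hn
    have hW : 0 ≤ ∑ q, w q := Finset.sum_nonneg fun q _ => (hw q).le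
    rcases lt_or_ge P.card (2 * k) with hlt | hge
    · refine ⟨1, _, _, IsSimplicialPartition.single hkP hlt.le hM₀ hP, ?_⟩
      have h1 : 1 ≤ Real.exp (2 * T * ((P.card : ℝ) / k) ^ (1 - α)) :=
        Real.one_le_exp (by positivity)
      refine le_trans ?_ (le_mul_of_one_le_right (by positivity) h1)
      rw [mul_comm, Finset.sum_mul]
      refine Finset.sum_le_sum fun q _ => mul_le_mul_of_nonneg_left ?_ (hw q).le
      calc (2 : ℝ) ^ crossNumber (ℓ (j q)) (fun _ : Fin 1 => M₀) ≤ 2 ^ 1 := by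
            refine pow_le_pow_right₀ one_le_two ?_
            exact (Finset.card_le_univ _).trans (by simp)
        _ = 2 := pow_one 2
    · obtain ⟨M₁, h1, h2, h3⟩ := hclass P subset_rfl hge w hw
      obtain ⟨P₁, hP₁, hP₁k⟩ := Finset.exists_subset_card_eq h2
      have hP₁P : P₁ ⊆ P := hP₁.trans (Finset.filter_subset _ _)
      set w' : κ → ℝ := fun q => w q * 2 ^ (if ∃ x ∈ openHull M₁, ev (ℓ (j q)) x = 0 then 1 else 0)
        with hw'
      have hw'0 : ∀ q, 0 < w' q := fun q => mul_pos (hw q) (by positivity)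
      have hc : (P \ P₁).card = P.card - k := by rw [Finset.card_sdiff_of_subset hP₁P, hP₁k]
      have hsub : P \ P₁ ⊆ P := Finset.sdiff_subset
      obtain ⟨m, parts, M, hpart, hsum⟩ := ih (P \ P₁).card (by omega) (P \ P₁)
        (fun p hp => hP p (hsub hp)) (by omega) (fun P' hP' => hclass P' (hP'.trans hsub))
        w' hw'0 rfl
      refine ⟨m + 1, _, _, hpart.cons hP₁P hP₁k h1 fun p hp => (Finset.mem_filter.1 (hP₁ hp)).2, ?_⟩
      have e1 : ∀ q, w q * 2 ^ crossNumber (ℓ (j q)) (Fin.cons M₁ M : Fin (m + 1) → List (Pt d)) =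
          w' q * 2 ^ crossNumber (ℓ (j q)) M := fun q => by
        rw [crossNumber_cons, pow_add, hw', mul_assoc]
      rw [Finset.sum_congr rfl fun q _ => e1 q]
      refine hsum.trans ?_
      have e2 : ∑ q, w' q = ∑ q, w q + crossWeight ℓ j w M₁ := by
        rw [crossWeight, ← Finset.sum_add_distrib]
        refine Finset.sum_congr rfl fun q _ => ?_
        simp only [hw']
        split_ifs <;> ring
      set r : ℝ := P.card / k with hr
      have hr' : ((P \ P₁).card : ℝ) / k = r - 1 := by
        rw [hc, Nat.cast_sub hkP, hr]; field_simp
      have hr1 : 1 ≤ r := by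
        rw [hr, le_div_iff₀ hk', one_mul]; exact_mod_cast hkP
      have h4 : ∑ q, w' q ≤ (∑ q, w q) * Real.exp (T * r ^ (-α)) := by
        rw [e2]
        have := Real.add_one_le_exp (T * r ^ (-α))
        nlinarith
      rw [hr']
      calc 2 * (∑ q, w' q) * Real.exp (2 * T * (r - 1) ^ (1 - α))
          ≤ 2 * ((∑ q, w q) * Real.exp (T * r ^ (-α))) * Real.exp (2 * T * (r - 1) ^ (1 - α)) := by
            gcongr
        _ = 2 * (∑ q, w q) * Real.exp (T * r ^ (-α) + 2 * T * (r - 1) ^ (1 - α)) := by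
            rw [Real.exp_add]; ring
        _ ≤ 2 * (∑ q, w q) * Real.exp (2 * T * r ^ (1 - α)) := by
            gcongr
            nlinarith [rpow_neg_le_two_mul_sub hr1 hα0 hα]

/-- The partition theorem for hyperplanes in general position. -/
theorem exists_partition_of_setting {e : ℕ} (he : 2 ≤ e) : ∃ K : ℝ, 0 < K ∧
    ∀ (ι κ : Type) [Fintype κ] [Nonempty κ] (ℓ : ι → Pt (e + 1) × ℝ) (c : Pt (e + 1))
      (S₀ : Finset ι) (P : Finset (Pt (e + 1))) (B : Set (Pt (e + 1))) (k : ℕ) (j : κ → ι)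
      (M₀ : List (Pt (e + 1))), Setting ℓ c S₀ P B → (∀ p ∈ P, IsShallowPt P k p) → 0 < k →
      2 * k ≤ P.card → IsSimplexIn B M₀ → (∀ p ∈ P, p ∈ openHull M₀) →
      ∃ (m : ℕ) (parts : Fin m → Finset (Pt (e + 1))) (M : Fin m → List (Pt (e + 1))),
        IsSimplicialPartition B P k parts M ∧
        ∀ q, (crossNumber (ℓ (j q)) M : ℝ) ≤ 1 + Real.logb 2 (Fintype.card κ) +
          K * (((P.card : ℝ) / k) ^ (1 - 1 / (e : ℝ)) *
            Real.logb 2 ((P.card : ℝ) / k) ^ (2 / (e : ℝ))) := by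
  obtain ⟨K, hK, hclass⟩ := exists_class (e := e) (by omega)
  have hlog2 : 0 < Real.log 2 := Real.log_pos one_lt_two
  refine ⟨2 * K / Real.log 2, by positivity, ?_⟩
  intro ι κ _ _ ℓ c S₀ P B k j M₀ hS hsh hk hkP hM₀ hPM₀
  have hk' : (0 : ℝ) < k := by exact_mod_cast hk
  have he2 : (2 : ℝ) ≤ e := by exact_mod_cast he
  set r : ℝ := P.card / k with hr
  have hr2 : 2 ≤ r := by
    rw [hr, le_div_iff₀ hk']; exact_mod_cast hkP
  have hlb := one_le_logb_two hr2
  set α : ℝ := 1 / (e : ℝ) with hα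
  have hα0 : 0 ≤ α := by positivity
  have hα1 : α ≤ 1 / 2 := one_div_le_one_div_of_le two_pos he2
  set T : ℝ := K * Real.logb 2 r ^ α with hT
  have hT0 : 0 ≤ T := by positivity
  obtain ⟨m, parts, M, h1, h2⟩ := exists_partition_of_classes (ℓ := ℓ) hk j hT0 hα0 hα1 hM₀ P hPM₀
    (by omega) (fun P' hP' hkP' w hw => by
      obtain ⟨M, h1, h2, h3⟩ := hclass ι κ ℓ c S₀ P' B k j w M₀ (hS.subset hP')
        (fun p hp => (hsh p (hP' hp)).mono hP') hk hkP' hw hM₀ fun p hp => hPM₀ p (hP' hp)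
      refine ⟨M, h1, h2, h3.trans ?_⟩
      set r' : ℝ := P'.card / k with hr'
      have hr2' : 2 ≤ r' := by
        rw [hr', le_div_iff₀ hk']; exact_mod_cast hkP'
      have hlb' := one_le_logb_two hr2'
      have hrr : r' ≤ r := by
        have := Finset.card_le_card hP'
        rw [hr, hr']; gcongr
      have hll : Real.logb 2 r' ≤ Real.logb 2 r :=
        Real.logb_le_logb_of_le one_lt_two (by linarith) hrr
      have hW : 0 ≤ ∑ q, w q := Finset.sum_nonneg fun q _ => (hw q).le
      rw [hT, Real.rpow_neg (by linarith), Real.div_rpow (by linarith) (by linarith),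
        div_eq_mul_inv,
        ← mul_assoc]
      gcongr) (fun _ => 1) fun _ => one_pos
  refine ⟨m, parts, M, h1, fun q => ?_⟩
  simp only [one_mul, Finset.sum_const, Finset.card_univ, nsmul_eq_mul, mul_one] at h2
  have h3 : (2 : ℝ) ^ crossNumber (ℓ (j q)) M ≤
      2 * (Fintype.card κ) * Real.exp (2 * T * r ^ (1 - α)) :=
    (Finset.single_le_sum (f := fun q => (2 : ℝ) ^ crossNumber (ℓ (j q)) M)
      (fun q _ => by positivity) (Finset.mem_univ q)).trans h2
  have hκ : (0 : ℝ) < Fintype.card κ := by exact_mod_cast Fintype.card_pos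
  have h4 := Real.logb_le_logb_of_le one_lt_two (by positivity) h3
  rw [← Real.rpow_natCast, Real.logb_rpow two_pos (by norm_num), Real.logb_mul (by positivity)
    (Real.exp_ne_zero _), Real.logb_mul two_ne_zero hκ.ne', Real.logb_self_eq_one one_lt_two] at h4
  have h5 : Real.logb 2 (Real.exp (2 * T * r ^ (1 - α))) ≤
      2 * K / Real.log 2 * (r ^ (1 - α) * Real.logb 2 r ^ (2 / (e : ℝ))) := by
    have h6 : Real.logb 2 r ^ α ≤ Real.logb 2 r ^ (2 / (e : ℝ)) :=
      Real.rpow_le_rpow_of_exponent_le hlb (by rw [hα]; gcongr; norm_num)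
    rw [Real.logb, Real.log_exp, hT]
    calc 2 * (K * Real.logb 2 r ^ α) * r ^ (1 - α) / Real.log 2
        = 2 * K / Real.log 2 * (r ^ (1 - α) * Real.logb 2 r ^ α) := by ring
      _ ≤ _ := by gcongr
  linarith

end Iteration

/-! ### Choosing vectors in general position -/

section Avoid

variable {V : Type*} [NormedAddCommGroup V] [NormedSpace ℝ V]

lemma exists_functional_vanishing {σ : Type*} (u : σ → V) (G : Finset σ)
    (hG : G.card < Module.finrank ℝ V) :
    ∃ f : V →ₗ[ℝ] ℝ, f ≠ 0 ∧ ∀ g ∈ G, f (u g) = 0 := by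
  have h1 : Submodule.span ℝ ((G.image u : Finset V) : Set V) < ⊤ := by
    refine lt_top_iff_ne_top.2 fun h => ?_
    have h2 := finrank_span_finset_le_card (R := ℝ) (G.image u)
    rw [Set.finrank, h, finrank_top] at h2
    have := Finset.card_image_le (s := G) (f := u)
    omega
  obtain ⟨f, hf, hle⟩ := Submodule.exists_le_ker_of_lt_top _ h1
  exact ⟨f, hf, fun g hg =>
    hle (Submodule.subset_span (Finset.mem_coe.2 (Finset.mem_image_of_mem u hg)))⟩

/-- Any at most `n` of the vectors `u i`, `i ∈ A`, are linearly independent. -/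
def GenLin {σ : Type*} (n : ℕ) (u : σ → V) (A : Finset σ) : Prop :=
  ∀ G ⊆ A, G.card ≤ n → ∀ β : σ → ℝ, ∑ i ∈ G, β i • u i = 0 → ∀ i ∈ G, β i = 0

variable [FiniteDimensional ℝ V]

/-- Finitely many affine hyperplanes do not cover a nonempty open set. -/
lemma exists_mem_avoid {α : Type*} (s : Finset α) (f : α → V →ₗ[ℝ] ℝ) (b : α → ℝ)
    (hf : ∀ i ∈ s, f i ≠ 0) {U : Set V} (hU : IsOpen U) (hne : U.Nonempty) :
    ∃ x ∈ U, ∀ i ∈ s, f i x ≠ b i := by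
  induction s using Finset.induction_on generalizing U with
  | empty => exact ⟨hne.some, hne.some_mem, by simp⟩
  | insert i s hi ih =>
    have hc : Continuous (f i) := (f i).continuous_of_finiteDimensional
    have hU' : IsOpen (U ∩ {x | f i x ≠ b i}) :=
      hU.inter (isOpen_ne_fun hc continuous_const)
    have hne' : (U ∩ {x | f i x ≠ b i}).Nonempty := by
      obtain ⟨x, hx⟩ := hne
      by_cases hb : f i x = b i
      · obtain ⟨v, hv⟩ : ∃ v, f i v ≠ 0 := by
          by_contra! h
          exact hf i (Finset.mem_insert_self _ _) (LinearMap.ext h)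
        have hcont : Continuous fun t : ℝ => x + t • v := by fun_prop
        have h0 : U ∈ 𝓝 (x + (0 : ℝ) • v) := by simpa using hU.mem_nhds hx
        have h1 : ∀ᶠ t in 𝓝[>] (0 : ℝ), x + t • v ∈ U :=
          (hcont.continuousAt.eventually h0).filter_mono nhdsWithin_le_nhds
        obtain ⟨t, ht, htp⟩ := (h1.and self_mem_nhdsWithin).exists
        refine ⟨x + t • v, ht, ?_⟩
        simp only [Set.mem_ofPred_eq, map_add, map_smul, hb, smul_eq_mul]
        have : t * f i v ≠ 0 := mul_ne_zero (ne_of_gt htp) hv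
        simpa using this
      · exact ⟨x, hx, hb⟩
    obtain ⟨x, hx, hxs⟩ := ih (fun j hj => hf j (Finset.mem_insert_of_mem hj)) hU' hne'
    refine ⟨x, hx.1, fun j hj => ?_⟩
    rcases Finset.mem_insert.1 hj with rfl | hj
    · exact hx.2
    · exact hxs j hj

lemma GenLin.exists_insert {σ : Type*} {n : ℕ} {u : σ → V} {A : Finset σ} (h : GenLin n u A)
    (hn : n ≤ Module.finrank ℝ V) (i : σ) {U : Set V} (hU : IsOpen U)
    (hne : U.Nonempty) : ∃ x ∈ U, GenLin n (Function.update u i x) (insert i A) := by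
  have h1 : ∀ G : Finset σ, ∃ f : V →ₗ[ℝ] ℝ, G.card < n → f ≠ 0 ∧ ∀ g ∈ G, f (u g) = 0 := by
    intro G
    by_cases hG : G.card < n
    · obtain ⟨f, hf⟩ := exists_functional_vanishing u G (hG.trans_le hn)
      exact ⟨f, fun _ => hf⟩
    · exact ⟨0, fun h => absurd h hG⟩
  choose f hf using h1
  obtain ⟨x, hxU, hx⟩ := exists_mem_avoid (A.powerset.filter fun G => G.card < n) f (fun _ => 0)
    (fun G hG => (hf G (Finset.mem_filter.1 hG).2).1) hU hne
  refine ⟨x, hxU, fun G hG hGn β hβ => ?_⟩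
  have hup : ∀ T : Finset σ, i ∉ T →
      ∑ j ∈ T, β j • Function.update u i x j = ∑ j ∈ T, β j • u j := fun T hT =>
    Finset.sum_congr rfl fun j hj => by
      rw [Function.update_of_ne (ne_of_mem_of_not_mem hj hT)]
  by_cases hiG : i ∈ G
  · have hsub : G.erase i ⊆ A := fun j hj =>
      (Finset.mem_insert.1 (hG (Finset.mem_of_mem_erase hj))).resolve_left
        (Finset.ne_of_mem_erase hj)
    have hcard : (G.erase i).card < n := by
      have := Finset.card_erase_lt_of_mem hiG
      omega
    rw [← Finset.add_sum_erase _ _ hiG, hup _ (Finset.notMem_erase i G),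
      Function.update_self] at hβ
    have h2 := congrArg (f (G.erase i)) hβ
    rw [map_add, map_sum, map_zero, Finset.sum_eq_zero (fun j hj => by
      rw [map_smul, (hf _ hcard).2 j hj, smul_zero]), add_zero, map_smul, smul_eq_mul] at h2
    have h3 : β i = 0 := (mul_eq_zero.1 h2).resolve_right
      (hx _ (Finset.mem_filter.2 ⟨Finset.mem_powerset.2 hsub, hcard⟩))
    rw [h3, zero_smul, zero_add] at hβ
    intro j hj
    by_cases hji : j = i
    · rw [hji, h3]
    · exact h _ hsub hcard.le β hβ j (Finset.mem_erase.2 ⟨hji, hj⟩)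
  · rw [hup _ hiG] at hβ
    exact h G (fun j hj => (Finset.mem_insert.1 (hG hj)).resolve_left
      (ne_of_mem_of_not_mem hj hiG)) hGn β hβ

lemma GenLin.exists_extend {σ : Type*} {n : ℕ} {u : σ → V} {A : Finset σ} (h : GenLin n u A)
    (hn : n ≤ Module.finrank ℝ V) (U : σ → Set V) (T : Finset σ)
    (hU : ∀ i ∈ T, IsOpen (U i)) (hne : ∀ i ∈ T, (U i).Nonempty) :
    ∃ u' : σ → V, (∀ i ∉ T, u' i = u i) ∧ (∀ i ∈ T, u' i ∈ U i) ∧ GenLin n u' (A ∪ T) := by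
  induction T using Finset.induction_on with
  | empty => exact ⟨u, by simp, by simp, by simpa using h⟩
  | insert i T hi ih =>
    obtain ⟨u', h1, h2, h3⟩ := ih (fun j hj => hU j (Finset.mem_insert_of_mem hj))
      (fun j hj => hne j (Finset.mem_insert_of_mem hj))
    obtain ⟨x, hx, hgen⟩ := h3.exists_insert hn i
      (hU i (Finset.mem_insert_self _ _)) (hne i (Finset.mem_insert_self _ _))
    refine ⟨Function.update u' i x, fun j hj => ?_, fun j hj => ?_, ?_⟩
    · rw [Finset.mem_insert, not_or] at hj
      rw [Function.update_of_ne hj.1, h1 j hj.2]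
    · by_cases hji : j = i
      · subst hji
        rwa [Function.update_self]
      · rw [Function.update_of_ne hji]
        exact h2 j ((Finset.mem_insert.1 hj).resolve_left hji)
    · rwa [Finset.union_insert]

lemma GenLin.eq_zero_of_card_eq {σ : Type*} {n : ℕ} {u : σ → V} {A : Finset σ}
    (h : GenLin n u A) (hn : Module.finrank ℝ V = n) {G : Finset σ} (hG : G ⊆ A)
    (hcard : G.card = n) (f : V →ₗ[ℝ] ℝ) (hf : ∀ g ∈ G, f (u g) = 0) : f = 0 := by
  have hli : LinearIndependent ℝ fun g : G => u g := by
    rw [Fintype.linearIndependent_iff]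
    intro β hβ g
    have h1 := h G hG hcard.le (fun i => if hi : i ∈ G then β ⟨i, hi⟩ else 0) (by
      rw [← Finset.sum_coe_sort]
      simpa using hβ) g g.2
    simpa using h1
  have hspan := hli.span_eq_top_of_card_eq_finrank' (by simp [hcard, hn])
  refine LinearMap.ext_on hspan ?_
  rintro _ ⟨g, rfl⟩
  simpa using hf g g.2

end Avoid

/-! ### Generic families from general position -/

section General

variable {d : ℕ} {ι : Type}

/-- Evaluation of affine functionals at `x`, as a linear functional. -/
def evLin (x : Pt d) : Pt d × ℝ →ₗ[ℝ] ℝ where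
  toFun u := ev u x
  map_add' u w := by simp only [ev, Prod.fst_add, Prod.snd_add, inner_add_right]; ring
  map_smul' r u := by
    simp only [ev, Prod.smul_fst, Prod.smul_snd, real_inner_smul_right, smul_eq_mul,
      RingHom.id_apply]
    ring

lemma evLin_apply (x : Pt d) (u : Pt d × ℝ) : evLin x u = ev u x := rfl

/-- Slope of affine functionals in direction `v`, as a linear functional. -/
def slopeLin (v : Pt d) : Pt d × ℝ →ₗ[ℝ] ℝ where
  toFun u := ⟪v, u.1⟫
  map_add' u w := by simp only [Prod.fst_add, inner_add_right]
  map_smul' r u := by simp only [Prod.smul_fst, real_inner_smul_right, smul_eq_mul,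
    RingHom.id_apply]

/-- The family `ℓ` together with the constant functional `-1`, representing the hyperplane at
infinity. -/
def homog (ℓ : ι → Pt d × ℝ) : Option ι → Pt d × ℝ := fun o => o.elim (0, 1) ℓ

lemma finrank_pt_prod : Module.finrank ℝ (Pt d × ℝ) = d + 1 := by
  simp [Module.finrank_prod]

variable {ℓ : ι → Pt d × ℝ}

/-- The functional `x ↦ ev u (x + τ)`. -/
def shift (τ : Pt d) (u : Pt d × ℝ) : Pt d × ℝ := (u.1, u.2 - ⟪τ, u.1⟫)

lemma ev_shift (τ : Pt d) (u : Pt d × ℝ) (x : Pt d) : ev (shift τ u) x = ev u (x + τ) := by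
  simp only [ev, shift, inner_add_left]; ring

lemma Generic.shift {c : Pt d} (h : Generic ℓ c) (τ : Pt d) :
    Generic (fun g => shift τ (ℓ g)) c where
  uniq := h.uniq
  card_le G x hx := h.card_le G (x + τ) fun g hg => by rw [← ev_shift]; exact hx g hg
  obj := h.obj

lemma exists_dependence (ℓ : ι → Pt d × ℝ) {G : Finset ι} {V : Finset (Pt d)}
    (hV : V.card < G.card) :
    ∃ α : ι → ℝ, (∀ v ∈ V, ∑ g ∈ G, α g * ev (ℓ g) v = 0) ∧ ∃ g ∈ G, α g ≠ 0 := by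
  let L : (G → ℝ) →ₗ[ℝ] (V → ℝ) := LinearMap.pi fun v =>
    ∑ g : G, ev (ℓ g) (v : Pt d) • LinearMap.proj g
  have h1 : LinearMap.ker L ≠ ⊥ := LinearMap.ker_ne_bot_of_finrank_lt (by simpa using hV)
  obtain ⟨α, hα, hne⟩ := (Submodule.ne_bot_iff _).1 h1
  obtain ⟨g, hg⟩ := Function.ne_iff.1 hne
  refine ⟨fun i => if hi : i ∈ G then α ⟨i, hi⟩ else 0, fun v hv => ?_, g, g.2, by simpa using hg⟩
  have h2 := congrFun (LinearMap.mem_ker.1 hα) ⟨v, hv⟩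
  rw [← Finset.sum_coe_sort]
  simpa [L, mul_comm] using h2

variable [Fintype ι]

lemma exists_generic (h : GenLin (d + 1) (homog ℓ) Finset.univ) : ∃ c, Generic ℓ c := by
  have h1 : ∀ G : Finset ι, ∃ v : Pt d, G.card < d → v ≠ 0 ∧ ∀ g ∈ G, ⟪v, (ℓ g).1⟫ = 0 := by
    intro G
    by_cases hG : G.card < d
    · obtain ⟨f, hf, hfG⟩ := exists_functional_vanishing (fun g => (ℓ g).1) G (by simpa using hG)
      refine ⟨(InnerProductSpace.toDual ℝ (Pt d)).symm (LinearMap.toContinuousLinearMap f),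
        fun _ => ⟨?_, fun g hg => ?_⟩⟩
      · simpa using hf
      · simpa using hfG g hg
    · exact ⟨0, fun h => absurd h hG⟩
  choose v hv using h1
  obtain ⟨c, -, hc⟩ := exists_mem_avoid (Finset.univ.filter fun G : Finset ι => G.card < d)
    (fun G => (innerₛₗ ℝ (v G) : Pt d →ₗ[ℝ] ℝ)) (fun _ => 0) (fun G hG hz => by
      refine (hv G (Finset.mem_filter.1 hG).2).1 ?_
      have := LinearMap.congr_fun hz (v G)
      simpa using this) isOpen_univ Set.univ_nonempty
  refine ⟨c, fun G hG w hw => ?_, fun G x hx => ?_, fun G hG => ?_⟩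
  · have h2 := h.eq_zero_of_card_eq finrank_pt_prod (G := G.insertNone) (Finset.subset_univ _)
      (by simp [hG]) (slopeLin w) (fun o ho => by
        rcases o with _ | g
        · simp [slopeLin, homog]
        · simpa [slopeLin, homog] using hw g (by simpa using ho))
    have h3 := LinearMap.congr_fun h2 (w, 0)
    simpa [slopeLin] using h3
  · by_contra! hlt
    obtain ⟨T, hTG, hT⟩ := Finset.exists_subset_card_eq (show d + 1 ≤ G.card from hlt)
    have h2 := h.eq_zero_of_card_eq finrank_pt_prod (G := T.map Function.Embedding.some)
      (Finset.subset_univ _) (by simp [hT]) (evLin x) (fun o ho => by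
        obtain ⟨g, hg, rfl⟩ := Finset.mem_map.1 ho
        exact hx g (hTG hg))
    have h3 := LinearMap.congr_fun h2 (0, 1)
    simp [evLin, ev] at h3
  · obtain ⟨-, h2⟩ := hv G hG
    exact ⟨v G, h2, by simpa using hc G (by simpa using hG)⟩

lemma Generic.finite_vertices {c : Pt d} (h : Generic ℓ c) : {v | IsVertex ℓ v}.Finite := by
  have h1 : {v | IsVertex ℓ v} ⊆
      ⋃ G : Finset ι, {v | G.card = d ∧ ∀ g ∈ G, ev (ℓ g) v = 0} := fun v ⟨G, hG⟩ =>
    Set.mem_iUnion.2 ⟨G, hG⟩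
  refine (Set.finite_iUnion fun G => Set.Subsingleton.finite ?_).subset h1
  rintro v ⟨hG, hv⟩ w ⟨-, hw⟩
  refine sub_eq_zero.1 (h.uniq G hG _ fun g hg => ?_)
  rw [inner_sub_eq_ev, hv g hg, hw g hg, sub_zero]

lemma exists_shift_pointGeneric (hd : 0 < d) (h : GenLin (d + 1) (homog ℓ) Finset.univ)
    (P : Finset (Pt d)) {ε : ℝ} (hε : 0 < ε) :
    ∃ τ : Pt d, ‖τ‖ < ε ∧ (∀ p ∈ P, ∀ g, ev (shift τ (ℓ g)) p ≠ 0) ∧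
      ∀ p ∈ P, PointGeneric (fun g => shift τ (ℓ g)) p := by
  obtain ⟨c, hc⟩ := exists_generic h
  set W := hc.finite_vertices.toFinset with hW
  have h1 : ∀ x : Finset ι × Finset (Pt d), ∃ α : ι → ℝ, x.2.card < x.1.card →
      (∀ v ∈ x.2, ∑ g ∈ x.1, α g * ev (ℓ g) v = 0) ∧ ∃ g ∈ x.1, α g ≠ 0 := by
    intro x
    by_cases hx : x.2.card < x.1.card
    · obtain ⟨α, hα⟩ := exists_dependence ℓ hx
      exact ⟨α, fun _ => hα⟩
    · exact ⟨0, fun h => absurd h hx⟩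
  choose α hα using h1
  obtain ⟨τ, hτ, hav⟩ := exists_mem_avoid
    (((Finset.univ : Finset (Finset ι)) ×ˢ W.powerset ×ˢ P).filter fun x =>
      x.2.1.card < x.1.card ∧ x.1.card ≤ d)
    (fun x => (innerₛₗ ℝ (∑ g ∈ x.1, α (x.1, x.2.1) g • (ℓ g).1) : Pt d →ₗ[ℝ] ℝ))
    (fun x => -∑ g ∈ x.1, α (x.1, x.2.1) g * ev (ℓ g) x.2.2) (by
      rintro ⟨G, V, p⟩ hx hz
      obtain ⟨-, hVG, hGd⟩ := Finset.mem_filter.1 hx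
      obtain ⟨-, g, hg, hne⟩ := hα (G, V) hVG
      have h2 : ∑ g ∈ G, α (G, V) g • (ℓ g).1 = 0 := by
        have := LinearMap.congr_fun hz (∑ g ∈ G, α (G, V) g • (ℓ g).1)
        exact inner_self_eq_zero.1 this
      refine hne (h G.insertNone (Finset.subset_univ _) (by simpa using hGd)
        (fun o => o.elim (-∑ g ∈ G, α (G, V) g * (ℓ g).2) (α (G, V))) ?_ (some g)
        (by simpa using hg))
      rw [Finset.sum_insertNone]
      ext1
      · simp [homog, Prod.fst_sum, h2]
      · simp [homog, Prod.snd_sum])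
    (Metric.isOpen_ball (x := (0 : Pt d)) (ε := ε)) ⟨0, Metric.mem_ball_self hε⟩
  have hpg : ∀ p ∈ P, PointGeneric (fun g => shift τ (ℓ g)) p := by
    intro p hp G hG V hV hVG
    have hV'W : V.image (· + τ) ⊆ W := by
      intro w hw
      obtain ⟨v, hv, rfl⟩ := Finset.mem_image.1 hw
      obtain ⟨T, hT, hTv⟩ := hV v hv
      rw [hW, Set.Finite.mem_toFinset]
      exact ⟨T, hT, fun g hg => by rw [← ev_shift]; exact hTv g hg⟩
    have hcard : (V.image (· + τ)).card < G.card := Finset.card_image_le.trans_lt hVG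
    obtain ⟨h2, -⟩ := hα (G, V.image (· + τ)) hcard
    refine ⟨α (G, V.image (· + τ)), fun v hv => ?_, ?_⟩
    · simp only [ev_shift]
      exact h2 _ (Finset.mem_image_of_mem _ hv)
    · have h3 := hav (G, V.image (· + τ), p) (Finset.mem_filter.2 ⟨Finset.mem_product.2
        ⟨Finset.mem_univ _, Finset.mem_product.2 ⟨Finset.mem_powerset.2 hV'W, hp⟩⟩, hcard, hG⟩)
      simp only [ev_shift, ev_add, mul_add, Finset.sum_add_distrib]
      intro h4
      apply h3
      simp only [innerₛₗ_apply_apply, sum_inner, real_inner_smul_left]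
      simp only [real_inner_comm τ] at h4 ⊢
      linarith
  refine ⟨τ, by simpa using hτ, fun p hp g hg => ?_, hpg⟩
  obtain ⟨β, -, hβ⟩ := hpg p hp {g} (by simpa using Nat.succ_le_of_lt hd) ∅ (by simp) (by simp)
  exact hβ (by simp [hg])

end General

/-! ### A generic family containing a big simplex -/

section BigSimplex

variable {d : ℕ}

lemma exists_ev_eq (f : Pt d →ᵃ[ℝ] ℝ) : ∃ u : Pt d × ℝ, ∀ x, ev u x = f x := by
  refine ⟨((InnerProductSpace.toDual ℝ (Pt d)).symm (LinearMap.toContinuousLinearMap f.linear),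
    -f 0), fun x => ?_⟩
  have h : f x = f.linear x + f 0 := by
    simpa using f.map_vadd 0 x
  rw [h, ev, real_inner_comm]
  simp

lemma genLin_coord {κ : Type} (b : AffineBasis (Fin (d + 1)) ℝ (Pt d))
    (u : Option (Fin (d + 1) ⊕ κ) → Pt d × ℝ) (h0 : u none = (0, 1))
    (hu : ∀ i x, ev (u (some (Sum.inl i))) x = b.coord i x) :
    GenLin (d + 1) u (Finset.univ.map Function.Embedding.inl).insertNone := by
  intro G hG hcard β hβ
  set A : Finset (Option (Fin (d + 1) ⊕ κ)) :=
    (Finset.univ.map Function.Embedding.inl).insertNone with hA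
  have hAc : A.card = d + 2 := by simp [hA]
  obtain ⟨a, haA, haG⟩ := Finset.exists_mem_notMem_of_card_lt_card (show G.card < A.card by omega)
  set γ : Option (Fin (d + 1) ⊕ κ) → ℝ := fun o => if o ∈ G then β o else 0 with hγ
  have h1 : ∑ o ∈ A, γ o • u o = 0 := by
    rw [← hβ, ← Finset.sum_subset hG (fun o _ ho => by simp [hγ, ho])]
    exact Finset.sum_congr rfl fun o ho => by simp [hγ, ho]
  have h2 : ∀ j, γ (some (Sum.inl j)) = γ none := by
    intro j
    have h3 := congrArg (evLin (b j)) h1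
    rw [hA, Finset.sum_insertNone, Finset.sum_map, map_add, map_sum, h0, map_zero] at h3
    simp only [map_smul, evLin_apply, Function.Embedding.inl_apply, hu, smul_eq_mul,
      AffineBasis.coord_apply] at h3
    simp [ev] at h3
    linarith
  have h4 : γ none = 0 := by
    have ha : γ a = 0 := by simp [hγ, haG]
    rcases a with _ | (i | i)
    · exact ha
    · rw [← h2 i, ha]
    · simp [hA] at haA
  intro o ho
  have h5 : γ o = β o := by simp [hγ, ho]
  rw [← h5]
  have hoA := hG ho
  rcases o with _ | (i | i)
  · exact h4
  · rw [h2 i, h4]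
  · simp [hA] at hoA

lemma exists_affineBasis_pos (P : Finset (Pt d)) :
    ∃ b : AffineBasis (Fin (d + 1)) ℝ (Pt d), ∀ p ∈ P, ∀ i, 0 < b.coord i p := by
  have h0 := exists_mem_interior_convexHull_affineBasis (E := Pt d) (x := 0) Filter.univ_mem
  rw [finrank_euclideanSpace_fin] at h0
  obtain ⟨b, hb, -⟩ := h0
  rw [AffineBasis.interior_convexHull] at hb
  have h1 : ∀ᶠ t in 𝓝[>] (0 : ℝ), ∀ p ∈ P, ∀ i, 0 < b.coord i (t • p) := by
    rw [Filter.eventually_all_finset]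
    intro p _
    rw [Filter.eventually_all]
    intro i
    have hc : Continuous fun t : ℝ => b.coord i (t • p) :=
      (b.coord i).continuous_of_finiteDimensional.comp (by fun_prop)
    refine (hc.continuousAt.eventually (lt_mem_nhds ?_)).filter_mono nhdsWithin_le_nhds
    simpa using hb i
  obtain ⟨t, ht, htp⟩ := (h1.and self_mem_nhdsWithin).exists
  have ht0 : t ≠ 0 := ne_of_gt htp
  refine ⟨(Units.mk0 t ht0)⁻¹ • b, fun p hp i => ?_⟩
  rw [AffineBasis.coord_smul]
  simpa [Units.smul_def] using ht p hp i

lemma shift_zero (u : Pt d × ℝ) : shift 0 u = u := by simp [shift]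

lemma continuous_shift (u : Pt d × ℝ) : Continuous fun τ => shift τ u := by
  unfold shift; fun_prop

lemma exists_setting (hd : 0 < d) (P : Finset (Pt d)) :
    ∃ (R : ℝ) (M₀ : List (Pt d)), 0 < R ∧ IsSimplexIn (Metric.closedBall 0 R) M₀ ∧
      (∀ p ∈ P, p ∈ openHull M₀) ∧
      ∀ (κ : Type) [Fintype κ] (U : κ → Set (Pt d × ℝ)), (∀ i, IsOpen (U i)) →
        (∀ i, (U i).Nonempty) → ∃ (ℓ : Fin (d + 1) ⊕ κ → Pt d × ℝ) (c : Pt d),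
          Setting ℓ c (Finset.univ.map Function.Embedding.inl) P (Metric.closedBall 0 R) ∧
          ∀ i, ℓ (Sum.inr i) ∈ U i := by
  obtain ⟨b, hb⟩ := exists_affineBasis_pos P
  obtain ⟨R, hR⟩ := (Set.finite_range b).isBounded.exists_norm_le
  have hR0 : 0 ≤ R := (norm_nonneg _).trans (hR (b 0) ⟨0, rfl⟩)
  have hhull : ∀ x, x ∈ convexHull ℝ (Set.range b) → ‖x‖ ≤ R := by
    intro x hx
    have h1 : convexHull ℝ (Set.range b) ⊆ Metric.closedBall 0 R :=
      convexHull_min (fun y hy => by simpa using hR y hy) (convex_closedBall _ _)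
    simpa using h1 hx
  have hset : {x | x ∈ List.ofFn b} = Set.range b :=
    Set.ext fun x => List.mem_ofFn' b x
  have hopen : openHull (List.ofFn b) = interior (convexHull ℝ (Set.range b)) := by
    rw [openHull, hset]
  refine ⟨R + 1, List.ofFn b, by linarith, ⟨⟨b, b.ind, hopen⟩, fun x hx => ?_⟩, fun p hp => ?_, ?_⟩
  · rw [hopen] at hx
    have := hhull x (interior_subset hx)
    rw [mem_closedBall_zero_iff]
    linarith
  · rw [hopen, AffineBasis.interior_convexHull]
    exact hb p hp
  intro κ _ U hU hne
  choose w hw using fun i => exists_ev_eq (b.coord i)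
  obtain ⟨u, hu1, hu2, hgen⟩ := (genLin_coord b
      (homog (Sum.elim w fun _ : κ => 0)) rfl hw).exists_extend finrank_pt_prod.ge
      (fun o => o.elim Set.univ (Sum.elim (fun _ => Set.univ) U))
      (Finset.univ.map (Function.Embedding.inr.trans Function.Embedding.some))
      (by simpa using hU) (by simpa using hne)
  have hhom : homog (fun i => u (some i)) = u := by
    funext o
    rcases o with _ | i
    · exact (hu1 none (by simp)).symm
    · rfl
  replace hgen : GenLin (d + 1) (homog fun i => u (some i)) Finset.univ := by
    rw [hhom]
    convert hgen using 1
    ext o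
    rcases o with _ | (i | i) <;> simp
  have hev1 : ∀ᶠ τ in 𝓝 (0 : Pt d), ∀ i : κ, shift τ (u (some (Sum.inr i))) ∈ U i := by
    rw [Filter.eventually_all]
    intro i
    refine (continuous_shift _).continuousAt.eventually ((hU i).mem_nhds ?_)
    simp only [shift_zero]
    simpa using hu2 (some (Sum.inr i)) (by simp)
  have hev2 : ∀ᶠ τ in 𝓝 (0 : Pt d), ∀ p ∈ P, ∀ i, 0 < b.coord i (p + τ) := by
    rw [Filter.eventually_all_finset]
    intro p hp
    rw [Filter.eventually_all]
    intro i
    have hc : Continuous fun τ => b.coord i (p + τ) :=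
      (b.coord i).continuous_of_finiteDimensional.comp (by fun_prop)
    exact hc.continuousAt.eventually (lt_mem_nhds (by simpa using hb p hp i))
  obtain ⟨ε, hε, hball⟩ := Metric.eventually_nhds_iff.1 (hev1.and hev2)
  obtain ⟨τ, hτ, hoff, hpg⟩ :=
    exists_shift_pointGeneric hd hgen P (lt_min hε one_pos)
  obtain ⟨h1, h2⟩ := hball (y := τ) (by simpa using hτ.trans_le (min_le_left _ _))
  have hτ1 : ‖τ‖ ≤ 1 := (hτ.trans_le (min_le_right _ _)).le
  obtain ⟨c, hc⟩ := exists_generic hgen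
  have hinl : ∀ i x, ev (shift τ (u (some (Sum.inl i)))) x = b.coord i (x + τ) := by
    intro i x
    rw [ev_shift, hu1 _ (by simp)]
    exact hw i _
  have hcell : ∀ p ∈ P, closedCell (fun g => shift τ (u (some g)))
      (Finset.univ.map Function.Embedding.inl) p ⊆ Metric.closedBall 0 (R + 1) := by
    intro p hp x hx
    have h3 : x + τ ∈ convexHull ℝ (Set.range b) := by
      rw [AffineBasis.convexHull_eq_nonneg_coord]
      intro i
      have h4 := hx (Sum.inl i) (by simp)
      simp only [hinl] at h4
      exact nonneg_of_mul_nonneg_left h4 (h2 p hp i)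
    have h5 := hhull _ h3
    have h6 := norm_sub_le (x + τ) τ
    rw [add_sub_cancel_right] at h6
    rw [mem_closedBall_zero_iff]
    linarith
  refine ⟨fun g => shift τ (u (some g)), c, ⟨hc.shift τ, by simp, hoff, hpg, fun p hp => ?_, hcell⟩,
    h1⟩
  exact Metric.isCompact_of_isClosed_isBounded (isClosed_closedCell p)
    (Metric.isBounded_closedBall.subset (hcell p hp))

end BigSimplex

/-! ### Sandwiching a test hyperplane -/

section Sandwich

variable {d : ℕ}

lemma abs_ev_sub_ev_lt {u w : Pt d × ℝ} {x : Pt d} {R δ : ℝ} (hR : 0 < R) (hx : ‖x‖ ≤ R)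
    (hu : u ∈ Metric.ball w (δ / (R + 1))) : |ev u x - ev w x| < δ := by
  have h1 : dist u w < δ / (R + 1) := hu
  rw [lt_div_iff₀ (by linarith), dist_eq_norm] at h1
  have h2 : ev u x - ev w x = ⟪x, (u - w).1⟫ - (u - w).2 := by
    simp only [ev, Prod.fst_sub, Prod.snd_sub, inner_sub_right]; ring
  have h3 : |⟪x, (u - w).1⟫| ≤ R * ‖u - w‖ :=
    (abs_real_inner_le_norm _ _).trans (mul_le_mul hx (norm_fst_le _) (norm_nonneg _) hR.le)
  have h4 : |(u - w).2| ≤ ‖u - w‖ := norm_snd_le (u - w)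
  rw [h2]
  have h5 := abs_sub (⟪x, (u - w).1⟫) (u - w).2
  linarith

lemma convex_openHull (M : List (Pt d)) : Convex ℝ (openHull M) := (convex_convexHull ℝ _).interior

lemma ev_neg_of_forall_ne {u : Pt d × ℝ} {M : List (Pt d)} (h : ∀ x ∈ openHull M, ev u x ≠ 0)
    {x y : Pt d} (hx : x ∈ openHull M) (hy : y ∈ openHull M) (hxu : ev u x < 0) : ev u y < 0 := by
  by_contra! hyu
  obtain ⟨z, hz, hz0⟩ := (convex_openHull M).isPreconnected.intermediate_value hx hy
    (continuous_ev u).continuousOn ⟨hxu.le, hyu⟩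
  exact h z hz hz0

lemma ev_pos_of_forall_ne {u : Pt d × ℝ} {M : List (Pt d)} (h : ∀ x ∈ openHull M, ev u x ≠ 0)
    {x y : Pt d} (hx : x ∈ openHull M) (hy : y ∈ openHull M) (hxu : 0 < ev u x) : 0 < ev u y := by
  by_contra! hyu
  obtain ⟨z, hz, hz0⟩ := (convex_openHull M).isPreconnected.intermediate_value hy hx
    (continuous_ev u).continuousOn ⟨hyu, hxu.le⟩
  exact h z hz hz0

lemma IsSimplicialPartition.crossNumber_le {B : Set (Pt d)} {P : Finset (Pt d)} {k m : ℕ}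
    {parts : Fin m → Finset (Pt d)} {M : Fin m → List (Pt d)}
    (h : IsSimplicialPartition B P k parts M) (hk : 0 < k) (hP : GenPos P) {q u₁ u₂ : Pt d × ℝ}
    (hq : q.1 ≠ 0) {δ : ℝ} (hδ : ∀ p ∈ P, |ev q p| < 2 * δ → ev q p = 0)
    (h₁ : ∀ x ∈ B, |ev u₁ x - (ev q x - δ)| < δ) (h₂ : ∀ x ∈ B, |ev u₂ x - (ev q x + δ)| < δ) :
    crossNumber q M ≤ crossNumber u₁ M + crossNumber u₂ M + d := by
  unfold crossNumber
  set T := fun u : Pt d × ℝ => Finset.univ.filter fun i => ∃ x ∈ openHull (M i), ev u x = 0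
  have hpick : ∀ i, ∃ p, p ∈ parts i := fun i =>
    Finset.card_pos.1 (hk.trans_le (h.card i).1)
  choose p hp using hpick
  have hpP : ∀ i, p i ∈ P := fun i => (h.mem _).2 ⟨i, hp i⟩
  have hzero : ∀ i ∈ T q \ (T u₁ ∪ T u₂), ev q (p i) = 0 := by
    intro i hi
    simp only [T, Finset.mem_sdiff, Finset.mem_union, Finset.mem_filter, Finset.mem_univ, true_and,
      not_or, not_exists, not_and] at hi
    obtain ⟨⟨x, hx, hx0⟩, hn₁, hn₂⟩ := hi
    have hB := (h.simplex i).2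
    have hpi := h.sub i _ (hp i)
    have a1 := abs_lt.1 (h₁ x (hB hx))
    have a2 := abs_lt.1 (h₂ x (hB hx))
    have b1 := abs_lt.1 (h₁ _ (hB hpi))
    have b2 := abs_lt.1 (h₂ _ (hB hpi))
    have c1 := ev_neg_of_forall_ne hn₁ hx hpi (by linarith [a1.2])
    have c2 := ev_pos_of_forall_ne hn₂ hx hpi (by linarith [a2.1])
    exact hδ _ (hpP i) (abs_lt.2 ⟨by linarith [b2.2], by linarith [b1.1]⟩)
  have hle : (T q \ (T u₁ ∪ T u₂)).card ≤ d := by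
    refine le_trans ?_ (hP q.1 q.2 hq)
    rw [← Set.ncard_coe_finset]
    refine Set.ncard_le_ncard_of_injOn p (fun i hi => ⟨hpP i, ?_⟩) (fun i _ j _ hij => ?_)
      (P.finite_toSet.inter_of_left _)
    · have := hzero i (Finset.mem_coe.1 hi)
      exact sub_eq_zero.1 this
    · by_contra hne
      exact Finset.disjoint_left.1 (h.disj i j hne) (hp i) (hij ▸ hp j)
  have h1 : T q ⊆ (T u₁ ∪ T u₂) ∪ (T q \ (T u₁ ∪ T u₂)) := by
    rw [Finset.union_sdiff_self_eq_union]
    exact Finset.subset_union_right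
  calc (T q).card ≤ _ := Finset.card_le_card h1
    _ ≤ _ := Finset.card_union_le _ _
    _ ≤ _ := add_le_add (Finset.card_union_le _ _) hle

lemma exists_margin (Q : Finset (Pt d × ℝ)) (P : Finset (Pt d)) :
    ∃ δ : ℝ, 0 < δ ∧ ∀ q ∈ Q, ∀ p ∈ P, |ev q p| < 2 * δ → ev q p = 0 := by
  have h : ∀ᶠ δ in 𝓝[>] (0 : ℝ), ∀ q ∈ Q, ∀ p ∈ P, |ev q p| < 2 * δ → ev q p = 0 := by
    rw [Filter.eventually_all_finset]
    intro q _
    rw [Filter.eventually_all_finset]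
    intro p _
    by_cases h0 : ev q p = 0
    · simp [h0]
    · have hc : Continuous fun δ : ℝ => 2 * δ := by fun_prop
      have h1 : ∀ᶠ δ in 𝓝 (0 : ℝ), 2 * δ < |ev q p| :=
        hc.continuousAt.eventually (gt_mem_nhds (by simpa using h0))
      filter_upwards [h1.filter_mono nhdsWithin_le_nhds] with δ hδ hlt
      exact absurd hlt hδ.not_gt
  obtain ⟨δ, h1, h2⟩ := (h.and self_mem_nhdsWithin).exists
  exact ⟨δ, h2, h1⟩

end Sandwich

/-- Lemma 4.4: partition of a shallow point set with small crossing number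
with respect to a given finite set `Q` of hyperplanes, `d ≥ 3`. -/
theorem partition_lemma_for_test_set (d : ℕ) (hd : 3 ≤ d) :
    ∃ C : ℝ, 0 < C ∧
      ∀ (P : Finset (EuclideanSpace ℝ (Fin d))) (n k : ℕ),
        P.card = n → 2 ≤ k → (k : ℝ) ≤ (n : ℝ) / 2 →
        GenPos P → (∀ p ∈ P, IsShallowPt P k p) →
        ∀ (Q : Finset (EuclideanSpace ℝ (Fin d) × ℝ)),
          Q.Nonempty → (∀ q ∈ Q, q.1 ≠ 0) →
        ∃ (m : ℕ) (parts : Fin m → Finset (EuclideanSpace ℝ (Fin d)))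
          (Δ : Fin m → Set (EuclideanSpace ℝ (Fin d))),
          (∀ i j, i ≠ j → Disjoint (parts i) (parts j)) ∧
          (∀ p, p ∈ P ↔ ∃ i, p ∈ parts i) ∧
          (∀ i, k ≤ (parts i).card ∧ (parts i).card ≤ 2 * k) ∧
          (∀ i, IsOpenSimplex (Δ i)) ∧
          (∀ i, ↑(parts i) ⊆ Δ i) ∧
          (∀ q ∈ Q,
            (({i : Fin m | (hyperplane q.1 q.2 ∩ Δ i).Nonempty}.ncard : ℝ)
              ≤ C * (((n : ℝ) / k) ^ (1 - 1 / ((d : ℝ) - 1)) *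
                    Real.logb 2 ((n : ℝ) / k) ^ (2 / ((d : ℝ) - 1)) +
                  Real.logb 2 ((Q.card : ℝ) + 1)))) := by
  obtain ⟨e, rfl⟩ : ∃ e, d = e + 1 := ⟨d - 1, by omega⟩
  obtain ⟨K, hK, hmain⟩ := exists_partition_of_setting (e := e) (by omega)
  refine ⟨7 + e + 2 * K, by positivity, ?_⟩
  rintro P n k rfl hk hkn hP hsh Q hQ hQ0
  have h2k : 2 * k ≤ P.card := by
    have : (2 * k : ℝ) ≤ P.card := by linarith
    exact_mod_cast this
  obtain ⟨R, M₀, hR, hM₀, hPM₀, hset⟩ := exists_setting (Nat.succ_pos e) P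
  obtain ⟨δ, hδ, hmargin⟩ := exists_margin Q P
  have hρ : 0 < δ / (R + 1) := by positivity
  obtain ⟨ℓ, c, hS, hℓ⟩ := hset ({q // q ∈ Q} × Bool)
    (fun i => Metric.ball (i.1.1.1, i.1.1.2 + if i.2 then δ else -δ) (δ / (R + 1)))
    (fun _ => Metric.isOpen_ball) (fun _ => ⟨_, Metric.mem_ball_self hρ⟩)
  have : Nonempty {q // q ∈ Q} := hQ.to_subtype
  obtain ⟨m, parts, M, hpart, hcross⟩ := hmain _ ({q // q ∈ Q} × Bool) ℓ c _ P _ k Sum.inr M₀ hS hsh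
    (by omega) h2k hM₀ hPM₀
  refine ⟨m, parts, fun i => openHull (M i), hpart.disj, hpart.mem, hpart.card,
    fun i => (hpart.simplex i).1, fun i p hp => hpart.sub i p hp, fun q hq => ?_⟩
  have hnear : ∀ s : Bool, ∀ x ∈ Metric.closedBall (0 : Pt (e + 1)) R,
      |ev (ℓ (Sum.inr (⟨q, hq⟩, s))) x - (ev q x - if s then δ else -δ)| < δ := by
    intro s x hx
    have h1 := abs_ev_sub_ev_lt hR (by simpa using hx) (hℓ (⟨q, hq⟩, s))
    have h2 : ev (q.1, q.2 + if s then δ else -δ) x = ev q x - if s then δ else -δ := by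
      simp only [ev]; ring
    rwa [← h2]
  have hle := hpart.crossNumber_le (by omega) hP (hQ0 q hq) (hmargin q hq)
    (by simpa using hnear true) (by simpa using hnear false)
  have h1 := hcross (⟨q, hq⟩, true)
  have h2 := hcross (⟨q, hq⟩, false)
  have hcr : {i : Fin m | (hyperplane q.1 q.2 ∩ openHull (M i)).Nonempty}.ncard =
      crossNumber q M := by
    rw [crossNumber, ← Set.ncard_coe_finset]
    congr 1
    ext i
    simp only [Set.mem_ofPred_eq, Finset.coe_filter, Finset.mem_univ, true_and]
    exact ⟨fun ⟨x, hx, hxM⟩ => ⟨x, hxM, sub_eq_zero.2 hx⟩,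
      fun ⟨x, hxM, hx⟩ => ⟨x, sub_eq_zero.1 hx, hxM⟩⟩
  rw [hcr]
  have hexp : ((e + 1 : ℕ) : ℝ) - 1 = e := by push_cast; ring
  rw [hexp]
  set X := ((P.card : ℝ) / k) ^ (1 - 1 / (e : ℝ)) * Real.logb 2 ((P.card : ℝ) / k) ^ (2 / (e : ℝ))
    with hX
  have hQ1 : (1 : ℝ) ≤ Q.card := by exact_mod_cast hQ.card_pos
  have hlog : Real.logb 2 (Fintype.card ({q // q ∈ Q} × Bool) : ℝ) ≤
      1 + Real.logb 2 ((Q.card : ℝ) + 1) := by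
    rw [Fintype.card_prod, Fintype.card_coe, Fintype.card_bool, Nat.cast_mul,
      Real.logb_mul (by positivity) (by norm_num)]
    have h3 : Real.logb 2 (Q.card : ℝ) ≤ Real.logb 2 ((Q.card : ℝ) + 1) :=
      Real.logb_le_logb_of_le (by norm_num) (by linarith) (by linarith)
    have h4 : Real.logb 2 ((2 : ℕ) : ℝ) = 1 := by
      rw [Nat.cast_ofNat]; exact Real.logb_self_eq_one (by norm_num)
    linarith
  have hL : 1 ≤ Real.logb 2 ((Q.card : ℝ) + 1) := one_le_logb_two (by linarith)
  have hk0 : (0 : ℝ) < k := by exact_mod_cast (by omega : 0 < k)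
  have hr : (2 : ℝ) ≤ (P.card : ℝ) / k := by
    rw [le_div_iff₀ hk0]; linarith
  have hX0 : 0 ≤ X :=
    mul_nonneg (Real.rpow_nonneg (by linarith) _)
      (Real.rpow_nonneg (by linarith [one_le_logb_two hr]) _)
  have hle' : (crossNumber q M : ℝ) ≤ crossNumber (ℓ (Sum.inr (⟨q, hq⟩, true))) M +
      crossNumber (ℓ (Sum.inr (⟨q, hq⟩, false))) M + (e + 1) := by exact_mod_cast hle
  have he0 : (0 : ℝ) ≤ e := Nat.cast_nonneg e
  nlinarith [mul_nonneg he0 hX0, mul_nonneg he0 (sub_nonneg.2 hL),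
    mul_nonneg hK.le (zero_le_one.trans hL)]
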